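/- arXiv:0812.0667 — 8 statements merged into one kernel-verified Lean document; each statement's English description precedes it below -/
import Mathlib

section
/- Let R be a commutative ring, G a finite simple graph on a vertex set I, and let T = {T^{(a)}_m(u)} be a regular solution of the unrestricted T-system 𝕋(G) in R. Define, for a ∈ I, m ≥ 1, u ∈ ℤ, Y^{(a)}_m(u) := (∏_{b adjacent to a} T^{(b)}_m(u)) · (T^{(a)}_{m−1}(u) · T^{(a)}_{m+1}(u))^{−1} (with T^{(a)}_0(u) = 1). Then: (i) each Y^{(a)}_m(u) is invertible; (ii) 1 + Y^{(a)}_m(u) = T^{(a)}_m(u−1) · T^{(a)}_m(u+1) · (T^{(a)}_{m−1}(u) · T^{(a)}_{m+1}(u))^{−1}, in particular 1 + Y^{(a)}_m(u) is invertible; and (iii) the family Y = {Y^{(a)}_m(u)} is a regular solution of the unrestricted Y-system 𝕐(G) in R. -/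
/-- For a regular solution `T` of the unrestricted T-system `𝕋(G)` on a finite simple
graph `G`, the family `Y` defined by `Y^{(a)}_m(u) = (∏_{b ∼ a} T^{(b)}_m(u)) /
(T^{(a)}_{m-1}(u) T^{(a)}_{m+1}(u))` is a regular solution of the unrestricted
Y-system `𝕐(G)`. -/
theorem unrestricted_T_to_Y {R : Type*} [CommRing R] {I : Type*} [Fintype I] [DecidableEq I]
    (G : SimpleGraph I) [DecidableRel G.Adj]
    (T : I → ℕ → ℤ → R)
    (hT0 : ∀ a u, T a 0 u = 1)
    (hTunit : ∀ a m u, 1 ≤ m → IsUnit (T a m u))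
    (hTsys : ∀ a m u, 1 ≤ m →
      T a m (u - 1) * T a m (u + 1)
        = T a (m - 1) u * T a (m + 1) u + ∏ b ∈ G.neighborFinset a, T b m u)
    (Y : I → ℕ → ℤ → R)
    (hY : ∀ a m u, 1 ≤ m →
      Y a m u = (∏ b ∈ G.neighborFinset a, T b m u)
        * Ring.inverse (T a (m - 1) u * T a (m + 1) u)) :
    (∀ a m u, 1 ≤ m → IsUnit (Y a m u)) ∧
    (∀ a m u, 1 ≤ m →
      1 + Y a m u
        = T a m (u - 1) * T a m (u + 1) * Ring.inverse (T a (m - 1) u * T a (m + 1) u)) ∧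
    (∀ a m u, 1 ≤ m → IsUnit (1 + Y a m u)) ∧
    (∀ a m u, 1 ≤ m →
      Y a m (u - 1) * Y a m (u + 1)
          * (if m = 1 then 1 else 1 + Ring.inverse (Y a (m - 1) u))
          * (1 + Ring.inverse (Y a (m + 1) u))
        = ∏ b ∈ G.neighborFinset a, (1 + Y b m u)) := by
  have hu : ∀ a m u, IsUnit (T a m u) := by
    intro a m u
    rcases Nat.eq_zero_or_pos m with h | h
    · subst h
      rw [hT0]
      exact isUnit_one
    · exact hTunit a m u h
  choose t ht using hu
  have ht0 : ∀ a u, t a 0 u = 1 := by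
    intro a u
    apply Units.ext
    rw [ht, hT0, Units.val_one]
  obtain ⟨p, hp⟩ : ∃ p : I → ℕ → ℤ → Rˣ,
      ∀ a m u, p a m u = ∏ b ∈ G.neighborFinset a, t b m u := ⟨_, fun _ _ _ => rfl⟩
  have hP : ∀ a m u, ∏ b ∈ G.neighborFinset a, T b m u = (p a m u : R) := by
    intro a m u
    rw [hp, Units.coe_prod]
    exact Finset.prod_congr rfl fun b _ => (ht b m u).symm
  have hp0 : ∀ a u, p a 0 u = 1 := by
    intro a u
    rw [hp]
    exact Finset.prod_eq_one fun b _ => ht0 b u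
  have hinv : ∀ a m u, Ring.inverse (T a (m - 1) u * T a (m + 1) u)
      = (((t a (m - 1) u * t a (m + 1) u)⁻¹ : Rˣ) : R) := by
    intro a m u
    rw [← ht, ← ht, ← Units.val_mul, Ring.inverse_unit]
  have hYu : ∀ a m u, 1 ≤ m →
      Y a m u = ((p a m u * (t a (m - 1) u * t a (m + 1) u)⁻¹ : Rˣ) : R) := by
    intro a m u hm
    rw [hY a m u hm, hP, hinv, Units.val_mul]
  have hS : ∀ a m u, 1 ≤ m → ((t a m (u - 1) * t a m (u + 1) : Rˣ) : R)
      = ((t a (m - 1) u * t a (m + 1) u : Rˣ) : R) + (p a m u : R) := by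
    intro a m u hm
    have := hTsys a m u hm
    rw [hP] at this
    simpa only [Units.val_mul, ht] using this
  have h1 : ∀ a m u, 1 ≤ m → 1 + Y a m u
      = ((t a m (u - 1) * t a m (u + 1) * (t a (m - 1) u * t a (m + 1) u)⁻¹ : Rˣ) : R) := by
    intro a m u hm
    rw [hYu a m u hm, Units.val_mul, Units.val_mul (t a m (u - 1) * t a m (u + 1)),
      hS a m u hm, add_mul, Units.mul_inv]
  have h2 : ∀ a m u, 1 ≤ m → 1 + Ring.inverse (Y a m u)
      = ((t a m (u - 1) * t a m (u + 1) * (p a m u)⁻¹ : Rˣ) : R) := by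
    intro a m u hm
    rw [hYu a m u hm, Ring.inverse_unit, Units.val_mul (t a m (u - 1) * t a m (u + 1)),
      hS a m u hm, add_mul, Units.mul_inv, mul_inv, inv_inv, mul_comm (p a m u)⁻¹,
      Units.val_mul, add_comm]
  have h3 : ∀ a m u, 1 ≤ m → (if m = 1 then 1 else 1 + Ring.inverse (Y a (m - 1) u))
      = ((t a (m - 1) (u - 1) * t a (m - 1) (u + 1) * (p a (m - 1) u)⁻¹ : Rˣ) : R) := by
    intro a m u hm
    split_ifs with h
    · subst h
      simp [ht0, hp0]
    · exact h2 a (m - 1) u (by omega)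
  refine ⟨fun a m u hm => ?_, fun a m u hm => ?_, fun a m u hm => ?_, fun a m u hm => ?_⟩
  · rw [hYu a m u hm]
    exact Units.isUnit _
  · rw [h1 a m u hm, hinv, Units.val_mul, Units.val_mul, ht, ht]
  · rw [h1 a m u hm]
    exact Units.isUnit _
  · rw [Finset.prod_congr rfl fun b _ => h1 b m u hm, ← Units.coe_prod, h3 a m u hm,
      h2 a (m + 1) u (by omega), hYu a m _ hm, hYu a m _ hm, ← Units.val_mul, ← Units.val_mul,
      ← Units.val_mul]
    congr 1
    simp only [Finset.prod_mul_distrib, Finset.prod_inv_distrib, ← hp]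
    generalize t a (m - 1) (u - 1) = x1
    generalize t a (m - 1) (u + 1) = x2
    generalize t a (m + 1) (u - 1) = x3
    generalize t a (m + 1) (u + 1) = x4
    rw [eq_mul_inv_iff_mul_eq]
    generalize p a (m - 1) u = q1
    generalize p a (m + 1) u = q2
    have : ∀ A B : Rˣ, A * (x1 * x3)⁻¹ * (B * (x2 * x4)⁻¹) * (x1 * x2 * q1⁻¹)
        * (x3 * x4 * q2⁻¹) * (q1 * q2) = A * B * ((x1 * x1⁻¹) * (x2 * x2⁻¹) * (x3 * x3⁻¹)
        * (x4 * x4⁻¹) * (q1 * q1⁻¹) * (q2 * q2⁻¹)) := by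
      intro A B
      simp only [mul_inv]
      ac_rfl
    rw [this]
    simp
end

section
/- Let R be a commutative ring and G a finite simple graph on a vertex set I. For every regular solution Y = {Y^{(a)}_m(u)} of the unrestricted Y-system 𝕐(G) in R, there exists a regular solution T = {T^{(a)}_m(u)} of the unrestricted T-system 𝕋(G) in R such that Y^{(a)}_m(u) = (∏_{b adjacent to a} T^{(b)}_m(u)) · (T^{(a)}_{m−1}(u) · T^{(a)}_{m+1}(u))^{−1} for all a ∈ I, m ≥ 1, u ∈ ℤ (with T^{(a)}_0(u) = 1). -/
theorem aux_int_seq {X : Type*} (F : ℤ → X ≃ X) (x : X) :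
    ∃ s : ℤ → X, ∀ u, s (u + 1) = F u (s u) := by
  let f : ℕ → X := fun n => Nat.rec x (fun k z => F (k : ℤ) z) n
  let g : ℕ → X := fun n => Nat.rec x (fun k z => (F (-(k : ℤ) - 1)).symm z) n
  refine ⟨fun u => if 0 ≤ u then f u.toNat else g (-u).toNat, fun u => ?_⟩
  obtain ⟨n, rfl | rfl⟩ := u.eq_nat_or_neg
  · have h1 : ((n : ℤ) + 1).toNat = n + 1 := by omega
    have h2 : (0 : ℤ) ≤ (n : ℤ) + 1 := by omega
    simp [h1, h2, f]
  · cases n with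
    | zero => simp [f]
    | succ k =>
      have hg : g (k + 1) = (F (-(k : ℤ) - 1)).symm (g k) := rfl
      have e : (-((k + 1 : ℕ) : ℤ)) = -(k : ℤ) - 1 := by push_cast; ring
      have h1 : ¬ (0 : ℤ) ≤ -(k : ℤ) - 1 := by omega
      have h2 : (-(-(k : ℤ) - 1)).toNat = k + 1 := by omega
      have h3 : (-(k : ℤ) - 1 + 1) = -(k : ℤ) := by ring
      simp only [e, h1, h2, h3, if_false, hg, Equiv.apply_symm_apply]
      cases k with
      | zero => simp [f, g]
      | succ j =>
        have h4 : ¬ (0 : ℤ) ≤ -((j + 1 : ℕ) : ℤ) := by omega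
        have h5 : (- -((j + 1 : ℕ) : ℤ)).toNat = j + 1 := by omega
        simp only [h4, h5, if_false]

theorem aux_row {A I : Type*} [CommGroup A] (N : I → Finset I) (w : I → ℤ → A) :
    ∃ t : I → ℤ → A, ∀ a u, t a (u - 1) * t a (u + 1) = w a u * ∏ b ∈ N a, t b u := by
  let F : ℤ → ((I → A) × (I → A)) ≃ ((I → A) × (I → A)) := fun u =>
    { toFun := fun x => (x.2, fun a => w a (u + 1) * (∏ b ∈ N a, x.2 b) / x.1 a)
      invFun := fun x => (fun a => w a (u + 1) * (∏ b ∈ N a, x.1 b) / x.2 a, x.1)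
      left_inv := fun x => by ext <;> simp
      right_inv := fun x => by ext <;> simp }
  obtain ⟨s, hs⟩ := aux_int_seq F (1, 1)
  have h2 : ∀ u, (s u).2 = (s (u + 1)).1 := fun u => by rw [hs u]; rfl
  refine ⟨fun a u => (s u).1 a, fun a u => ?_⟩
  have h := hs (u - 1)
  have h3 := h2 (u - 1)
  rw [sub_add_cancel] at h h3
  have h4 : (s u).2 a = w a (u - 1 + 1) * (∏ b ∈ N a, (s (u - 1)).2 b) / (s (u - 1)).1 a := by
    rw [h]; rfl
  rw [sub_add_cancel, h3, h2 u] at h4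
  simp only [h4]
  exact mul_div_cancel _ _

theorem aux_group {A I : Type*} [CommGroup A] (N : I → Finset I) (y p : I → ℕ → ℤ → A)
    (h0 : ∀ a u, p a 0 u / y a 0 u = 1)
    (hs : ∀ a n u, y a (n + 1) (u - 1) * y a (n + 1) (u + 1) * (p a n u / y a n u)
      * (p a (n + 2) u / y a (n + 2) u) = ∏ b ∈ N a, p b (n + 1) u) :
    ∃ T : I → ℕ → ℤ → A, (∀ a u, T a 0 u = 1) ∧
      (∀ a n u, T a n (u - 1) * T a n (u + 1) = p a n u / y a n u * ∏ b ∈ N a, T b n u) ∧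
      (∀ a n u, y a (n + 1) u * (T a n u * T a (n + 2) u) = ∏ b ∈ N a, T b (n + 1) u) := by
  obtain ⟨t, ht⟩ := aux_row N (fun a u => p a 1 u / y a 1 u)
  let P : ℕ → (I → ℤ → A) × (I → ℤ → A) := fun n => Nat.rec (1, t)
    (fun k x => (x.2, fun a u => (∏ b ∈ N a, x.2 b u) / (y a (k + 1) u * x.1 a u))) n
  let T : I → ℕ → ℤ → A := fun a n u => (P n).1 a u
  have T0 : ∀ a u, T a 0 u = 1 := fun a u => rfl
  have T1 : ∀ a u, T a 1 u = t a u := fun a u => rfl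
  have T2 : ∀ a n u, T a (n + 2) u
      = (∏ b ∈ N a, T b (n + 1) u) / (y a (n + 1) u * T a n u) := fun a n u => rfl
  have hY : ∀ a n u, y a (n + 1) u * (T a n u * T a (n + 2) u) = ∏ b ∈ N a, T b (n + 1) u := by
    intro a n u
    rw [T2, ← mul_assoc]; exact mul_div_cancel _ _
  refine ⟨T, T0, ?_, hY⟩
  have key : ∀ n, (∀ a u, T a n (u - 1) * T a n (u + 1)
        = p a n u / y a n u * ∏ b ∈ N a, T b n u) ∧
      (∀ a u, T a (n + 1) (u - 1) * T a (n + 1) (u + 1)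
        = p a (n + 1) u / y a (n + 1) u * ∏ b ∈ N a, T b (n + 1) u) := by
    intro n
    induction n with
    | zero =>
      refine ⟨fun a u => ?_, fun a u => ?_⟩
      · simp [T0, h0]
      · simpa [T1] using ht a u
    | succ n ih =>
      refine ⟨ih.2, fun a u => ?_⟩
      have e1 := hY a n (u - 1)
      have e2 := hY a n (u + 1)
      have e3 := ih.1 a u
      have e4 : (∏ b ∈ N a, T b (n + 1) (u - 1)) * (∏ b ∈ N a, T b (n + 1) (u + 1))
          = (∏ b ∈ N a, p b (n + 1) u) * ((∏ b ∈ N a, T b n u) * ∏ b ∈ N a, T b (n + 2) u) := by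
        simp only [← Finset.prod_mul_distrib]
        refine Finset.prod_congr rfl fun b _ => ?_
        rw [ih.2 b u, ← hY b n u, ← mul_assoc, div_mul_cancel]
      rw [← e1, ← e2, ← hs a n u] at e4
      generalize (∏ b ∈ N a, T b n u) = M0 at *
      show T a (n + 2) (u - 1) * T a (n + 2) (u + 1)
        = p a (n + 2) u / y a (n + 2) u * ∏ b ∈ N a, T b (n + 2) u
      generalize (∏ b ∈ N a, T b (n + 2) u) = M2 at *
      apply mul_left_cancel (a := y a (n + 1) (u - 1) * y a (n + 1) (u + 1)
        * (T a n (u - 1) * T a n (u + 1)))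
      calc _ = y a (n + 1) (u - 1) * (T a n (u - 1) * T a (n + 2) (u - 1)) *
          (y a (n + 1) (u + 1) * (T a n (u + 1) * T a (n + 2) (u + 1))) := by
            simp only [mul_assoc, mul_left_comm, mul_comm]
        _ = _ := e4
        _ = _ := by
            rw [e3]; simp only [mul_assoc, mul_left_comm, mul_comm]
  exact fun a n u => (key n).1 a u


/-- Every regular solution `Y` of the unrestricted Y-system `𝕐(G)` on a finite simple
graph `G` arises from a regular solution `T` of the unrestricted T-system `𝕋(G)` via
`Y^{(a)}_m(u) = (∏_{b ∼ a} T^{(b)}_m(u)) / (T^{(a)}_{m-1}(u) T^{(a)}_{m+1}(u))`. -/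
theorem unrestricted_Y_lifts_to_T {R : Type*} [CommRing R] {I : Type*} [Fintype I]
    [DecidableEq I] (G : SimpleGraph I) [DecidableRel G.Adj]
    (Y : I → ℕ → ℤ → R)
    (hYunit : ∀ a m u, 1 ≤ m → IsUnit (Y a m u))
    (hY1unit : ∀ a m u, 1 ≤ m → IsUnit (1 + Y a m u))
    (hYsys : ∀ a m u, 1 ≤ m →
      Y a m (u - 1) * Y a m (u + 1)
          * (if m = 1 then 1 else 1 + Ring.inverse (Y a (m - 1) u))
          * (1 + Ring.inverse (Y a (m + 1) u))
        = ∏ b ∈ G.neighborFinset a, (1 + Y b m u)) :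
    ∃ T : I → ℕ → ℤ → R,
      (∀ a u, T a 0 u = 1) ∧
      (∀ a m u, 1 ≤ m → IsUnit (T a m u)) ∧
      (∀ a m u, 1 ≤ m →
        T a m (u - 1) * T a m (u + 1)
          = T a (m - 1) u * T a (m + 1) u + ∏ b ∈ G.neighborFinset a, T b m u) ∧
      (∀ a m u, 1 ≤ m →
        Y a m u = (∏ b ∈ G.neighborFinset a, T b m u)
          * Ring.inverse (T a (m - 1) u * T a (m + 1) u)) := by
  let y : I → ℕ → ℤ → Rˣ := fun a m u =>
    if h : 1 ≤ m then (hYunit a m u h).unit else 1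
  let p : I → ℕ → ℤ → Rˣ := fun a m u =>
    if h : 1 ≤ m then (hY1unit a m u h).unit else 1
  have hy : ∀ a m u, 1 ≤ m → (y a m u : R) = Y a m u := fun a m u h => by simp [y, h]
  have hp : ∀ a m u, 1 ≤ m → (p a m u : R) = 1 + Y a m u := fun a m u h => by simp [p, h]
  have hw : ∀ a m u, 1 ≤ m → ((p a m u / y a m u : Rˣ) : R) = 1 + Ring.inverse (Y a m u) := by
    intro a m u h
    rw [← hy a m u h, Ring.inverse_unit, div_eq_mul_inv, Units.val_mul, hp a m u h, ← hy a m u h,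
      add_mul, Units.mul_inv, one_mul, add_comm]
  have h0 : ∀ a u, p a 0 u / y a 0 u = 1 := fun a u => by simp [p, y]
  obtain ⟨T, T0, hT, hTY⟩ := aux_group (fun a => G.neighborFinset a) y p h0 (by
    intro a n u
    ext
    have h := hYsys a (n + 1) u (by omega)
    have hif : (if n + 1 = 1 then (1 : R) else 1 + Ring.inverse (Y a (n + 1 - 1) u))
        = ((p a n u / y a n u : Rˣ) : R) := by
      cases n with
      | zero => simp [h0]
      | succ k => rw [hw a (k + 1) u (by omega)]; simp
    rw [hif] at h
    rw [Units.val_mul, Units.val_mul, Units.val_mul, hw a (n + 2) u (by omega),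
      hy a _ _ (by omega), hy a _ _ (by omega), h, Units.coe_prod]
    exact Finset.prod_congr rfl fun b _ => (hp b _ _ (by omega)).symm)
  have hTY' : ∀ a n u, Y a (n + 1) u * ((T a n u : R) * (T a (n + 2) u : R))
      = ∏ b ∈ G.neighborFinset a, (T b (n + 1) u : R) := by
    intro a n u
    have h := congrArg (Units.val) (hTY a n u)
    simpa [Units.coe_prod, hy a (n + 1) u (by omega)] using h
  refine ⟨fun a m u => (T a m u : R), fun a u => by simp [T0], fun a m u _ => (T a m u).isUnit,
    ?_, ?_⟩
  · intro a m u hm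
    obtain ⟨n, rfl⟩ : ∃ n, m = n + 1 := ⟨m - 1, by omega⟩
    have h := congrArg (Units.val) (hT a (n + 1) u)
    rw [← hTY a n u, ← mul_assoc, div_mul_cancel] at h
    simp only [Units.val_mul, hp a (n + 1) u (by omega)] at h
    simp only [Nat.add_sub_cancel]
    rw [h, ← hTY' a n u]
    ring
  · intro a m u hm
    obtain ⟨n, rfl⟩ : ∃ n, m = n + 1 := ⟨m - 1, by omega⟩
    simp only [Nat.add_sub_cancel]
    rw [← hTY' a n u, ← Units.val_mul, Ring.inverse_unit, Units.mul_inv_cancel_right]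
end

section
/- Let R be a commutative ring, r ≥ 1 and ℓ ≥ 2 integers, and let T = {T^{(a)}_m(u)} be a regular solution in R of the level ℓ restricted T-system 𝕋̃_ℓ(A_r) with spiral boundary condition, indexed by H = {(a,m,u) : 0 ≤ a ≤ r+1, 0 ≤ m ≤ ℓ, u ∈ ℤ}. Then for all (a,m,u) ∈ H: (1) half-periodicity: T^{(a)}_m(u + r + 1 + ℓ) = T^{(r+1−a)}_{ℓ−m}(u); (2) periodicity: T^{(a)}_m(u + 2(r + 1 + ℓ)) = T^{(a)}_m(u). -/
namespace SpiralT

def D {R : Type*} [CommRing R] (k : ℕ) (v : ℕ → Fin (k+1) → R) (a m x : ℕ) : R :=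
  Matrix.det (fun i : Fin (k+1) => v (if (i:ℕ) < a then x + i else x + m + i) :
    Matrix (Fin (k+1)) (Fin (k+1)) R)

lemma D_congr {R : Type*} [CommRing R] (k : ℕ) (v v' : ℕ → Fin (k+1) → R) (a m x a' m' x' : ℕ)
    (h : ∀ i, i < k+1 → v (if i < a then x + i else x + m + i) =
      v' (if i < a' then x' + i else x' + m' + i)) : D k v a m x = D k v' a' m' x' := by
  unfold D
  congr 1
  funext i
  exact h i i.2

lemma urow {R : Type*} [CommRing R] {n : ℕ} (M : Matrix (Fin n) (Fin n) R) (i i' : Fin n)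
    (b : Fin n → R) : M.updateRow i b i' = if (i' : ℕ) = i then b else M i' := by
  by_cases h : i' = i
  · subst h; simp
  · rw [Matrix.updateRow_ne h, if_neg (fun hh => h (Fin.ext hh))]

lemma rot1 {R : Type*} [CommRing R] (k : ℕ) (w : ℕ → Fin (k+1) → R)
    (h : w (k+1) = (-1:R)^k • w 0) :
    Matrix.det (fun i : Fin (k+1) => w (i+1) : Matrix (Fin (k+1)) (Fin (k+1)) R) =
    Matrix.det (fun i : Fin (k+1) => w i : Matrix (Fin (k+1)) (Fin (k+1)) R) := by
  set M : Matrix (Fin (k+1)) (Fin (k+1)) R := fun i => w i with hM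
  have e1 : (fun i : Fin (k+1) => w (i+1) : Matrix (Fin (k+1)) (Fin (k+1)) R) =
      (M.submatrix (finRotate (k+1)) id).updateRow (Fin.last k) ((-1:R)^k • w 0) := by
    funext i
    by_cases hi : i = Fin.last k
    · subst hi
      simp [h]
    · rw [Matrix.updateRow_ne hi]
      have : (i:ℕ) < k := by
        have := i.2
        have : (i:ℕ) ≠ k := fun h => hi (Fin.ext h)
        omega
      funext j
      change _ = w (finRotate (k+1) i : ℕ) j
      rw [coe_finRotate_of_ne_last hi]
  have e2 : (M.submatrix (finRotate (k+1)) id).updateRow (Fin.last k) (w 0) =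
      (M.submatrix (finRotate (k+1)) id) := by
    funext i
    by_cases hi : i = Fin.last k
    · subst hi
      rw [Matrix.updateRow_self]
      change _ = w (finRotate (k+1) (Fin.last k) : ℕ)
      simp
    · rw [Matrix.updateRow_ne hi]
  rw [e1, Matrix.det_updateRow_smul, e2, Matrix.det_permute, sign_finRotate]
  simp only [Units.val_pow_eq_pow_val, Int.cast_pow, Units.val_neg, Units.val_one, Int.cast_neg, Int.cast_one]
  rw [Nat.add_sub_cancel, ← mul_assoc, ← mul_pow]
  simp

lemma rot {R : Type*} [CommRing R] (k : ℕ) (w : ℕ → Fin (k+1) → R)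
    (h : ∀ i, i < k + 1 → w (i + (k+1)) = (-1:R)^k • w i) (j : ℕ) (hj : j ≤ k+1) :
    Matrix.det (fun i : Fin (k+1) => w (i+j) : Matrix (Fin (k+1)) (Fin (k+1)) R) =
    Matrix.det (fun i : Fin (k+1) => w i : Matrix (Fin (k+1)) (Fin (k+1)) R) := by
  induction j with
  | zero => rfl
  | succ j ih =>
    rw [← ih (by omega)]
    have := rot1 k (fun i => w (i + j)) (by
      have := h j (by omega)
      simp only [zero_add]
      rw [← this]; congr 1; omega)
    rw [← this]
    congr 1
    funext i
    congr 1
    omega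

lemma D_symm {R : Type*} [CommRing R] (k l : ℕ) (v : ℕ → Fin (k+1) → R)
    (hv : ∀ i, v (i + (k + 1 + l)) = (-1:R)^k • v i) (a m x : ℕ) (ha : a ≤ k+1) (hm : m ≤ l) :
    D k v a m x = D k v (k+1-a) (l-m) (x+a+m) := by
  have := rot k (fun i => if i < k+1 then v (if i < a then x + i else x + m + i) else
    (-1:R)^k • v (if i - (k+1) < a then x + (i-(k+1)) else x + m + (i-(k+1))))
    (by intro i hi; rw [if_neg (by omega), if_pos hi, Nat.add_sub_cancel]) a ha
  unfold D
  refine Eq.trans ?_ (this.symm.trans ?_)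
  · congr 1
    funext i
    rw [if_pos i.2]
  · congr 1
    funext i
    have hi := i.2
    by_cases h : (i:ℕ) < k + 1 - a
    · rw [if_pos h, if_pos (by omega), if_neg (by omega)]
      congr 1; omega
    · rw [if_neg h, if_neg (by omega), if_pos (by omega), ← hv]
      congr 1; omega

lemma plucker {R : Type*} [CommRing R] {n : ℕ} (e : Matrix (Fin n) (Fin n) R) (i0 i1 : Fin n)
    (hne : i0 ≠ i1) (q t : Fin n → R) :
    e.det * ((e.updateRow i0 q).updateRow i1 t).det =
      (e.updateRow i0 q).det * (e.updateRow i1 t).det +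
      ((e.updateRow i0 (e i1)).updateRow i1 t).det * (e.updateRow i1 q).det := by
  have hq : e.det • q = ∑ i, (e.updateRow i q).det • e i := by
    have := Matrix.mulVec_cramer e.transpose q
    rw [Matrix.det_transpose] at this
    rw [← this]
    funext j
    simp [Matrix.mulVec, dotProduct, Matrix.cramer_transpose_apply, mul_comm]
  have hL : ∀ q, ((e.updateRow i0 q).updateRow i1 t).det =
      (Matrix.detRowAlternating.toMultilinearMap.toLinearMap (e.updateRow i1 t) i0) q := by
    intro q
    rw [Matrix.updateRow_comm _ hne]
    rfl
  have h0 : ∀ i, i ≠ i0 → i ≠ i1 → ((e.updateRow i0 (e i)).updateRow i1 t).det = 0 := by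
    intro i h0 h1
    apply Matrix.det_zero_of_row_eq h0
    rw [Matrix.updateRow_ne h1, Matrix.updateRow_ne h0, Matrix.updateRow_ne hne,
      Matrix.updateRow_self]
  have h00 : e.updateRow i0 (e i0) = e := Matrix.updateRow_eq_self e i0
  have : e.det * ((e.updateRow i0 q).updateRow i1 t).det =
      ∑ i, (e.updateRow i q).det * ((e.updateRow i0 (e i)).updateRow i1 t).det := by
    rw [hL, ← smul_eq_mul, ← map_smul, hq, map_sum]
    refine Finset.sum_congr rfl fun i _ => ?_
    rw [map_smul, smul_eq_mul, hL]
  rw [this, ← Finset.sum_subset (Finset.subset_univ {i0, i1}), Finset.sum_pair hne, h00]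
  · ring
  · intro i _ hi
    simp only [Finset.mem_insert, Finset.mem_singleton, not_or] at hi
    rw [h0 i hi.1 hi.2, mul_zero]

/-- cyclic permutation of the interval `[lo, hi]`. -/
def cyc (n lo hi : ℕ) (h : lo ≤ hi) (hn : hi < n) : Equiv.Perm (Fin n) where
  toFun i := ⟨if lo ≤ (i:ℕ) ∧ (i:ℕ) < hi then i + 1 else if (i:ℕ) = hi then lo else i, by
    have := i.2; split_ifs <;> omega⟩
  invFun i := ⟨if lo < (i:ℕ) ∧ (i:ℕ) ≤ hi then i - 1 else if (i:ℕ) = lo then hi else i, by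
    have := i.2; split_ifs <;> omega⟩
  left_inv i := by
    ext; dsimp only; split_ifs <;> omega
  right_inv i := by
    ext; dsimp only; split_ifs <;> omega

lemma D_plucker {R : Type*} [CommRing R] (k : ℕ) (v : ℕ → Fin (k+1) → R) (a m x : ℕ)
    (ha : 1 ≤ a) (hak : a ≤ k) (hm : 1 ≤ m) :
    D k v a m x * D k v a m (x+1) =
      D k v a (m-1) (x+1) * D k v a (m+1) x + D k v (a-1) m (x+1) * D k v (a+1) m x := by
  set e : Matrix (Fin (k+1)) (Fin (k+1)) R :=
    fun i => v (if (i:ℕ) < a then x + i else x + m + i) with he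
  set i0 : Fin (k+1) := ⟨0, by omega⟩ with hi0
  set i1 : Fin (k+1) := ⟨a, by omega⟩ with hi1
  have hne : i0 ≠ i1 := by
    intro h; have := congrArg Fin.val h; simp [hi0, hi1] at this; omega
  set r1 := cyc (k+1) 0 (a-1) (by omega) (by omega) with hr1
  set r2 := cyc (k+1) a k (by omega) (by omega) with hr2
  have P := plucker e i0 i1 hne (v (x+a)) (v (x+m+(k+1)))
  have key : ∀ (M : Matrix (Fin (k+1)) (Fin (k+1)) R) (r : Equiv.Perm (Fin (k+1)))
      (a' m' x' : ℕ), (∀ i, M (r i) = v (if (i:ℕ) < a' then x' + i else x' + m' + i)) →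
      D k v a' m' x' = (Equiv.Perm.sign r : ℤ) * M.det := by
    intro M r a' m' x' h
    rw [← Matrix.det_permute]
    unfold D
    congr 1
    funext i
    rw [← h i]
    rfl
  have ei1 : e i1 = v (x + m + a) := by simp [he, hi1]
  have rowv : ∀ (p q : ℕ → Prop), True := fun _ _ => trivial
  have A1 : D k v a m x = e.det := rfl
  have A2 := key ((e.updateRow i0 (v (x+a))).updateRow i1 (v (x+m+(k+1)))) (r1 * r2) a m (x+1) (by
    intro i
    have := i.2
    simp only [urow]; simp only [Equiv.Perm.mul_apply, hr1, hr2, cyc, Equiv.coe_fn_mk, hi0, hi1, he]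
    split_ifs <;> first | rfl | (exfalso; omega) | (congr 1; omega))
  have A3 := key (e.updateRow i0 (v (x+a))) r1 a (m-1) (x+1) (by
    intro i
    have := i.2
    simp only [urow]; simp only [Equiv.Perm.mul_apply, hr1, hr2, cyc, Equiv.coe_fn_mk, hi0, hi1, he]
    split_ifs <;> first | rfl | (exfalso; omega) | (congr 1; omega))
  have A4 := key (e.updateRow i1 (v (x+m+(k+1)))) r2 a (m+1) x (by
    intro i
    have := i.2
    simp only [urow]; simp only [Equiv.Perm.mul_apply, hr1, hr2, cyc, Equiv.coe_fn_mk, hi0, hi1, he]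
    split_ifs <;> first | rfl | (exfalso; omega) | (congr 1; omega))
  have A5 := key ((e.updateRow i0 (e i1)).updateRow i1 (v (x+m+(k+1)))) (r1 * r2) (a-1) m (x+1) (by
    intro i
    have := i.2
    rw [ei1]
    simp only [urow]; simp only [Equiv.Perm.mul_apply, hr1, hr2, cyc, Equiv.coe_fn_mk, hi0, hi1, he]
    split_ifs <;> first | rfl | (exfalso; omega) | (congr 1; omega))
  have A6 := key (e.updateRow i1 (v (x+a))) 1 (a+1) m x (by
    intro i
    have := i.2
    simp only [urow]; simp only [Equiv.Perm.one_apply, hi0, hi1, he]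
    split_ifs <;> first | rfl | (exfalso; omega) | (congr 1; omega))
  rw [A1, A2, A3, A4, A5, A6]
  simp only [Equiv.Perm.sign_mul, Units.val_mul, Int.cast_mul, Equiv.Perm.sign_one, Units.val_one, Int.cast_one]
  linear_combination ((Equiv.Perm.sign r1 : ℤ) : R) * ((Equiv.Perm.sign r2 : ℤ) : R) * P

lemma exists_vec {R : Type*} [CommRing R] (k l : ℕ) (S : ℕ → ℕ → R)
    (hu : ∀ a m, a ≤ k+1 → m ≤ l → IsUnit (S a m))
    (h0 : ∀ a, a ≤ k+1 → S a 0 = S 0 0) (hN : ∀ m, m ≤ l → S (k+1) m = S 0 0) (j : ℕ) (hj : j ≤ l) :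
    ∃ v : ℕ → Fin (k+1) → R, ∀ a m, a ≤ k+1 → m ≤ j → D k v a m 0 = S a m := by
  induction j with
  | zero =>
    refine ⟨fun i j => if i = (j:ℕ) then (if i = 0 then S 0 0 else 1) else 0, ?_⟩
    intro a m ha hm
    obtain rfl : m = 0 := by omega
    rw [h0 a ha]
    have : (fun i : Fin (k+1) => (fun i j => if i = (j:ℕ) then (if i = 0 then S 0 0 else 1) else 0 :
      ℕ → Fin (k+1) → R) (if (i:ℕ) < a then 0 + i else 0 + 0 + i)) =
      Matrix.diagonal (fun i : Fin (k+1) => if i = 0 then S 0 0 else 1) := by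
      funext i j
      by_cases hij : i = j
      · subst hij
        simp only [Matrix.diagonal_apply_eq, Fin.ext_iff, Fin.val_zero]
        split_ifs <;> first | rfl | (exfalso; omega)
      · rw [Matrix.diagonal_apply_ne _ hij]
        have : (i:ℕ) ≠ j := fun h => hij (Fin.ext h)
        dsimp only
        rw [if_neg]
        split_ifs <;> omega
    unfold D
    rw [this, Matrix.det_diagonal]
    simp
  | succ j ih =>
    obtain ⟨v, hv⟩ := ih (by omega)
    set F : ℕ → Matrix (Fin (k+1)) (Fin (k+1)) R := fun a i =>
      v (if (i:ℕ) < a then 0 + i else 0 + (j+1) + i) with hF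
    set P : Matrix (Fin (k+1)) (Fin (k+1)) R := fun a b =>
      ((F a).updateRow (Fin.last k) (v b)).det with hP
    have htri : P.BlockTriangular id := by
      intro a b hab
      simp only [id] at hab
      have hab' : (b:ℕ) < a := hab
      have ha := a.2
      have hbl : b ≠ Fin.last k := by
        intro h; have := congrArg Fin.val h; simp at this; omega
      apply Matrix.det_zero_of_row_eq hbl
      rw [Matrix.updateRow_self, Matrix.updateRow_ne hbl]
      simp [hF, hab']
    have hdiag : ∀ a, IsUnit (P a a) := by
      intro a
      have ha := a.2
      let G : Matrix (Fin (k+1)) (Fin (k+1)) R :=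
        fun i => v (if (i:ℕ) < a+1 then 0 + i else 0 + j + i)
      have e1 : (F a).updateRow (Fin.last k) (v a) =
          Matrix.submatrix G (cyc (k+1) a k (by omega) (by omega)) id := by
        funext i
        have hi := i.2
        change _ = v _
        simp only [urow]; simp only [cyc, Equiv.coe_fn_mk, hF, Fin.val_last]
        split_ifs <;> first | rfl | (exfalso; omega) | (congr 1; omega)
      simp only [hP]
      rw [e1, Matrix.det_permute]
      have := hv (a+1) j (by omega) le_rfl
      change G.det = _ at this
      rw [this]
      refine IsUnit.mul ?_ (hu _ _ (by omega) (by omega))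
      exact (Units.isUnit _).map (Int.castRingHom R)
    have hdet : IsUnit P.det := by
      rw [Matrix.det_of_isUpperTriangular htri]
      exact IsUnit.prod_univ_iff.2 hdiag
    set s : Fin (k+1) → R := fun a => S a (j+1) with hs
    set c := P⁻¹.mulVec s with hc
    have hPc : P.mulVec c = s := by
      rw [hc, Matrix.mulVec_mulVec, Matrix.mul_nonsing_inv _ hdet, Matrix.one_mulVec]
    set w : Fin (k+1) → R := ∑ b, c b • v (b : Fin (k+1)) with hw
    refine ⟨fun i => if i = j + (k+1) then w else v i, ?_⟩
    intro a m ha hm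
    rcases Nat.lt_or_ge m (j+1) with hm' | hm'
    · rw [← hv a m ha (by omega)]
      apply D_congr
      intro i hi
      rw [if_neg]
      split_ifs <;> omega
    · obtain rfl : m = j+1 := by omega
      rcases Nat.lt_or_ge a (k+1) with ha' | ha'
      · have e1 : D k (fun i => if i = j + (k+1) then w else v i) a (j+1) 0 =
            ((F a).updateRow (Fin.last k) w).det := by
          unfold D
          congr 1
          funext i
          have hi := i.2
          simp only [urow]; simp only [hF, Fin.val_last]
          split_ifs <;> first | rfl | (exfalso; omega)
        have hL : ∀ q, ((F a).updateRow (Fin.last k) q).det =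
            (Matrix.detRowAlternating.toMultilinearMap.toLinearMap (F a) (Fin.last k)) q := by
          intro q
          rfl
        rw [e1, hL, hw, map_sum]
        have := congrFun hPc ⟨a, ha'⟩
        simp only [hs] at this
        rw [← this]
        simp only [Matrix.mulVec, dotProduct]
        refine Finset.sum_congr rfl fun b _ => ?_
        rw [map_smul, ← hL, smul_eq_mul, mul_comm]
      · obtain rfl : a = k+1 := by omega
        rw [hN _ (by omega), ← h0 (k+1) le_rfl, ← hv (k+1) 0 le_rfl (by omega)]
        apply D_congr
        intro i hi
        rw [if_pos hi, if_neg (by omega)]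
        simp [hi]

lemma main {R : Type*} [CommRing R] (k l : ℕ) (hl : 1 ≤ l) (S : ℕ → ℕ → ℕ → R) (g : ℕ → R)
    (hu : ∀ a m x, a ≤ k+1 → m ≤ l → IsUnit (S a m x))
    (hS : ∀ a m x, 1 ≤ a → a ≤ k → 1 ≤ m → m ≤ l - 1 → S a m x * S a m (x+1) =
      S a (m-1) (x+1) * S a (m+1) x + S (a-1) m (x+1) * S (a+1) m x)
    (hg1 : ∀ a x, a ≤ k+1 → S a 0 x = g x)
    (hg2 : ∀ m x, m ≤ l → S 0 m x = g (x+m))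
    (hg3 : ∀ m x, m ≤ l → S (k+1) m x = g x)
    (hg4 : ∀ a x, a ≤ k+1 → S a l x = g (x+a+l))
    (a m : ℕ) (ha : a ≤ k+1) (hm : m ≤ l) :
    S a m (k+1-a+(l-m)) = S (k+1-a) (l-m) 0 := by
  have hper : ∀ x, g (x + (k+1+l)) = g x := by
    intro x
    rw [← hg3 l x le_rfl, hg4 (k+1) x le_rfl, add_assoc x]
  obtain ⟨v0, hv0⟩ := exists_vec k l (fun a m => S a m 0) (fun a m => hu a m 0)
    (fun a h => by rw [hg1 a 0 h, hg1 0 0 (by omega)])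
    (fun m h => by rw [hg3 m 0 h, hg1 0 0 (by omega)]) l le_rfl
  set v : ℕ → Fin (k+1) → R := fun i => ((-1:R)^k)^(i/(k+1+l)) • v0 (i % (k+1+l)) with hv
  have hvp : ∀ i, v (i + (k + 1 + l)) = (-1:R)^k • v i := by
    intro i
    simp only [hv]
    rw [Nat.add_mod_right, Nat.add_div_right _ (by omega), pow_succ, smul_smul, mul_comm]
  have hD0 : ∀ a m, a ≤ k+1 → m ≤ l → D k v a m 0 = S a m 0 := by
    intro a m ha hm
    rw [← hv0 a m ha hm]
    apply D_congr
    intro i hi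
    have : (if i < a then 0 + i else 0 + m + i) < k+1+l := by split_ifs <;> omega
    simp only [hv]
    rw [Nat.mod_eq_of_lt this, Nat.div_eq_of_lt this, pow_zero, one_smul]
  have hDa0 : ∀ a x, D k v a 0 x = D k v 0 0 x := by
    intro a x
    apply D_congr
    intro i hi
    congr 1
    split_ifs <;> omega
  have hD0m : ∀ m x, D k v 0 m x = D k v 0 0 (x+m) := by
    intro m x
    apply D_congr
    intro i hi
    congr 1
  have hDN : ∀ m x, D k v (k+1) m x = D k v 0 0 x := by
    intro m x
    apply D_congr
    intro i hi
    congr 1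
    simp [hi]
  have hDl : ∀ a x, a ≤ k+1 → D k v a l x = D k v 0 0 (x+a+l) := by
    intro a x ha
    rw [D_symm k l v hvp a l x ha le_rfl, Nat.sub_self, hDa0]
  have hDg : ∀ x, D k v 0 0 x = g x := by
    intro x
    induction x using Nat.strong_induction_on with
    | _ x ih =>
      rcases Nat.lt_or_ge x (k+1+l) with h | h
      · rcases Nat.le_total x l with h1 | h1
        · have := hD0m x 0
          rw [zero_add] at this
          rw [← this, hD0 _ _ (by omega) h1, hg2 _ _ h1, zero_add]
        · obtain ⟨b, rfl⟩ := Nat.exists_eq_add_of_le' h1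
          have := hDl b 0 (by omega)
          rw [zero_add] at this
          rw [← this, hD0 _ _ (by omega) le_rfl, hg4 _ _ (by omega), zero_add]
      · obtain ⟨b, rfl⟩ := Nat.exists_eq_add_of_le' h
        rw [hper, ← ih b (by omega), ← hDN l b, hDl _ _ le_rfl, add_assoc b]
  have hDS : ∀ x a m, a ≤ k+1 → m ≤ l → D k v a m x = S a m x := by
    intro x
    induction x with
    | zero => exact hD0
    | succ x ihx =>
      intro a
      induction a with
      | zero =>
        intro m _ hm
        rw [hD0m, hDg, hg2 _ _ hm]
      | succ a iha =>
        intro m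
        induction m with
        | zero =>
          intro ha _
          rw [hDa0, hDg, hg1 _ _ ha]
        | succ m ihm =>
          intro ha hm
          rcases Nat.lt_or_ge a k with ha' | ha'
          · rcases Nat.lt_or_ge (m+1) l with hm' | hm'
            · have h1 := D_plucker k v (a+1) (m+1) x (by omega) (by omega) (by omega)
              have h2 := hS (a+1) (m+1) x (by omega) (by omega) (by omega) (by omega)
              simp only [Nat.add_sub_cancel] at h1 h2
              rw [ihx _ _ ha hm, ihm ha (by omega), ihx _ _ ha (by omega), iha _ (by omega) hm,
                ihx _ _ (by omega) hm, ← h2] at h1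
              exact (hu _ _ _ ha hm).mul_left_cancel h1
            · obtain rfl : l = m+1 := by omega
              rw [hDl _ _ ha, hDg, hg4 _ _ ha]
          · obtain rfl : a = k := by omega
            rw [hDN, hDg, hg3 _ _ hm]
  rw [← hDS _ _ _ ha hm, ← hDS _ _ _ (by omega) (by omega),
    D_symm k l v hvp (k+1-a) (l-m) 0 (by omega) (by omega)]
  congr 1 <;> omega

end SpiralT

/-- Periodicity of the level `ℓ` restricted T-system `𝕋̃_ℓ(A_r)` with the spiral
boundary condition. -/
theorem restricted_T_Ar_spiral_periodicity {R : Type*} [CommRing R]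
    (r ℓ : ℕ) (hr : 1 ≤ r) (hℓ : 2 ≤ ℓ)
    (T : ℕ → ℕ → ℤ → R)
    (hunit : ∀ a m u, a ≤ r + 1 → m ≤ ℓ → IsUnit (T a m u))
    (hsys : ∀ a m u, 1 ≤ a → a ≤ r → 1 ≤ m → m ≤ ℓ - 1 →
      T a m (u - 1) * T a m (u + 1)
        = T a (m - 1) u * T a (m + 1) u + T (a - 1) m u * T (a + 1) m u)
    (hb1 : ∀ a u, 1 ≤ a → a ≤ r + 1 → T a 0 (u + 1) = T (a - 1) 0 u)
    (hb2 : ∀ a u, a ≤ r → T a ℓ (u + 1) = T (a + 1) ℓ u)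
    (hb3 : ∀ m u, m ≤ ℓ - 1 → T 0 m (u + 1) = T 0 (m + 1) u)
    (hb4 : ∀ m u, 1 ≤ m → m ≤ ℓ → T (r + 1) m (u + 1) = T (r + 1) (m - 1) u) :
    (∀ a m u, a ≤ r + 1 → m ≤ ℓ →
      T a m (u + ((r : ℤ) + 1 + ℓ)) = T (r + 1 - a) (ℓ - m) u) ∧
    (∀ a m u, a ≤ r + 1 → m ≤ ℓ →
      T a m (u + 2 * ((r : ℤ) + 1 + ℓ)) = T a m u) := by
  have f1 : ∀ a u, a ≤ r + 1 → T a 0 u = T 0 0 (u - a) := by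
    intro a
    induction a with
    | zero => intro u _; simp
    | succ a ih =>
      intro u ha
      have := hb1 (a+1) (u-1) (by omega) ha
      rw [sub_add_cancel, Nat.add_sub_cancel, ih _ (by omega)] at this
      rw [this]; congr 1; push_cast; ring
  have f2 : ∀ m u, m ≤ ℓ → T 0 m u = T 0 0 (u + m) := by
    intro m
    induction m with
    | zero => intro u _; simp
    | succ m ih =>
      intro u hm
      rw [← hb3 m u (by omega), ih _ (by omega)]
      congr 1; push_cast; ring
  have f3 : ∀ a u, a ≤ r + 1 → T a ℓ u = T 0 0 (u + a + ℓ) := by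
    intro a
    induction a with
    | zero => intro u _; rw [f2 _ _ le_rfl]; simp
    | succ a ih =>
      intro u ha
      rw [← hb2 a u (by omega), ih _ (by omega)]
      congr 1; push_cast; ring
  have f4 : ∀ m u, m ≤ ℓ → T (r+1) m u = T 0 0 (u - m - (r + 1)) := by
    intro m
    induction m with
    | zero => intro u _; rw [f1 _ _ le_rfl]; simp
    | succ m ih =>
      intro u hm
      have := hb4 (m+1) (u-1) (by omega) hm
      rw [sub_add_cancel, Nat.add_sub_cancel, ih _ (by omega)] at this
      rw [this]; congr 1; push_cast; ring
  have half : ∀ a m u, a ≤ r + 1 → m ≤ ℓ →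
      T a m (u + ((r : ℤ) + 1 + ℓ)) = T (r + 1 - a) (ℓ - m) u := by
    intro a m u ha hm
    set c : ℤ := u - ((r + 1 - a : ℕ) : ℤ) - ((ℓ - m : ℕ) : ℤ) with hc
    have := SpiralT.main r ℓ (by omega) (fun a m x => T a m (c + a + m + 2 * x))
      (fun x => T 0 0 (c + 2 * x)) (fun a m x h1 h2 => hunit _ _ _ h1 h2)
      (by
        intro a m x h1 h2 h3 h4
        have := hsys a m (c + a + m + 2 * x + 1) h1 h2 h3 h4
        convert this using 2
        · congr 1; ring
        · congr 1; push_cast; ring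
        · congr 2 <;> push_cast [h3] <;> ring
        · congr 2 <;> push_cast [h1] <;> ring)
      (by intro a x h; rw [f1 _ _ h]; congr 1; push_cast; ring)
      (by intro a x h; rw [f2 _ _ h]; congr 1; push_cast; ring)
      (by intro a x h; rw [f4 _ _ h]; congr 1; push_cast; ring)
      (by intro a x h; rw [f3 _ _ h]; congr 1; push_cast; ring)
      a m ha hm
    convert this using 2
    · rw [hc]; push_cast [ha, hm]; ring
    · rw [hc]; push_cast [ha, hm]; ring
  refine ⟨half, ?_⟩
  intro a m u ha hm
  have e : u + 2 * ((r : ℤ) + 1 + ℓ) = (u + ((r : ℤ) + 1 + ℓ)) + ((r : ℤ) + 1 + ℓ) := by ring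
  rw [e, half _ _ _ ha hm, half _ _ _ (by omega) (by omega)]
  congr 1 <;> omega
end

section
/- Let R be a commutative ring, r ≥ 1 and ℓ ≥ 2 integers, and let T = {T^{(a)}_m(u)} be a regular solution in R of the level ℓ restricted T-system 𝕋_ℓ(A_r) with unit boundary condition. Then for all 1 ≤ a ≤ r, 1 ≤ m ≤ ℓ−1, u ∈ ℤ: (1) half-periodicity: T^{(a)}_m(u + r + 1 + ℓ) = T^{(r+1−a)}_{ℓ−m}(u); (2) periodicity: T^{(a)}_m(u + 2(r + 1 + ℓ)) = T^{(a)}_m(u). -/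
namespace TPer

open Matrix

variable {R : Type*} [CommRing R]

/-- Contiguous block of an infinite array. -/
def M (f : ℤ → ℤ → R) (a : ℕ) (x y : ℤ) : Matrix (Fin a) (Fin a) R :=
  Matrix.of fun i j => f (x + (i : ℕ)) (y + (j : ℕ))

lemma schur (f : ℤ → ℤ → R) {a : ℕ} (ρ κ : Fin a → ℤ)
    (hA : IsUnit (det (Matrix.of fun i j => f (ρ i) (κ j)))) :
    ∃ g : ℤ → ℤ → R, ∀ (s : ℕ) (p q : Fin s → ℤ),
      det (Matrix.of fun i j : Fin (a + s) => f (Fin.append ρ p i) (Fin.append κ q j))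
        = det (Matrix.of fun i j => f (ρ i) (κ j)) * det (Matrix.of fun i j => g (p i) (q j)) := by
  set A : Matrix (Fin a) (Fin a) R := Matrix.of fun i j => f (ρ i) (κ j) with hAdef
  let _ : Invertible A := Matrix.invertibleOfIsUnitDet A hA
  refine ⟨fun p q => f p q - ((fun j => f p (κ j)) ᵥ* ⅟A) ⬝ᵥ (fun i => f (ρ i) q), ?_⟩
  intro s p q
  rw [← Matrix.det_submatrix_equiv_self (finSumFinEquiv (m := a) (n := s))]
  have : (Matrix.of fun i j : Fin (a + s) =>
        f (Fin.append ρ p i) (Fin.append κ q j)).submatrix finSumFinEquiv finSumFinEquiv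
      = Matrix.fromBlocks A (Matrix.of fun i j => f (ρ i) (q j))
          (Matrix.of fun i j => f (p i) (κ j)) (Matrix.of fun i j => f (p i) (q j)) := by
    ext i j
    rcases i with i | i <;> rcases j with j | j <;> simp [hAdef]
  rw [this, Matrix.det_fromBlocks₁₁]
  congr 1

lemma desnanot (f : ℤ → ℤ → R) (a : ℕ) (x y : ℤ)
    (hA : IsUnit (det (M f a (x + 1) (y + 1)))) :
    det (M f (a + 2) x y) * det (M f a (x + 1) (y + 1))
      = det (M f (a + 1) x y) * det (M f (a + 1) (x + 1) (y + 1))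
        - det (M f (a + 1) x (y + 1)) * det (M f (a + 1) (x + 1) y) := by
  obtain ⟨g, hg⟩ := schur f (fun i : Fin a => x + 1 + (i : ℕ)) (fun i : Fin a => y + 1 + (i : ℕ)) hA
  change ∀ (s : ℕ) (p q : Fin s → ℤ), _ = det (M f a (x + 1) (y + 1)) * _ at hg
  have rot : ∀ (b : ℕ) (z : ℤ) (i : Fin (b + 1)),
      z + ((finRotate (b + 1) i : Fin (b + 1)) : ℕ)
        = Fin.append (fun i : Fin b => z + 1 + (i : ℕ)) (fun _ : Fin 1 => z) i := by
    intro b z i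
    refine Fin.lastCases ?_ (fun i => ?_) i
    · rw [finRotate_last]
      have : Fin.last b = Fin.natAdd b (0 : Fin 1) := rfl
      rw [this, Fin.append_right]; simp
    · rw [coe_finRotate_of_ne_last (Fin.castSucc_lt_last i).ne]
      have : Fin.castSucc i = Fin.castAdd 1 i := rfl
      rw [this, Fin.append_left]; push_cast; simp; ring
  have app : ∀ (b : ℕ) (z : ℤ) (i : Fin (b + 1)),
      z + (i : ℕ)
        = Fin.append (fun i : Fin b => z + (i : ℕ)) (fun _ : Fin 1 => z + b) i := by
    intro b z i
    refine Fin.lastCases ?_ (fun i => ?_) i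
    · have : Fin.last b = Fin.natAdd b (0 : Fin 1) := rfl
      rw [this, Fin.append_right]; simp
    · have : Fin.castSucc i = Fin.castAdd 1 i := rfl
      rw [this, Fin.append_left]; simp
  have rot2 : ∀ (z : ℤ) (i : Fin (a + 2)),
      z + ((finRotate (a + 2) i : Fin (a + 2)) : ℕ)
        = Fin.append (fun i : Fin a => z + 1 + (i : ℕ)) (![z + 1 + a, z]) i := by
    intro z i
    rw [rot (a + 1) z i]
    refine Fin.lastCases ?_ (fun i => ?_) i
    · have h1 : Fin.last (a + 1) = Fin.natAdd (a + 1) (0 : Fin 1) := rfl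
      rw [h1, Fin.append_right]
      have h2 : Fin.natAdd (a + 1) (0 : Fin 1) = Fin.natAdd a (1 : Fin 2) := rfl
      rw [h2, Fin.append_right]; simp
    · have h1 : Fin.castSucc i = Fin.castAdd 1 i := rfl
      rw [h1, Fin.append_left]
      refine Fin.lastCases ?_ (fun i => ?_) i
      · have h2 : Fin.castAdd 1 (Fin.last a) = Fin.natAdd a (0 : Fin 2) := rfl
        rw [h2, Fin.append_right]; simp
      · have h2 : Fin.castAdd 1 (Fin.castSucc i) = Fin.castAdd 2 i := rfl
        rw [h2, Fin.append_left]; simp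
  set B := det (M f a (x + 1) (y + 1)) with hB
  have e0 : det (M f (a + 2) x y)
      = B * (g (x + 1 + a) (y + 1 + a) * g x y - g (x + 1 + a) y * g x (y + 1 + a)) := by
    rw [← Matrix.det_submatrix_equiv_self (finRotate (a + 2))]
    have := hg 2 ![x + 1 + a, x] ![y + 1 + a, y]
    rw [Matrix.det_fin_two] at this
    simp only [Matrix.of_apply, Matrix.cons_val_zero, Matrix.cons_val_one] at this
    rw [← this]
    congr 1
    ext i j
    simp only [M, Matrix.submatrix_apply, Matrix.of_apply, rot2]
  have one : ∀ p q, det (Matrix.of fun i j : Fin (a + 1) =>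
      f (Fin.append (fun i : Fin a => x + 1 + (i : ℕ)) (fun _ : Fin 1 => p) i)
        (Fin.append (fun i : Fin a => y + 1 + (i : ℕ)) (fun _ : Fin 1 => q) j)) = B * g p q := by
    intro p q
    rw [hg 1 (fun _ => p) (fun _ => q)]
    simp
  have e1 : det (M f (a + 1) x y) = B * g x y := by
    rw [← one, ← Matrix.det_submatrix_equiv_self (finRotate (a + 1))]
    congr 1
    ext i j
    simp only [M, Matrix.submatrix_apply, Matrix.of_apply, rot]
  have e2 : det (M f (a + 1) (x + 1) (y + 1)) = B * g (x + 1 + a) (y + 1 + a) := by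
    rw [← one]
    congr 1
    ext i j
    simp only [M, Matrix.of_apply, app]
  have e3 : ((Equiv.Perm.sign (finRotate (a + 1)) : ℤ) : R) * det (M f (a + 1) x (y + 1))
      = B * g x (y + 1 + a) := by
    rw [← one, ← Matrix.det_permute]
    congr 1
    ext i j
    simp only [M, Matrix.submatrix_apply, Matrix.of_apply, rot, app a (y + 1), id]
  have e4 : ((Equiv.Perm.sign (finRotate (a + 1)) : ℤ) : R) * det (M f (a + 1) (x + 1) y)
      = B * g (x + 1 + a) y := by
    rw [← one, ← Matrix.det_permute']
    congr 1
    ext i j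
    simp only [M, Matrix.submatrix_apply, Matrix.of_apply, rot, app a (x + 1), id]
  have hs : ((Equiv.Perm.sign (finRotate (a + 1)) : ℤ) : R)
      * ((Equiv.Perm.sign (finRotate (a + 1)) : ℤ) : R) = 1 := by
    rw [← Int.cast_mul, ← Units.val_mul, Int.units_mul_self]; simp
  have e5 : det (M f (a + 1) x (y + 1)) * det (M f (a + 1) (x + 1) y)
      = (B * g x (y + 1 + a)) * (B * g (x + 1 + a) y) := by
    rw [← e3, ← e4]
    linear_combination (-det (M f (a + 1) x (y + 1)) * det (M f (a + 1) (x + 1) y)) * hs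
  rw [e0, e1, e2, e5]
  ring

lemma rowcomb (f : ℤ → ℤ → R) (k : ℕ) (x y : ℤ)
    (h1 : IsUnit (det (M f k x y))) (h0 : det (M f (k + 1) x y) = 0) :
    ∃ c : Fin k → R, ∀ j : Fin (k + 1),
      f (x + k) (y + (j : ℕ)) = ∑ i, c i * f (x + (i : ℕ)) (y + (j : ℕ)) := by
  let _ : Invertible (M f k x y) := Matrix.invertibleOfIsUnitDet _ h1
  let C : Matrix (Fin 1) (Fin k) R := Matrix.of fun _ j => f (x + k) (y + (j : ℕ))
  let B : Matrix (Fin k) (Fin 1) R := Matrix.of fun i _ => f (x + (i : ℕ)) (y + k)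
  let D : Matrix (Fin 1) (Fin 1) R := Matrix.of fun _ _ => f (x + k) (y + k)
  rw [← Matrix.det_submatrix_equiv_self (finSumFinEquiv (m := k) (n := 1))] at h0
  have hb : (M f (k + 1) x y).submatrix finSumFinEquiv finSumFinEquiv
      = Matrix.fromBlocks (M f k x y) B C D := by
    ext i j
    rcases i with i | i <;> rcases j with j | j <;> simp [M, B, C, D]
  rw [hb, Matrix.det_fromBlocks₁₁] at h0
  have h2 := (h1.mul_right_eq_zero).1 h0
  rw [Matrix.det_fin_one, Matrix.sub_apply, sub_eq_zero] at h2
  refine ⟨fun i => (C * ⅟(M f k x y)) 0 i, fun j => ?_⟩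
  refine Fin.lastCases ?_ (fun j => ?_) j
  · rw [Matrix.mul_apply] at h2
    simpa [D, B] using h2
  · have h3 : (C * ⅟(M f k x y) * M f k x y) 0 j = C 0 j := by
      rw [Matrix.invOf_mul_cancel_right]
    rw [Matrix.mul_apply] at h3
    simpa [M, C] using h3.symm

/-- Windows move by a common matrix. -/
lemma window (f : ℤ → ℤ → R) (n : ℕ) (x y : ℤ) (K : ℕ)
    (h1 : ∀ k : ℕ, k ≤ K → det (M f n (x + k) y) = 1)
    (h1' : det (M f n x (y + 1)) = 1)
    (h0 : ∀ k : ℕ, k < K → det (M f (n + 1) (x + k) y) = 0) :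
    ∃ C : Matrix (Fin n) (Fin n) R, det C = 1 ∧ ∀ k : ℕ, k < n + K → ∀ j : Fin n,
      f (x + k) (y + 1 + (j : ℕ)) = ∑ i : Fin n, f (x + k) (y + (i : ℕ)) * C i j := by
  have hx : det (M f n x y) = 1 := by simpa using h1 0 (Nat.zero_le _)
  let _ : Invertible (M f n x y) := Matrix.invertibleOfIsUnitDet _ (by rw [hx]; exact isUnit_one)
  have hC : M f n x y * (⅟(M f n x y) * M f n x (y + 1)) = M f n x (y + 1) :=
    Matrix.mul_invOf_cancel_left _ _
  refine ⟨⅟(M f n x y) * M f n x (y + 1), ?_, ?_⟩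
  · have := congrArg det hC
    rw [Matrix.det_mul, hx, h1', one_mul] at this
    exact this
  · generalize ⅟(M f n x y) * M f n x (y + 1) = C at hC
    intro k
    induction k using Nat.strong_induction_on with
    | _ k ih =>
      intro hk j
      by_cases hkn : k < n
      · have := congrFun (congrFun hC ⟨k, hkn⟩) j
        rw [Matrix.mul_apply] at this
        simpa [M] using this.symm
      · obtain ⟨l, rfl⟩ : ∃ l, k = l + n := ⟨k - n, by omega⟩
        obtain ⟨c, hc⟩ := rowcomb f n (x + l) y (by rw [h1 l (by omega)]; exact isUnit_one)
          (h0 l (by omega))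
        have e1 := hc j.succ
        have e2 := fun i : Fin n => hc i.castSucc
        have e3 : ∀ i : Fin n, _ := fun i => ih (l + i) (by omega) (by omega) j
        simp only [Fin.val_succ, Fin.val_castSucc] at e1 e2
        have a1 : x + ((l + n : ℕ) : ℤ) = x + l + n := by push_cast; ring
        have a2 : y + 1 + ((j : ℕ) : ℤ) = y + ((j + 1 : ℕ) : ℤ) := by push_cast; ring
        rw [a1, a2, e1]
        simp only [e2, Finset.sum_mul]
        rw [Finset.sum_comm]
        refine Finset.sum_congr rfl fun i _ => ?_
        have := e3 i
        have a3 : x + ((l + i : ℕ) : ℤ) = x + l + (i : ℕ) := by push_cast; ring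
        rw [a3, a2] at this
        rw [this, Finset.mul_sum]
        exact Finset.sum_congr rfl fun _ _ => by ring

/-- Half-periodicity for a band array. -/
lemma band (f : ℤ → ℤ → R) (r ℓ m : ℕ) (x : ℤ) (hm : m ≤ ℓ)
    (hlow : ∀ x y : ℤ, y - x - 1 < 0 → f x y = 0)
    (hhigh : ∀ x y : ℤ, ℓ < y - x - 1 → f x y = 0)
    (hz : ∀ x y : ℤ, y - x - 1 = 0 → f x y = 1)
    (hl : ∀ x y : ℤ, y - x - 1 = ℓ → f x y = 1)
    (h1 : ∀ x y : ℤ, 0 ≤ y - x - 1 → y - x - 1 ≤ ℓ → det (M f (r + 1) x y) = 1)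
    (h0 : ∀ x y : ℤ, 1 ≤ y - x - 1 → y - x - 1 ≤ ℓ - 1 → det (M f (r + 2) x y) = 0) :
    det (M f r x (x + 1 + m)) = f (x + r + m) (x + 1 + r + ℓ) := by
  let ρ : Fin (r + 1) → ℕ := fun i => if (i : ℕ) < r then i else r + m
  let G : ℤ → Matrix (Fin (r + 1)) (Fin (r + 1)) R := fun y =>
    Matrix.of fun i j => f (x + (ρ i : ℕ)) (y + (j : ℕ))
  have step : ∀ y : ℤ, x + m + 1 ≤ y → y ≤ x + ℓ → det (G (y + 1)) = det (G y) := by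
    intro y hy1 hy2
    obtain ⟨C, hC, h⟩ := window f (r + 1) x y m
      (fun k hk => h1 _ _ (by omega) (by omega)) (h1 _ _ (by omega) (by omega))
      (fun k hk => h0 _ _ (by omega) (by omega))
    have : G (y + 1) = G y * C := by
      ext i j
      rw [Matrix.mul_apply]
      exact h (ρ i) (by simp only [ρ]; split_ifs <;> omega) j
    rw [this, Matrix.det_mul, hC, mul_one]
  have all : ∀ k : ℕ, m + k ≤ ℓ → det (G (x + 1 + m + k)) = det (G (x + 1 + m)) := by
    intro k
    induction k with
    | zero => intro _; simp
    | succ k ih =>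
      intro hk
      rw [← ih (by omega), ← step (x + 1 + m + k) (by omega) (by omega)]
      congr 2; push_cast; ring
  have hlast : ρ (Fin.last r) = r + m := by simp [ρ]
  have hcs : ∀ i : Fin r, ρ i.castSucc = i := by intro i; simp [ρ]
  have hstart : det (G (x + 1 + m)) = det (M f r x (x + 1 + m)) := by
    rw [Matrix.det_succ_row _ (Fin.last r), Fin.sum_univ_castSucc, Finset.sum_eq_zero]
    · have : G (x + 1 + m) (Fin.last r) (Fin.last r) = 1 := by
        simp only [G, Matrix.of_apply, hlast]
        apply hz; simp; ring
      rw [this]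
      have h2 : (G (x + 1 + m)).submatrix (Fin.last r).succAbove (Fin.last r).succAbove
          = M f r x (x + 1 + m) := by
        ext i j
        simp [G, M, hcs]
      rw [h2]
      simp
    · intro j _
      have : G (x + 1 + m) (Fin.last r) j.castSucc = 0 := by
        simp only [G, Matrix.of_apply, hlast]
        apply hlow
        have := j.isLt
        simp only [Fin.val_castSucc]; push_cast; omega
      rw [this]; simp
  have hend : det (G (x + 1 + ℓ)) = f (x + r + m) (x + 1 + r + ℓ) := by
    rw [Matrix.det_of_lowerTriangular, Fin.prod_univ_castSucc, Finset.prod_eq_one]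
    · simp only [G, Matrix.of_apply, hlast, Fin.val_last, one_mul]
      congr 1 <;> push_cast <;> ring
    · intro i _
      simp only [G, Matrix.of_apply, hcs, Fin.val_castSucc]
      apply hl; ring
    · intro i j hij
      simp only [OrderDual.toDual_lt_toDual] at hij
      have hij' : (i : ℕ) < j := hij
      have := j.isLt
      simp only [G, Matrix.of_apply]
      apply hhigh
      have : ρ i = i := by simp only [ρ]; rw [if_pos (by omega)]
      rw [this]; omega
  rw [← hstart, ← hend]
  obtain ⟨k, rfl⟩ := Nat.exists_eq_add_of_le hm
  rw [← all k le_rfl]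
  congr 2; push_cast; ring

end TPer

/-- Periodicity of the level `ℓ` restricted T-system `𝕋_ℓ(A_r)` with the unit
boundary condition. -/
theorem restricted_T_Ar_unit_periodicity {R : Type*} [CommRing R]
    (r ℓ : ℕ) (hr : 1 ≤ r) (hℓ : 2 ≤ ℓ)
    (T : ℕ → ℕ → ℤ → R)
    (hb0 : ∀ m u, m ≤ ℓ → T 0 m u = 1)
    (hbr : ∀ m u, m ≤ ℓ → T (r + 1) m u = 1)
    (hm0 : ∀ a u, a ≤ r + 1 → T a 0 u = 1)
    (hmℓ : ∀ a u, a ≤ r + 1 → T a ℓ u = 1)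
    (hunit : ∀ a m u, 1 ≤ a → a ≤ r → 1 ≤ m → m ≤ ℓ - 1 → IsUnit (T a m u))
    (hsys : ∀ a m u, 1 ≤ a → a ≤ r → 1 ≤ m → m ≤ ℓ - 1 →
      T a m (u - 1) * T a m (u + 1)
        = T a (m - 1) u * T a (m + 1) u + T (a - 1) m u * T (a + 1) m u) :
    (∀ a m u, 1 ≤ a → a ≤ r → 1 ≤ m → m ≤ ℓ - 1 →
      T a m (u + ((r : ℤ) + 1 + ℓ)) = T (r + 1 - a) (ℓ - m) u) ∧
    (∀ a m u, 1 ≤ a → a ≤ r → 1 ≤ m → m ≤ ℓ - 1 →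
      T a m (u + 2 * ((r : ℤ) + 1 + ℓ)) = T a m u) := by
  have hunit' : ∀ a m u, a ≤ r + 1 → m ≤ ℓ → IsUnit (T a m u) := by
    intro a m u ha hm
    rcases Nat.eq_zero_or_pos a with rfl | ha0
    · rw [hb0 _ _ hm]; exact isUnit_one
    rcases Nat.eq_zero_or_pos m with rfl | hm0'
    · rw [hm0 _ _ ha]; exact isUnit_one
    rcases ha.eq_or_lt with rfl | ha1
    · rw [hbr _ _ hm]; exact isUnit_one
    rcases hm.eq_or_lt with rfl | hm1
    · rw [hmℓ _ _ ha]; exact isUnit_one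
    exact hunit a m u ha0 (by omega) hm0' (by omega)
  -- first row
  have first : ∀ m u, m ≤ ℓ → T r m u = T 1 (ℓ - m) (u + ((r : ℤ) + 1 + ℓ)) := by
    intro m u hm
    obtain ⟨c, hc⟩ : ∃ c : ℤ, u = r + m + c := ⟨u - r - m, by ring⟩
    let f : ℤ → ℤ → R := fun x y =>
      if 0 ≤ y - x - 1 ∧ y - x - 1 ≤ ℓ then T 1 (y - x - 1).toNat (x + y + c) else 0
    have hf : ∀ (x y : ℤ) (k : ℕ), k ≤ ℓ → y - x - 1 = k → f x y = T 1 k (x + y + c) := by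
      intro x y k hk h
      simp only [f, h]
      rw [if_pos (by omega)]; simp
    have hlow : ∀ x y : ℤ, y - x - 1 < 0 → f x y = 0 := by
      intro x y h; simp only [f]; rw [if_neg (by omega)]
    have hhigh : ∀ x y : ℤ, ℓ < y - x - 1 → f x y = 0 := by
      intro x y h; simp only [f]; rw [if_neg (by omega)]
    have hz : ∀ x y : ℤ, y - x - 1 = 0 → f x y = 1 := by
      intro x y h; rw [hf x y 0 (by omega) (by simpa using h), hm0 _ _ (by omega)]
    have hl : ∀ x y : ℤ, y - x - 1 = ℓ → f x y = 1 := by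
      intro x y h; rw [hf x y ℓ le_rfl h, hmℓ _ _ (by omega)]
    have key : ∀ a : ℕ, a ≤ r + 1 → ∀ (x : ℤ) (k : ℕ), k ≤ ℓ →
        (TPer.M f a x (x + 1 + k)).det = T a k (2 * x + a + k + c) := by
      intro a
      induction a using Nat.strong_induction_on with
      | _ a ih =>
        intro ha x k hk
        match a, ih, ha with
        | 0, _, _ => rw [hb0 _ _ hk]; simp
        | 1, _, _ =>
          rw [Matrix.det_fin_one]
          simp only [TPer.M, Matrix.of_apply]
          rw [hf _ _ k hk (by simp; ring)]
          congr 1; simp; ring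
        | a + 2, ih, ha =>
          rcases Nat.eq_zero_or_pos k with rfl | hk0
          · rw [hm0 _ _ ha, Matrix.det_of_upperTriangular]
            · apply Finset.prod_eq_one
              intro i _
              simp only [TPer.M, Matrix.of_apply]
              apply hz; simp
            · intro i j hij
              have hij' : (j : ℕ) < i := hij
              simp only [TPer.M, Matrix.of_apply]
              apply hlow; push_cast; omega
          rcases hk.eq_or_lt with rfl | hk1
          · rw [hmℓ _ _ ha, Matrix.det_of_lowerTriangular]
            · apply Finset.prod_eq_one
              intro i _
              simp only [TPer.M, Matrix.of_apply]
              apply hl; ring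
            · intro i j hij
              simp only [OrderDual.toDual_lt_toDual] at hij
              have hij' : (i : ℕ) < j := hij
              simp only [TPer.M, Matrix.of_apply]
              apply hhigh; omega
          have A0 := ih a (by omega) (by omega) (x + 1) k hk
          have A1 := ih (a + 1) (by omega) (by omega) x k hk
          have A2 := ih (a + 1) (by omega) (by omega) (x + 1) k hk
          have A3 := ih (a + 1) (by omega) (by omega) x (k + 1) (by omega)
          have A4 := ih (a + 1) (by omega) (by omega) (x + 1) (k - 1) (by omega)
          have b0 : x + 1 + 1 + (k : ℤ) = x + 1 + k + 1 := by ring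
          have b3 : x + 1 + ((k + 1 : ℕ) : ℤ) = x + 1 + k + 1 := by push_cast; ring
          have b4 : x + 1 + 1 + ((k - 1 : ℕ) : ℤ) = x + 1 + k := by omega
          rw [b0] at A0 A2
          rw [b3] at A3
          rw [b4] at A4
          have hU := hunit' a k (2 * (x + 1) + a + k + c) (by omega) hk
          have D := TPer.desnanot f a x (x + 1 + k) (by rw [A0]; exact hU)
          rw [A0, A1, A2, A3, A4] at D
          have S := hsys (a + 1) k (2 * (x + 1) + a + k + c) (by omega) (by omega) hk0 (by omega)
          have c1 : 2 * x + ((a + 1 : ℕ) : ℤ) + k + c = 2 * (x + 1) + a + k + c - 1 := by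
            push_cast; ring
          have c2 : 2 * (x + 1) + ((a + 1 : ℕ) : ℤ) + k + c = 2 * (x + 1) + a + k + c + 1 := by
            push_cast; ring
          have c3 : 2 * x + ((a + 1 : ℕ) : ℤ) + ((k + 1 : ℕ) : ℤ) + c
              = 2 * (x + 1) + a + k + c := by push_cast; ring
          have c4 : 2 * (x + 1) + ((a + 1 : ℕ) : ℤ) + ((k - 1 : ℕ) : ℤ) + c
              = 2 * (x + 1) + a + k + c := by omega
          have c5 : 2 * x + ((a + 2 : ℕ) : ℤ) + k + c = 2 * (x + 1) + a + k + c := by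
            push_cast; ring
          rw [c1, c2, c3, c4] at D
          rw [c5]
          apply hU.mul_right_cancel
          simp only [Nat.add_sub_cancel] at S
          rw [D, S]
          ring
    have h1 : ∀ x y : ℤ, 0 ≤ y - x - 1 → y - x - 1 ≤ ℓ → (TPer.M f (r + 1) x y).det = 1 := by
      intro x y h h'
      obtain ⟨k, hk⟩ := Int.eq_ofNat_of_zero_le h
      obtain rfl : y = x + 1 + k := by omega
      rw [key _ le_rfl x k (by omega), hbr _ _ (by omega)]
    have h0 : ∀ x y : ℤ, 1 ≤ y - x - 1 → y - x - 1 ≤ ℓ - 1 →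
        (TPer.M f (r + 2) x y).det = 0 := by
      intro x y h h'
      have hU : IsUnit (TPer.M f r (x + 1) (y + 1)).det := by
        obtain ⟨k, hk⟩ := Int.eq_ofNat_of_zero_le (by omega : 0 ≤ y - x - 1)
        obtain rfl : y = x + 1 + k := by omega
        have b0 : x + 1 + (k : ℤ) + 1 = x + 1 + 1 + k := by ring
        rw [b0, key r (by omega) (x + 1) k (by omega)]
        exact hunit' _ _ _ (by omega) (by omega)
      have D := TPer.desnanot f r x y hU
      rw [h1 _ _ (by omega) (by omega), h1 _ _ (by omega) (by omega),
        h1 _ _ (by omega) (by omega), h1 _ _ (by omega) (by omega)] at D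
      apply hU.mul_right_cancel
      rw [D]; ring
    have B := TPer.band f r ℓ m 0 hm hlow hhigh hz hl h1 h0
    rw [key r (by omega) 0 m hm, hf _ _ (ℓ - m) (by omega) (by omega)] at B
    rw [hc]
    convert B using 2 <;> ring
  have full : ∀ a : ℕ, a ≤ r + 1 → ∀ m u, m ≤ ℓ →
      T a m (u + ((r : ℤ) + 1 + ℓ)) = T (r + 1 - a) (ℓ - m) u := by
    intro a
    induction a using Nat.strong_induction_on with
    | _ a ih =>
      intro ha m u hm
      match a, ih, ha with
      | 0, _, _ => rw [hb0 _ _ hm, Nat.sub_zero, hbr _ _ (by omega)]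
      | 1, _, _ =>
        rw [Nat.add_sub_cancel, first _ _ (by omega : ℓ - m ≤ ℓ), Nat.sub_sub_self hm]
      | a + 2, ih, ha =>
        rcases Nat.eq_zero_or_pos m with rfl | hk0
        · rw [hm0 _ _ ha, Nat.sub_zero, hmℓ _ _ (by omega)]
        rcases hm.eq_or_lt with rfl | hk1
        · rw [hmℓ _ _ ha, Nat.sub_self, hm0 _ _ (by omega)]
        set N : ℤ := (r : ℤ) + 1 + ℓ with hN
        have S1 := hsys (a + 1) m (u + N) (by omega) (by omega) hk0 (by omega)
        have S2 := hsys (r + 1 - (a + 1)) (ℓ - m) u (by omega) (by omega) (by omega) (by omega)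
        have A0 := ih a (by omega) (by omega) m u hm
        have A1 := ih (a + 1) (by omega) (by omega) m (u - 1) hm
        have A2 := ih (a + 1) (by omega) (by omega) m (u + 1) hm
        have A3 := ih (a + 1) (by omega) (by omega) (m - 1) u (by omega)
        have A4 := ih (a + 1) (by omega) (by omega) (m + 1) u (by omega)
        have hU := hunit' a m (u + N) (by omega) hm
        rw [show u - 1 + N = u + N - 1 by ring] at A1
        rw [show u + 1 + N = u + N + 1 by ring] at A2
        rw [show ℓ - (m - 1) = ℓ - m + 1 by omega] at A3
        rw [show ℓ - (m + 1) = ℓ - m - 1 by omega] at A4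
        rw [show r + 1 - (a + 1) - 1 = r + 1 - (a + 2) by omega,
          show r + 1 - (a + 1) + 1 = r + 1 - a by omega, ← A0, ← A1, ← A2, ← A3, ← A4] at S2
        rw [Nat.add_sub_cancel] at S1
        apply hU.mul_right_cancel
        linear_combination S2 - S1
  refine ⟨fun a m u _ h2 _ h4 => full a (by omega) m u (by omega), fun a m u _ h2 _ h4 => ?_⟩
  have e : u + 2 * ((r : ℤ) + 1 + ℓ) = u + ((r : ℤ) + 1 + ℓ) + ((r : ℤ) + 1 + ℓ) := by ring
  rw [e, full a (by omega) m _ (by omega), full (r + 1 - a) (by omega) (ℓ - m) _ (by omega)]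
  congr 1 <;> omega
end

section
/- Let R be a commutative ring, r ≥ 1, ℓ ≥ 2, and let T = {T^{(a)}_m(u)} be a regular solution in R of the level ℓ restricted T-system 𝕋̃_ℓ(A_r) with spiral boundary condition, indexed by H = {(a,m,u) : 0 ≤ a ≤ r+1, 0 ≤ m ≤ ℓ, u ∈ ℤ}. Define, for 1 ≤ a ≤ r, 1 ≤ m ≤ ℓ−1, u ∈ ℤ: Y^{(a)}_m(u) := T^{(a−1)}_m(u) · T^{(a+1)}_m(u) · (T^{(a)}_{m−1}(u) · T^{(a)}_{m+1}(u))^{−1}. Then every Y^{(a)}_m(u) and every 1 + Y^{(a)}_m(u) is invertible, and Y = {Y^{(a)}_m(u)} is a regular solution in R of the level ℓ restricted Y-system 𝕐_ℓ(A_r). -/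
/-- From a regular solution of the level `ℓ` restricted T-system `𝕋̃_ℓ(A_r)` with the
spiral boundary condition, the formula
`Y^{(a)}_m(u) = T^{(a-1)}_m(u) T^{(a+1)}_m(u) / (T^{(a)}_{m-1}(u) T^{(a)}_{m+1}(u))`
yields a regular solution of the level `ℓ` restricted Y-system `𝕐_ℓ(A_r)`. -/
theorem restricted_T_to_Y_Ar {R : Type*} [CommRing R]
    (r ℓ : ℕ) (hr : 1 ≤ r) (hℓ : 2 ≤ ℓ)
    (T : ℕ → ℕ → ℤ → R)
    (hunit : ∀ a m u, a ≤ r + 1 → m ≤ ℓ → IsUnit (T a m u))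
    (hsys : ∀ a m u, 1 ≤ a → a ≤ r → 1 ≤ m → m ≤ ℓ - 1 →
      T a m (u - 1) * T a m (u + 1)
        = T a (m - 1) u * T a (m + 1) u + T (a - 1) m u * T (a + 1) m u)
    (hb1 : ∀ a u, 1 ≤ a → a ≤ r + 1 → T a 0 (u + 1) = T (a - 1) 0 u)
    (hb2 : ∀ a u, a ≤ r → T a ℓ (u + 1) = T (a + 1) ℓ u)
    (hb3 : ∀ m u, m ≤ ℓ - 1 → T 0 m (u + 1) = T 0 (m + 1) u)
    (hb4 : ∀ m u, 1 ≤ m → m ≤ ℓ → T (r + 1) m (u + 1) = T (r + 1) (m - 1) u)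
    (Y : ℕ → ℕ → ℤ → R)
    (hY : ∀ a m u, 1 ≤ a → a ≤ r → 1 ≤ m → m ≤ ℓ - 1 →
      Y a m u = T (a - 1) m u * T (a + 1) m u
        * Ring.inverse (T a (m - 1) u * T a (m + 1) u)) :
    (∀ a m u, 1 ≤ a → a ≤ r → 1 ≤ m → m ≤ ℓ - 1 → IsUnit (Y a m u)) ∧
    (∀ a m u, 1 ≤ a → a ≤ r → 1 ≤ m → m ≤ ℓ - 1 → IsUnit (1 + Y a m u)) ∧
    (∀ a m u, 1 ≤ a → a ≤ r → 1 ≤ m → m ≤ ℓ - 1 →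
      Y a m (u - 1) * Y a m (u + 1)
          * (if m = 1 then 1 else 1 + Ring.inverse (Y a (m - 1) u))
          * (if m = ℓ - 1 then 1 else 1 + Ring.inverse (Y a (m + 1) u))
        = (if a = 1 then 1 else 1 + Y (a - 1) m u)
          * (if a = r then 1 else 1 + Y (a + 1) m u)) := by
  have hYD : ∀ a m u, 1 ≤ a → a ≤ r → 1 ≤ m → m ≤ ℓ - 1 →
      Y a m u * (T a (m - 1) u * T a (m + 1) u) = T (a - 1) m u * T (a + 1) m u := by
    intro a m u h1 h2 h3 h4
    rw [hY a m u h1 h2 h3 h4, mul_assoc, Ring.inverse_mul_cancel, mul_one]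
    exact (hunit _ _ _ (by omega) (by omega)).mul (hunit _ _ _ (by omega) (by omega))
  have hYu : ∀ a m u, 1 ≤ a → a ≤ r → 1 ≤ m → m ≤ ℓ - 1 → IsUnit (Y a m u) := by
    intro a m u h1 h2 h3 h4
    have h := hYD a m u h1 h2 h3 h4
    have hE : IsUnit (T (a - 1) m u * T (a + 1) m u) :=
      (hunit _ _ _ (by omega) (by omega)).mul (hunit _ _ _ (by omega) (by omega))
    rw [← h] at hE
    exact isUnit_of_mul_isUnit_left hE
  have hG : ∀ a m u, 1 ≤ a → a ≤ r → 1 ≤ m → m ≤ ℓ - 1 →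
      (1 + Y a m u) * (T a (m - 1) u * T a (m + 1) u) = T a m (u - 1) * T a m (u + 1) := by
    intro a m u h1 h2 h3 h4
    rw [hsys a m u h1 h2 h3 h4, add_mul, hYD a m u h1 h2 h3 h4, one_mul]
  have hF : ∀ a m u, 1 ≤ a → a ≤ r → 1 ≤ m → m ≤ ℓ - 1 →
      (1 + Ring.inverse (Y a m u)) * (T (a - 1) m u * T (a + 1) m u)
        = T a m (u - 1) * T a m (u + 1) := by
    intro a m u h1 h2 h3 h4
    rw [hsys a m u h1 h2 h3 h4, ← hYD a m u h1 h2 h3 h4, add_mul, ← mul_assoc (Ring.inverse _),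
      Ring.inverse_mul_cancel _ (hYu a m u h1 h2 h3 h4)]
    ring
  refine ⟨hYu, ?_, ?_⟩
  · intro a m u h1 h2 h3 h4
    have h := hG a m u h1 h2 h3 h4
    have hE : IsUnit (T a m (u - 1) * T a m (u + 1)) :=
      (hunit _ _ _ (by omega) (by omega)).mul (hunit _ _ _ (by omega) (by omega))
    rw [← h] at hE
    exact isUnit_of_mul_isUnit_left hE
  · intro a m u h1 h2 h3 h4
    obtain ⟨b, rfl⟩ : ∃ b, a = b + 1 := ⟨a - 1, by omega⟩
    obtain ⟨k, rfl⟩ : ∃ k, m = k + 1 := ⟨m - 1, by omega⟩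
    simp only [Nat.add_sub_cancel]
    have e1 : (if k + 1 = 1 then (1 : R) else 1 + Ring.inverse (Y (b + 1) k u))
        * (T b k u * T (b + 2) k u) = T (b + 1) k (u - 1) * T (b + 1) k (u + 1) := by
      split_ifs with h
      · obtain rfl : k = 0 := by omega
        have p := hb1 (b + 1) u (by omega) (by omega)
        have q := hb1 (b + 2) (u - 1) (by omega) (by omega)
        simp only [sub_add_cancel, Nat.add_sub_cancel, Nat.reduceSubDiff] at p q
        rw [p, q]; ring
      · exact hF (b + 1) k u h1 h2 (by omega) (by omega)
    have e2 : (if k + 1 = ℓ - 1 then (1 : R) else 1 + Ring.inverse (Y (b + 1) (k + 1 + 1) u))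
        * (T b (k + 2) u * T (b + 2) (k + 2) u)
          = T (b + 1) (k + 2) (u - 1) * T (b + 1) (k + 2) (u + 1) := by
      split_ifs with h
      · obtain rfl : ℓ = k + 2 := by omega
        have p := hb2 (b + 1) u (by omega)
        have q := hb2 b (u - 1) (by omega)
        simp only [sub_add_cancel] at p q
        rw [p, q]; ring
      · exact hF (b + 1) (k + 2) u h1 h2 (by omega) (by omega)
    have e3 : (if b + 1 = 1 then (1 : R) else 1 + Y b (k + 1) u)
        * (T b k u * T b (k + 2) u) = T b (k + 1) (u - 1) * T b (k + 1) (u + 1) := by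
      split_ifs with h
      · obtain rfl : b = 0 := by omega
        have p := hb3 (k + 1) u (by omega)
        have q := hb3 k (u - 1) (by omega)
        simp only [sub_add_cancel] at p q
        rw [p, q]; ring
      · exact hG b (k + 1) u (by omega) (by omega) h3 h4
    have e4 : (if b + 1 = r then (1 : R) else 1 + Y (b + 1 + 1) (k + 1) u)
        * (T (b + 2) k u * T (b + 2) (k + 2) u)
          = T (b + 2) (k + 1) (u - 1) * T (b + 2) (k + 1) (u + 1) := by
      split_ifs with h
      · subst h
        have p := hb4 (k + 1) u (by omega) (by omega)
        have q := hb4 (k + 2) (u - 1) (by omega) (by omega)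
        simp only [sub_add_cancel, Nat.add_sub_cancel, Nat.reduceSubDiff] at p q
        rw [p, q]; ring
      · exact hG (b + 2) (k + 1) u (by omega) (by omega) h3 h4
    have y1 := hYD (b + 1) (k + 1) (u - 1) h1 h2 h3 h4
    have y2 := hYD (b + 1) (k + 1) (u + 1) h1 h2 h3 h4
    simp only [Nat.add_sub_cancel] at y1 y2
    have U : ∀ x n v, x ≤ b + 2 → n ≤ k + 2 → IsUnit (T x n v) :=
      fun x n v hx hn => hunit _ _ _ (by omega) (by omega)
    generalize (if k + 1 = 1 then (1 : R) else 1 + Ring.inverse (Y (b + 1) k u)) = A at *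
    generalize (if k + 1 = ℓ - 1 then (1 : R)
      else 1 + Ring.inverse (Y (b + 1) (k + 1 + 1) u)) = B at *
    generalize (if b + 1 = 1 then (1 : R) else 1 + Y b (k + 1) u) = C at *
    generalize (if b + 1 = r then (1 : R) else 1 + Y (b + 1 + 1) (k + 1) u) = D at *
    have hU : IsUnit ((T (b + 1) k (u - 1) * T (b + 1) (k + 1 + 1) (u - 1))
        * (T (b + 1) k (u + 1) * T (b + 1) (k + 1 + 1) (u + 1))
        * ((T b k u * T (b + 2) k u) * (T b (k + 2) u * T (b + 2) (k + 2) u))) := by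
      refine (((U _ _ _ ?_ ?_).mul (U _ _ _ ?_ ?_)).mul ((U _ _ _ ?_ ?_).mul (U _ _ _ ?_ ?_))).mul
        (((U _ _ _ ?_ ?_).mul (U _ _ _ ?_ ?_)).mul ((U _ _ _ ?_ ?_).mul (U _ _ _ ?_ ?_))) <;> omega
    apply hU.mul_right_cancel
    generalize Y (b + 1) (k + 1) (u - 1) = Y1 at *
    generalize Y (b + 1) (k + 1) (u + 1) = Y2 at *
    calc _ = (Y1 * (T (b + 1) k (u - 1) * T (b + 1) (k + 1 + 1) (u - 1)))
          * (Y2 * (T (b + 1) k (u + 1) * T (b + 1) (k + 1 + 1) (u + 1)))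
          * (A * (T b k u * T (b + 2) k u)) * (B * (T b (k + 2) u * T (b + 2) (k + 2) u)) := by ring
      _ = (T b (k + 1) (u - 1) * T (b + 1 + 1) (k + 1) (u - 1))
          * (T b (k + 1) (u + 1) * T (b + 1 + 1) (k + 1) (u + 1))
          * (T (b + 1) k (u - 1) * T (b + 1) k (u + 1))
          * (T (b + 1) (k + 2) (u - 1) * T (b + 1) (k + 2) (u + 1)) := by rw [y1, y2, e1, e2]
      _ = (T b (k + 1) (u - 1) * T b (k + 1) (u + 1))
          * (T (b + 2) (k + 1) (u - 1) * T (b + 2) (k + 1) (u + 1))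
          * (T (b + 1) k (u - 1) * T (b + 1) k (u + 1))
          * (T (b + 1) (k + 2) (u - 1) * T (b + 1) (k + 2) (u + 1)) := by ring
      _ = _ := by rw [← e3, ← e4]; ring
end

section
/- Let R be a commutative ring, r ≥ 1, ℓ ≥ 2. For every regular solution Y = {Y^{(a)}_m(u)} in R of the level ℓ restricted Y-system 𝕐_ℓ(A_r), there exists a regular solution T = {T^{(a)}_m(u)} in R of the level ℓ restricted T-system 𝕋̃_ℓ(A_r) with spiral boundary condition such that Y^{(a)}_m(u) = T^{(a−1)}_m(u) · T^{(a+1)}_m(u) · (T^{(a)}_{m−1}(u) · T^{(a)}_{m+1}(u))^{−1} for all 1 ≤ a ≤ r, 1 ≤ m ≤ ℓ−1, u ∈ ℤ. -/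
theorem layers_aux {G : Type*} [CommGroup G] (H L : ℤ) (hH : 1 ≤ H) (hL : 1 ≤ L)
    (y0 y1 : ℤ → ℤ → G) :
    ∃ (f : ℤ → G) (t0 t1 : ℤ → ℤ → G),
      (∀ u, f (u + 2 * (H + L)) = f u) ∧
      (∀ a m, 1 ≤ a → y0 a m * (t0 a (m-1) * t0 a (m+1)) = t0 (a-1) m * t0 (a+1) m) ∧
      (∀ a m, 1 ≤ a → y1 a m * (t1 a (m-1) * t1 a (m+1)) = t1 (a-1) m * t1 (a+1) m) ∧
      (∀ m, 0 ≤ m → m ≤ L → t0 0 m = f m ∧ t1 0 m = f (m+1)) ∧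
      (∀ a, 0 ≤ a → a ≤ H → t0 a L = f (L + a) ∧ t1 a L = f (L+a+1)) ∧
      (∀ a, 0 ≤ a → a ≤ H → t0 a 0 = f (-a) ∧ t1 a 0 = f (-a+1)) ∧
      (∀ m, 0 ≤ m → m ≤ L → t0 H m = f (-m-H) ∧ t1 H m = f (-m-H+1)) := by
  -- particular solutions
  have part : ∀ y : ℤ → ℤ → G, ∃ s : ℤ → ℤ → G, ∀ a m, 1 ≤ a →
      y a m * (s a (m-1) * s a (m+1)) = s (a-1) m * s (a+1) m := by
    intro y
    let st : ℕ → (ℤ → G) × (ℤ → G) := fun n => Nat.rec (fun _ => 1, fun _ => 1)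
      (fun n p => (p.2, fun m => y (n+1) m * (p.2 (m-1) * p.2 (m+1)) / p.1 m)) n
    have h1 : ∀ n, (st (n+1)).1 = (st n).2 := fun n => rfl
    have h2 : ∀ n m, (st (n+1)).2 m =
      y (n+1) m * ((st n).2 (m-1) * (st n).2 (m+1)) / (st n).1 m := fun n m => rfl
    refine ⟨fun a m => (st a.toNat).1 m, ?_⟩
    intro a m ha
    obtain ⟨n, rfl⟩ : ∃ n : ℕ, a = n + 1 := ⟨(a-1).toNat, by omega⟩
    have e1 : ((n:ℤ)+1).toNat = n+1 := by omega
    have e2 : ((n:ℤ)+1-1).toNat = n := by omega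
    have e3 : ((n:ℤ)+1+1).toNat = n+1+1 := by omega
    simp only [e1, e2, e3, h1, h2]
    simp
  obtain ⟨s0, hs0⟩ := part y0
  obtain ⟨s1, hs1⟩ := part y1
  let pos : ℤ → ℤ × ℤ := fun i =>
    if 0 ≤ i then (if i ≤ L then (0, i) else (i - L, L))
    else (if -H ≤ i then (-i, 0) else (H, -i-H))
  let b0 : ℤ → G := fun i => s0 (pos i).1 (pos i).2
  let b1 : ℤ → G := fun i => s1 (pos i).1 (pos i).2
  let pp : ℕ → G × G := fun n => Nat.rec (1, 1)
    (fun k p => (p.2 * b1 k / b0 (k+1), p.1 * b0 (-k) / b1 (-k-1))) n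
  have pp1 : ∀ k, (pp (k+1)).1 = (pp k).2 * b1 k / b0 (k+1) := fun k => rfl
  have pp2 : ∀ k : ℕ, (pp (k+1)).2 = (pp k).1 * b0 (-k) / b1 (-k-1) := fun k => rfl
  let t0 : ℤ → ℤ → G := fun a m => s0 a m * (pp (a+m).natAbs).1
  let t1 : ℤ → ℤ → G := fun a m => s1 a m * (pp (a+m).natAbs).2
  let N := H + L
  have hN : N = H + L := rfl
  let f : ℤ → G := fun u =>
    let i := (u + N - 1) % (2*N) - (N - 1)
    b0 i * (pp i.natAbs).1
  have fper : ∀ u, f (u + 2*N) = f u := by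
    intro u
    have : (u + 2*N + N - 1) % (2*N) = (u + N - 1) % (2*N) := by
      rw [show u + 2*N + N - 1 = (u+N-1) + 2*N by ring, Int.add_emod_right]
    simp only [f, this]
  have fin : ∀ i, -N + 1 ≤ i → i ≤ N → f i = b0 i * (pp i.natAbs).1 := by
    intro i h1 h2
    have : (i + N - 1) % (2*N) - (N - 1) = i := by
      rw [Int.emod_eq_of_lt (by omega) (by omega)]; ring
    simp only [f, this]
  have b0N : b0 (-N) = b0 N := by
    have e1 : pos (-N) = (H, L) := by
      simp only [pos]; rw [if_neg (by omega), if_neg (by omega)]; ext <;> simp [hN]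
    have e2 : pos N = (H, L) := by
      simp only [pos]; rw [if_pos (by omega), if_neg (by omega)]; ext <;> simp [hN]
    simp only [b0, e1, e2]
  have b1N : b1 (-N) = b1 N := by
    have e1 : pos (-N) = (H, L) := by
      simp only [pos]; rw [if_neg (by omega), if_neg (by omega)]; ext <;> simp [hN]
    have e2 : pos N = (H, L) := by
      simp only [pos]; rw [if_pos (by omega), if_neg (by omega)]; ext <;> simp [hN]
    simp only [b1, e1, e2]
  have fin0 : ∀ i, -N ≤ i → i ≤ N → f i = b0 i * (pp i.natAbs).1 := by
    intro i h1 h2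
    rcases eq_or_lt_of_le h1 with h | h
    · subst h
      rw [← fper, show -N + 2*N = N by ring, fin N (by omega) le_rfl, b0N, Int.natAbs_neg]
    · exact fin i (by omega) h2
  have fin1' : ∀ i, -N ≤ i → i < N → f (i+1) = b1 i * (pp i.natAbs).2 := by
    intro i h1 h2
    rw [fin (i+1) (by omega) (by omega)]
    by_cases hi : 0 ≤ i
    · obtain ⟨k, rfl⟩ := Int.eq_ofNat_of_zero_le hi
      rw [show ((k:ℤ)+1).natAbs = k+1 by omega, show ((k:ℤ)).natAbs = k by omega, pp1]
      simp [mul_comm]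
    · obtain ⟨k, rfl⟩ : ∃ k : ℕ, i = -k-1 := ⟨(-i-1).toNat, by omega⟩
      rw [show (-(k:ℤ)-1+1).natAbs = k by omega, show (-(k:ℤ)-1).natAbs = k+1 by omega, pp2,
        show (-(k:ℤ)-1+1) = -k by ring]
      simp [mul_comm]
  have fin1 : ∀ i, -N ≤ i → i ≤ N → f (i+1) = b1 i * (pp i.natAbs).2 := by
    intro i h1 h2
    rcases eq_or_lt_of_le h2 with h | h
    · rw [h, show N + 1 = (-N + 1) + 2*N by ring, fper, fin1' (-N) (by omega) (by omega), b1N,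
        Int.natAbs_neg]
    · exact fin1' i h1 h
  have key : ∀ a m i, -N ≤ i → i ≤ N → pos i = (a, m) → (a+m).natAbs = i.natAbs →
      t0 a m = f i ∧ t1 a m = f (i+1) := by
    intro a m i h1 h2 h3 h4
    rw [fin0 i h1 h2, fin1 i h1 h2]
    simp only [t0, t1, b0, b1, h3, h4, and_self]
  refine ⟨f, t0, t1, fper, ?_, ?_, ?_, ?_, ?_, ?_⟩
  · intro a m ha
    have := hs0 a m ha
    simp only [t0]
    rw [show a + (m-1) = a-1+m by ring, show a + (m+1) = a+1+m by ring, mul_mul_mul_comm,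
      ← mul_assoc, this, mul_mul_mul_comm]
  · intro a m ha
    have := hs1 a m ha
    simp only [t1]
    rw [show a + (m-1) = a-1+m by ring, show a + (m+1) = a+1+m by ring, mul_mul_mul_comm,
      ← mul_assoc, this, mul_mul_mul_comm]
  · intro m h1 h2
    apply key _ _ _ (by omega) (by omega) _ (by omega)
    simp only [pos]
    rw [if_pos (by omega), if_pos (by omega)]
  · intro a h1 h2
    apply key _ _ _ (by omega) (by omega) _ (by omega)
    simp only [pos]
    rw [if_pos (by omega)]
    split_ifs
    · ext <;> simp <;> omega
    · ext <;> simp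
  · intro a h1 h2
    apply key _ _ _ (by omega) (by omega) _ (by omega)
    simp only [pos]
    split_ifs
    · ext <;> simp <;> omega
    · omega
    · ext <;> simp
    · omega
  · intro m h1 h2
    apply key _ _ _ (by omega) (by omega) _ (by omega)
    simp only [pos]
    rw [if_neg (by omega)]
    split_ifs
    · ext <;> simp <;> omega
    · ext <;> simp

theorem two_sided_rec {S : Type*} (F : ℤ → S → S → S) (x0 x1 : S)
    : ∃ X : ℤ → S, X 0 = x0 ∧ X 1 = x1 ∧ (∀ u, 1 ≤ u → X (u+1) = F u (X u) (X (u-1))) ∧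
      (∀ u, u ≤ 0 → X (u-1) = F u (X u) (X (u+1))) := by
  let fw : ℕ → S × S := fun n => Nat.rec (x0, x1) (fun n p => (p.2, F (n+1) p.2 p.1)) n
  let bw : ℕ → S × S := fun n => Nat.rec (x1, x0) (fun n p => (p.2, F (-n) p.2 p.1)) n
  have f1 : ∀ n, (fw (n+1)).1 = (fw n).2 := fun n => rfl
  have f2 : ∀ n, (fw (n+1)).2 = F (n+1) (fw n).2 (fw n).1 := fun n => rfl
  have g1 : ∀ n, (bw (n+1)).1 = (bw n).2 := fun n => rfl
  have g2 : ∀ n : ℕ, (bw (n+1)).2 = F (-n) (bw n).2 (bw n).1 := fun n => rfl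
  let X : ℤ → S := fun u => if 0 ≤ u then (fw u.toNat).1 else (bw (1-u).toNat).1
  have Xf : ∀ n : ℕ, X n = (fw n).1 := by
    intro n; simp [X]
  have Xb : ∀ n : ℕ, X (1 - n) = (bw n).1 := by
    intro n
    match n with
    | 0 => simp [X]; rfl
    | 1 => simp [X]; rfl
    | n+2 =>
      simp only [X]
      rw [if_neg (by omega), show (1 - (1 - ((n+2 : ℕ):ℤ))).toNat = n+2 by omega]
  refine ⟨X, rfl, rfl, ?_, ?_⟩
  · intro u hu
    obtain ⟨n, rfl⟩ : ∃ n : ℕ, u = n + 1 := ⟨(u-1).toNat, by omega⟩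
    have := Xf n
    have h1 := Xf (n+1)
    have h2 := Xf (n+2)
    push_cast at h1 h2
    rw [show (n:ℤ)+1+1 = n+2 by ring, show (n:ℤ)+1-1 = n by ring, h2, h1, this, f1 (n+1), f2, f1]
  · intro u hu
    obtain ⟨n, rfl⟩ : ∃ n : ℕ, u = -n := ⟨(-u).toNat, by omega⟩
    have := Xb n
    have h1 := Xb (n+1)
    have h2 := Xb (n+2)
    push_cast at h1 h2
    rw [show -(n:ℤ)-1 = 1 - (n+2) by ring, h2, show -(n:ℤ)+1 = 1 - n by ring, this, 
      show X (-n) = (bw (n+1)).1 by rw [← h1]; congr 1; ring, g1 (n+1), g2, g1]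

theorem lift_group {G : Type*} [CommGroup G] (H L : ℤ) (hH : 2 ≤ H) (hL : 2 ≤ L)
    (y w : ℤ → ℤ → ℤ → G)
    (hsys : ∀ a m u, 1 ≤ a → a < H → 1 ≤ m → m < L →
      y a m (u-1) * y a m (u+1) * (if m = 1 then 1 else w a (m-1) u / y a (m-1) u)
        * (if m = L - 1 then 1 else w a (m+1) u / y a (m+1) u)
      = (if a = 1 then 1 else w (a-1) m u) * (if a = H - 1 then 1 else w (a+1) m u)) :
    ∃ T : ℤ → ℤ → ℤ → G,
      (∀ a m u, 1 ≤ a → a < H → 1 ≤ m → m < L →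
        T a m (u-1) * T a m (u+1) = w a m u * (T a (m-1) u * T a (m+1) u)) ∧
      (∀ a m u, 1 ≤ a → a < H → 1 ≤ m → m < L →
        y a m u * (T a (m-1) u * T a (m+1) u) = T (a-1) m u * T (a+1) m u) ∧
      ∃ f : ℤ → G,
      (∀ a u, 0 ≤ a → a ≤ H → T a 0 u = f (u - a)) ∧
      (∀ a u, 0 ≤ a → a ≤ H → T a L u = f (u + L + a)) ∧
      (∀ m u, 0 ≤ m → m ≤ L → T 0 m u = f (u + m)) ∧
      (∀ m u, 0 ≤ m → m ≤ L → T H m u = f (u - m - H)) := by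
  obtain ⟨f, t0, t1, fper, ht0, ht1, c1, c2, c3, c4⟩ :=
    layers_aux H L (by omega) (by omega) (fun a m => y a m 0) (fun a m => y a m 1)
  let nb : ℤ → (ℤ → ℤ → G) → ℤ → ℤ → G := fun u X a m =>
    if a = 0 then f (u + m) else if m = L then f (u + L + a) else if m = 0 then f (u - a)
    else if a = H then f (u - m - H) else X a m
  let F : ℤ → (ℤ → ℤ → G) → (ℤ → ℤ → G) → (ℤ → ℤ → G) := fun u X Z a m =>
    w a m u * (nb u X a (m-1) * nb u X a (m+1)) / Z a m
  obtain ⟨X, X0, X1, Xp, Xm⟩ := two_sided_rec F t0 t1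
  let T : ℤ → ℤ → ℤ → G := fun a m u => nb u (X u) a m
  have d1 : ∀ a u, 0 ≤ a → a ≤ H → T a 0 u = f (u - a) := by
    intro a u h1 h2
    simp only [T, nb]
    split_ifs
    · congr 1; omega
    · omega
    · rfl
  have d2 : ∀ a u, 0 ≤ a → a ≤ H → T a L u = f (u + L + a) := by
    intro a u h1 h2
    simp only [T, nb]
    split_ifs
    · congr 1; omega
    · rfl
  have d3 : ∀ m u, 0 ≤ m → m ≤ L → T 0 m u = f (u + m) := by
    intro a u h1 h2
    simp only [T, nb, if_true]
  have d4 : ∀ m u, 0 ≤ m → m ≤ L → T H m u = f (u - m - H) := by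
    intro m u h1 h2
    simp only [T, nb]
    split_ifs
    · omega
    · rw [← fper (u - m - H)]; congr 1; subst m; ring
    · congr 1; omega
    · rfl
  have din : ∀ a m u, 1 ≤ a → a < H → 1 ≤ m → m < L → T a m u = X u a m := by
    intro a m u h1 h2 h3 h4
    simp only [T, nb]
    rw [if_neg (by omega), if_neg (by omega), if_neg (by omega), if_neg (by omega)]
  have hT : ∀ a m u, 1 ≤ a → a < H → 1 ≤ m → m < L →
        T a m (u-1) * T a m (u+1) = w a m u * (T a (m-1) u * T a (m+1) u) := by
    intro a m u h1 h2 h3 h4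
    rw [din a m _ h1 h2 h3 h4, din a m _ h1 h2 h3 h4]
    by_cases hu : 1 ≤ u
    · rw [Xp u hu]
      simp only [F, T]
      rw [mul_div_cancel]
    · rw [Xm u (by omega)]
      simp only [F, T]
      rw [div_mul_cancel]
  have T0 : ∀ a m, 0 ≤ a → a ≤ H → 0 ≤ m → m ≤ L → T a m 0 = t0 a m := by
    intro a m h1 h2 h3 h4
    simp only [T, nb]
    split_ifs with q1 q2 q3 q4
    · subst q1; rw [(c1 m h3 h4).1]; congr 1; ring
    · subst q2; rw [(c2 a h1 h2).1]; congr 1; ring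
    · subst q3; rw [(c3 a h1 h2).1]; congr 1; ring
    · subst q4; rw [(c4 m h3 h4).1]; congr 1; ring
    · rw [X0]
  have T1 : ∀ a m, 0 ≤ a → a ≤ H → 0 ≤ m → m ≤ L → T a m 1 = t1 a m := by
    intro a m h1 h2 h3 h4
    simp only [T, nb]
    split_ifs with q1 q2 q3 q4
    · subst q1; rw [(c1 m h3 h4).2]; congr 1; ring
    · subst q2; rw [(c2 a h1 h2).2]; congr 1; ring
    · subst q3; rw [(c3 a h1 h2).2]; congr 1; ring
    · subst q4; rw [(c4 m h3 h4).2]; congr 1; ring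
    · rw [X1]
  let P : ℤ → Prop := fun u => ∀ a m, 1 ≤ a → a < H → 1 ≤ m → m < L →
        y a m u * (T a (m-1) u * T a (m+1) u) = T (a-1) m u * T (a+1) m u
  have P0 : P 0 := by
    intro a m h1 h2 h3 h4
    rw [T0 _ _ (by omega) (by omega) (by omega) (by omega),
      T0 _ _ (by omega) (by omega) (by omega) (by omega),
      T0 _ _ (by omega) (by omega) (by omega) (by omega),
      T0 _ _ (by omega) (by omega) (by omega) (by omega)]
    exact ht0 a m h1
  have P1 : P 1 := by
    intro a m h1 h2 h3 h4
    rw [T1 _ _ (by omega) (by omega) (by omega) (by omega),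
      T1 _ _ (by omega) (by omega) (by omega) (by omega),
      T1 _ _ (by omega) (by omega) (by omega) (by omega),
      T1 _ _ (by omega) (by omega) (by omega) (by omega)]
    exact ht1 a m h1
  have step : ∀ u, P u → ∀ a m, 1 ≤ a → a < H → 1 ≤ m → m < L →
      (y a m (u-1) * (T a (m-1) (u-1) * T a (m+1) (u-1))) *
      (y a m (u+1) * (T a (m-1) (u+1) * T a (m+1) (u+1))) =
      (T (a-1) m (u-1) * T (a+1) m (u-1)) * (T (a-1) m (u+1) * T (a+1) m (u+1)) := by
    intro u hP a m h1 h2 h3 h4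
    have A1 : T (a-1) m (u-1) * T (a-1) m (u+1) =
        (if a = 1 then 1 else w (a-1) m u) * (T (a-1) (m-1) u * T (a-1) (m+1) u) := by
      split_ifs with h
      · subst h
        simp only [sub_self]
        rw [d3 _ _ (by omega) (by omega), d3 _ _ (by omega) (by omega),
          d3 _ _ (by omega) (by omega), d3 _ _ (by omega) (by omega), one_mul]
        congr 2 <;> ring
      · exact hT _ _ _ (by omega) (by omega) h3 h4
    have A2 : T (a+1) m (u-1) * T (a+1) m (u+1) =
        (if a = H - 1 then 1 else w (a+1) m u) * (T (a+1) (m-1) u * T (a+1) (m+1) u) := by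
      split_ifs with h
      · subst h
        simp only [sub_add_cancel]
        rw [d4 _ _ (by omega) (by omega), d4 _ _ (by omega) (by omega),
          d4 _ _ (by omega) (by omega), d4 _ _ (by omega) (by omega), one_mul, mul_comm]
        congr 2 <;> ring
      · exact hT _ _ _ (by omega) (by omega) h3 h4
    have A3 : T a (m-1) (u-1) * T a (m-1) (u+1) =
        (if m = 1 then 1 else w a (m-1) u / y a (m-1) u) *
          (T (a-1) (m-1) u * T (a+1) (m-1) u) := by
      split_ifs with h
      · subst h
        simp only [sub_self]
        rw [d1 _ _ (by omega) (by omega), d1 _ _ (by omega) (by omega),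
          d1 _ _ (by omega) (by omega), d1 _ _ (by omega) (by omega), one_mul, mul_comm]
        congr 2 <;> ring
      · rw [hT _ _ _ h1 h2 (by omega) (by omega), ← hP a (m-1) h1 h2 (by omega) (by omega),
          ← mul_assoc (_ / _), div_mul_cancel]
    have A4 : T a (m+1) (u-1) * T a (m+1) (u+1) =
        (if m = L - 1 then 1 else w a (m+1) u / y a (m+1) u) *
          (T (a-1) (m+1) u * T (a+1) (m+1) u) := by
      split_ifs with h
      · subst h
        simp only [sub_add_cancel]
        rw [d2 _ _ (by omega) (by omega), d2 _ _ (by omega) (by omega),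
          d2 _ _ (by omega) (by omega), d2 _ _ (by omega) (by omega), one_mul]
        congr 2 <;> ring
      · rw [hT _ _ _ h1 h2 (by omega) (by omega), ← hP a (m+1) h1 h2 (by omega) (by omega),
          ← mul_assoc (_ / _), div_mul_cancel]
    have S := hsys a m u h1 h2 h3 h4
    generalize (if m = 1 then 1 else w a (m-1) u / y a (m-1) u) = v1 at *
    generalize (if m = L - 1 then 1 else w a (m+1) u / y a (m+1) u) = v2 at *
    generalize (if a = 1 then 1 else w (a-1) m u) = w1 at *
    generalize (if a = H - 1 then 1 else w (a+1) m u) = w2 at *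
    rw [mul_mul_mul_comm, mul_mul_mul_comm (T a (m-1) (u-1)), A3, A4,
      mul_mul_mul_comm (T (a-1) m (u-1)), A1, A2, mul_mul_mul_comm w1, ← S,
      mul_mul_mul_comm v1, mul_mul_mul_comm (T (a-1) (m-1) u)]
    simp only [mul_assoc]
  have all : ∀ n : ℕ, P (n:ℤ) ∧ P (n+1) ∧ P (-n) ∧ P (1 - n) := by
    intro n
    induction n with
    | zero => simpa using ⟨P0, P1, P0, P1⟩
    | succ n ih =>
      obtain ⟨i1, i2, i3, i4⟩ := ih
      have q1 : P ((n:ℤ) + 1 + 1) := by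
        intro a m h1 h2 h3 h4
        have s := step _ i2 a m h1 h2 h3 h4
        rw [show (n:ℤ) + 1 - 1 = n by ring, i1 a m h1 h2 h3 h4] at s
        exact mul_left_cancel s
      have q2 : P (-(n:ℤ) - 1) := by
        intro a m h1 h2 h3 h4
        have s := step _ i3 a m h1 h2 h3 h4
        rw [show -(n:ℤ) + 1 = 1 - n by ring, i4 a m h1 h2 h3 h4] at s
        exact mul_right_cancel s
      refine ⟨by exact_mod_cast i2, by exact_mod_cast q1, ?_, ?_⟩
      · rw [show -((n+1 : ℕ) : ℤ) = -n - 1 by push_cast; ring]; exact q2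
      · rw [show 1 - ((n+1 : ℕ) : ℤ) = -n by push_cast; ring]; exact i3
  refine ⟨T, hT, ?_, f, d1, d2, d3, d4⟩
  intro a m u
  have : P u := by
    rcases Int.eq_nat_or_neg u with ⟨n, rfl | rfl⟩
    · exact (all n).1
    · exact (all n).2.2.1
  exact this a m

/-- Every regular solution of the level `ℓ` restricted Y-system `𝕐_ℓ(A_r)` arises
from a regular solution of the level `ℓ` restricted T-system `𝕋̃_ℓ(A_r)` with the
spiral boundary condition. -/
theorem restricted_Y_lifts_to_T_Ar {R : Type*} [CommRing R]
    (r ℓ : ℕ) (hr : 1 ≤ r) (hℓ : 2 ≤ ℓ)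
    (Y : ℕ → ℕ → ℤ → R)
    (hYu : ∀ a m u, 1 ≤ a → a ≤ r → 1 ≤ m → m ≤ ℓ - 1 → IsUnit (Y a m u))
    (hY1u : ∀ a m u, 1 ≤ a → a ≤ r → 1 ≤ m → m ≤ ℓ - 1 → IsUnit (1 + Y a m u))
    (hYsys : ∀ a m u, 1 ≤ a → a ≤ r → 1 ≤ m → m ≤ ℓ - 1 →
      Y a m (u - 1) * Y a m (u + 1)
          * (if m = 1 then 1 else 1 + Ring.inverse (Y a (m - 1) u))
          * (if m = ℓ - 1 then 1 else 1 + Ring.inverse (Y a (m + 1) u))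
        = (if a = 1 then 1 else 1 + Y (a - 1) m u)
          * (if a = r then 1 else 1 + Y (a + 1) m u)) :
    ∃ T : ℕ → ℕ → ℤ → R,
      (∀ a m u, a ≤ r + 1 → m ≤ ℓ → IsUnit (T a m u)) ∧
      (∀ a m u, 1 ≤ a → a ≤ r → 1 ≤ m → m ≤ ℓ - 1 →
        T a m (u - 1) * T a m (u + 1)
          = T a (m - 1) u * T a (m + 1) u + T (a - 1) m u * T (a + 1) m u) ∧
      (∀ a u, 1 ≤ a → a ≤ r + 1 → T a 0 (u + 1) = T (a - 1) 0 u) ∧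
      (∀ a u, a ≤ r → T a ℓ (u + 1) = T (a + 1) ℓ u) ∧
      (∀ m u, m ≤ ℓ - 1 → T 0 m (u + 1) = T 0 (m + 1) u) ∧
      (∀ m u, 1 ≤ m → m ≤ ℓ → T (r + 1) m (u + 1) = T (r + 1) (m - 1) u) ∧
      (∀ a m u, 1 ≤ a → a ≤ r → 1 ≤ m → m ≤ ℓ - 1 →
        Y a m u = T (a - 1) m u * T (a + 1) m u
          * Ring.inverse (T a (m - 1) u * T a (m + 1) u)) := by
  classical
  let y : ℤ → ℤ → ℤ → Rˣ := fun a m u =>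
    if h : IsUnit (Y a.toNat m.toNat u) then h.unit else 1
  let w : ℤ → ℤ → ℤ → Rˣ := fun a m u =>
    if h : IsUnit (1 + Y a.toNat m.toNat u) then h.unit else 1
  have hy : ∀ (a m : ℕ) u, 1 ≤ a → a ≤ r → 1 ≤ m → m ≤ ℓ - 1 → (y a m u : R) = Y a m u := by
    intro a m u h1 h2 h3 h4
    have h := hYu a m u h1 h2 h3 h4
    simp [y, h]
  have hw : ∀ (a m : ℕ) u, 1 ≤ a → a ≤ r → 1 ≤ m → m ≤ ℓ - 1 →
      (w a m u : R) = 1 + Y a m u := by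
    intro a m u h1 h2 h3 h4
    have h := hY1u a m u h1 h2 h3 h4
    simp [w, h]
  have hwy : ∀ (a m : ℕ) u, 1 ≤ a → a ≤ r → 1 ≤ m → m ≤ ℓ - 1 →
      ((w a m u / y a m u : Rˣ) : R) = 1 + Ring.inverse (Y a m u) := by
    intro a m u h1 h2 h3 h4
    rw [← hy a m u h1 h2 h3 h4, Ring.inverse_unit, div_eq_mul_inv, Units.val_mul,
      hw a m u h1 h2 h3 h4, ← hy a m u h1 h2 h3 h4, add_mul, Units.mul_inv, one_mul, add_comm]
  obtain ⟨T, hT, hYT, f, d1, d2, d3, d4⟩ := lift_group ((r:ℤ)+1) ℓ (by omega) (by omega) y w (by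
    intro a m u h1 h2 h3 h4
    lift a to ℕ using by omega
    lift m to ℕ using by omega
    have S := hYsys a m u (by omega) (by omega) (by omega) (by omega)
    have ea : 1 ≤ a := by omega
    have ea' : a ≤ r := by omega
    have em : 1 ≤ m := by omega
    have em' : m ≤ ℓ - 1 := by omega
    have B1 : (((if (m:ℤ) = 1 then 1 else w a ((m:ℤ)-1) u / y a ((m:ℤ)-1) u) : Rˣ) : R) =
        (if m = 1 then 1 else 1 + Ring.inverse (Y a (m - 1) u)) := by
      by_cases h : m = 1
      · rw [if_pos h, if_pos (by omega)]; rfl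
      · rw [if_neg h, if_neg (by omega), ← hwy a (m-1) u ea ea' (by omega) (by omega),
          show ((m - 1 : ℕ) : ℤ) = m - 1 by omega]
    have B2 : (((if (m:ℤ) = ℓ - 1 then 1 else w a ((m:ℤ)+1) u / y a ((m:ℤ)+1) u) : Rˣ) : R) =
        (if m = ℓ - 1 then 1 else 1 + Ring.inverse (Y a (m + 1) u)) := by
      by_cases h : m = ℓ - 1
      · rw [if_pos h, if_pos (by omega)]; rfl
      · rw [if_neg h, if_neg (by omega), ← hwy a (m+1) u ea ea' (by omega) (by omega),
          show ((m + 1 : ℕ) : ℤ) = m + 1 by omega]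
    have B3 : (((if (a:ℤ) = 1 then 1 else w ((a:ℤ)-1) m u) : Rˣ) : R) =
        (if a = 1 then 1 else 1 + Y (a-1) m u) := by
      by_cases h : a = 1
      · rw [if_pos h, if_pos (by omega)]; rfl
      · rw [if_neg h, if_neg (by omega), ← hw (a-1) m u (by omega) (by omega) em em',
          show ((a - 1 : ℕ) : ℤ) = a - 1 by omega]
    have B4 : (((if (a:ℤ) = (r:ℤ) + 1 - 1 then 1 else w ((a:ℤ)+1) m u) : Rˣ) : R) =
        (if a = r then 1 else 1 + Y (a+1) m u) := by
      by_cases h : a = r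
      · rw [if_pos h, if_pos (by omega)]; rfl
      · rw [if_neg h, if_neg (by omega), ← hw (a+1) m u (by omega) (by omega) em em',
          show ((a + 1 : ℕ) : ℤ) = a + 1 by omega]
    apply Units.ext
    rw [Units.val_mul, Units.val_mul, Units.val_mul, Units.val_mul, B1, B2, B3, B4,
      hy a m _ ea ea' em em', hy a m _ ea ea' em em']
    exact S)
  refine ⟨fun a m u => (T a m u : R), fun a m u _ _ => Units.isUnit _, ?_, ?_, ?_, ?_, ?_, ?_⟩
  · intro a m u h1 h2 h3 h4
    have e1 := congrArg Units.val (hT a m u (by omega) (by omega) (by omega) (by omega))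
    have e2 := congrArg Units.val (hYT a m u (by omega) (by omega) (by omega) (by omega))
    simp only [Units.val_mul, hw a m u h1 h2 h3 h4, hy a m u h1 h2 h3 h4] at e1 e2
    simp only [show ((m - 1 : ℕ) : ℤ) = m - 1 by omega, show ((a - 1 : ℕ) : ℤ) = a - 1 by omega,
      Nat.cast_add, Nat.cast_one]
    rw [e1, ← e2]; ring
  · intro a u h1 h2
    simp only [Nat.cast_zero]
    rw [d1 _ _ (by omega) (by omega), d1 _ _ (by omega) (by omega)]
    congr 2; omega
  · intro a u h1
    simp only [Nat.cast_add, Nat.cast_one]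
    rw [d2 _ _ (by omega) (by omega), d2 _ _ (by omega) (by omega)]
    congr 2; omega
  · intro m u h1
    simp only [Nat.cast_zero]
    rw [d3 _ _ (by omega) (by omega), d3 _ _ (by omega) (by omega)]
    congr 2; omega
  · intro m u h1 h2
    simp only [Nat.cast_add, Nat.cast_one]
    rw [d4 _ _ (by omega) (by omega), d4 _ _ (by omega) (by omega)]
    congr 2; omega
  · intro a m u h1 h2 h3 h4
    have e2 := hYT a m u (by omega) (by omega) (by omega) (by omega)
    simp only [show ((m - 1 : ℕ) : ℤ) = m - 1 by omega, show ((a - 1 : ℕ) : ℤ) = a - 1 by omega,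
      Nat.cast_add, Nat.cast_one]
    rw [← Units.val_mul, ← Units.val_mul, Ring.inverse_unit, ← e2, ← Units.val_mul,
      mul_inv_cancel_right, hy a m u h1 h2 h3 h4]
end

section
/- Let R be a commutative ring, r ≥ 1, ℓ ≥ 2, and let Y = {Y^{(a)}_m(u)} be a regular solution in R of the level ℓ restricted Y-system 𝕐_ℓ(A_r). Then for all 1 ≤ a ≤ r, 1 ≤ m ≤ ℓ−1, u ∈ ℤ: (1) half-periodicity: Y^{(a)}_m(u + r + 1 + ℓ) = Y^{(r+1−a)}_{ℓ−m}(u); (2) periodicity: Y^{(a)}_m(u + 2(r + 1 + ℓ)) = Y^{(a)}_m(u). -/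
namespace YSys

section dets
variable {R : Type*} [CommRing R]

/-- determinant of rows -/
def F (n : ℕ) (f : Fin n → Fin n → R) : R := Matrix.detRowAlternating f

theorem F_pull (n : ℕ) (p : Fin (n+1)) (f : Fin (n+1) → Fin (n+1) → R) :
    F (n+1) f = (-1)^(p:ℕ) * F (n+1) (Fin.cons (f p) (fun k => f (p.succAbove k))) := by
  have h := AlternatingMap.map_insertNth (Matrix.detRowAlternating (n := Fin (n+1)) (R := R)) p
    (f p) (fun k => f (p.succAbove k))
  have e : p.insertNth (f p) (fun k => f (p.succAbove k)) = f :=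
    Fin.insertNth_self_removeNth p f
  rw [e] at h
  unfold F
  rw [h]
  simp [Matrix.vecCons]

theorem F_pull2 (n : ℕ) (p : Fin (n+2)) (q : Fin (n+1)) (f : Fin (n+2) → Fin (n+2) → R) :
    F (n+2) f = (-1)^(p:ℕ) * ((-1)^(q:ℕ) * F (n+2) (Fin.cons (f p) (Fin.cons (f (p.succAbove q))
      (fun k => f (p.succAbove (q.succAbove k)))))) := by
  rw [F_pull (n+1) p f]
  congr 1
  have h := AlternatingMap.map_insertNth
    ((Matrix.detRowAlternating (n := Fin (n+2)) (R := R)).curryLeft (f p)) q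
    (f (p.succAbove q)) (fun k => f (p.succAbove (q.succAbove k)))
  have e : q.insertNth (f (p.succAbove q)) (fun k => f (p.succAbove (q.succAbove k)))
      = fun k => f (p.succAbove k) :=
    Fin.insertNth_self_removeNth q (fun k => f (p.succAbove k))
  rw [e] at h
  simp only [AlternatingMap.curryLeft_apply_apply, Matrix.vecCons] at h
  unfold F
  rw [h]
  simp

/-- linear expansions -/
theorem cramerF (n : ℕ) (f : Fin n → Fin n → R) (x : Fin n → R) :
    F n f • x = ∑ k, F n (Function.update f k x) • f k := by
  have h := Matrix.mulVec_cramer (Matrix.transpose (Matrix.of f)) x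
  rw [Matrix.det_transpose] at h
  have : F n f = (Matrix.of f).det := rfl
  rw [this, ← h]
  ext j
  simp only [Matrix.mulVec, dotProduct, Matrix.cramer_transpose_apply, Finset.sum_apply,
    Pi.smul_apply, smul_eq_mul, Matrix.transpose_apply, Matrix.of_apply]
  refine Finset.sum_congr rfl fun k _ => ?_
  rw [mul_comm]
  rfl

theorem F_update_sum (n : ℕ) {ι : Type*} (s : Finset ι) (f : Fin n → Fin n → R) (i : Fin n)
    (c : ι → R) (g : ι → Fin n → R) :
    F n (Function.update f i (∑ k ∈ s, c k • g k))
      = ∑ k ∈ s, c k * F n (Function.update f i (g k)) := by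
  unfold F
  rw [AlternatingMap.map_update_sum]
  simp

theorem F_dup (n : ℕ) (f : Fin n → Fin n → R) (i j : Fin n) (hij : i ≠ j) (h : f i = f j) :
    F n f = 0 := AlternatingMap.map_eq_zero_of_eq _ f h hij

theorem plucker (n : ℕ) (M : Fin n → Fin (n+2) → R) (x y z w : Fin (n+2) → R) :
    F (n+2) (Fin.cons x (Fin.cons z M)) * F (n+2) (Fin.cons y (Fin.cons w M))
     = F (n+2) (Fin.cons x (Fin.cons y M)) * F (n+2) (Fin.cons z (Fin.cons w M))
     + F (n+2) (Fin.cons x (Fin.cons w M)) * F (n+2) (Fin.cons y (Fin.cons z M)) := by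
  set Q : (Fin (n+2) → R) → (Fin (n+2) → R) → R := fun a b => F (n+2) (Fin.cons a (Fin.cons b M))
    with hQ
  change Q x z * Q y w = Q x y * Q z w + Q x w * Q y z
  -- expand x in terms of y, w : Q(y,w) x = Q(x,w) y + Q(y,x) w + ...
  have h := cramerF (n+2) (Fin.cons y (Fin.cons w M)) x
  have h2 := congrArg (fun X => F (n+2) (Function.update (Fin.cons 0 (Fin.cons z M) : Fin (n+2) → _) 0 X)) h
  rw [F_update_sum] at h2
  have anti : ∀ a b, Q a b = - Q b a := by
    intro a b
    have := AlternatingMap.map_swap (Matrix.detRowAlternating (n := Fin (n+2)) (R := R))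
      (Fin.cons b (Fin.cons a M)) (i := 0) (j := 1) (by simp)
    rw [hQ]
    simp only [F]
    rw [← this]
    congr 1
    funext k
    refine Fin.cases ?_ (fun k => Fin.cases ?_ (fun k => ?_) k) k
    · simp
    · simp
    · rw [Function.comp_apply, Equiv.swap_apply_of_ne_of_ne]
      · simp
      · simp
      · simp [Fin.ext_iff]
  rw [Fin.sum_univ_succ, Fin.sum_univ_succ] at h2
  have hz : ∀ k : Fin n, F (n+2) (Function.update (Fin.cons 0 (Fin.cons z M) : Fin (n+2) → Fin (n+2) → R) 0
     ((Fin.cons y (Fin.cons w M) : Fin (n+2) → Fin (n+2) → R) k.succ.succ)) = 0 := by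
    intro k
    apply F_dup _ _ 0 k.succ.succ
    · exact (Fin.succ_ne_zero _).symm
    · simp
  simp only [hz, mul_zero, Finset.sum_const_zero, add_zero] at h2
  have e1 : F (n+2) (Function.update (Fin.cons 0 (Fin.cons z M) : Fin (n+2) → Fin (n+2) → R) 0
     (F (n+2) (Fin.cons y (Fin.cons w M)) • x)) = Q y w * Q x z := by
    have := F_update_sum (n+2) {()} (Fin.cons 0 (Fin.cons z M) : Fin (n+2) → Fin (n+2) → R) 0
       (fun _ => Q y w) (fun _ => x)
    simpa using this
  rw [e1] at h2
  have e2 : (Function.update (Fin.cons y (Fin.cons w M) : Fin (n+2) → Fin (n+2) → R) (Fin.succ 0) x)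
     = Fin.cons y (Fin.cons x M) := by
    rw [← Fin.cons_update]; simp
  rw [e2] at h2
  simp only [Fin.update_cons_zero, Fin.cons_zero, Fin.cons_succ] at h2
  change Q y w * Q x z = Q x w * Q y z + Q y x * Q w z at h2
  rw [anti y x, anti w z] at h2
  linear_combination h2

/-- minors -/
def D {s : ℕ} (v : ℕ → Fin (s+2) → R) (a i m : ℕ) : R :=
  F (s+2) (fun k => v (i + k + if (k:ℕ) < a then 0 else m))

theorem sA {n : ℕ} (p : Fin (n+1)) (k : Fin n) : ((p.succAbove k : Fin (n+1)) : ℕ)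
     = if (k:ℕ) < p then (k:ℕ) else k+1 := by
  simp only [Fin.succAbove, Fin.lt_def]
  split_ifs <;> simp_all

theorem F_pull2' {s : ℕ} (v : ℕ → Fin (s+2) → R) (idx : Fin (s+2) → ℕ) (p : Fin (s+2))
    (q : Fin (s+1)) (x y : ℕ) (M : Fin s → ℕ) (hx : idx p = x) (hy : idx (p.succAbove q) = y)
    (hM : ∀ k, idx (p.succAbove (q.succAbove k)) = M k) :
    F (s+2) (fun k => v (idx k)) =
      (-1)^(p:ℕ) * ((-1)^(q:ℕ) * F (s+2) (Fin.cons (v x) (Fin.cons (v y) (fun k => v (M k))))) := by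
  rw [F_pull2 s p q]
  simp only [hx, hy, hM]

theorem D_plucker {s : ℕ} (v : ℕ → Fin (s+2) → R) (b i m : ℕ) (hb : b ≤ s) :
    D v (b+1) i (m+1) * D v (b+1) (i+1) (m+1)
     = D v (b+2) i (m+1) * D v b (i+1) (m+1) + D v (b+1) i (m+2) * D v (b+1) (i+1) m := by
  let M : Fin s → ℕ := fun k => i + 1 + k + if (k:ℕ) < b then 0 else m + 2
  have P := plucker s (fun k => v (M k))
    (v i) (v (i+1+b)) (v (i+1+b+(m+1))) (v (i+1+(m+1)+(s+1)))
  let B : Fin (s+1) := ⟨b, by omega⟩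
  let B' : Fin (s+2) := ⟨b, by omega⟩
  have anti : ∀ x y, F (s+2) (Fin.cons x (Fin.cons y (fun k => v (M k))))
     = - F (s+2) (Fin.cons y (Fin.cons x (fun k => v (M k)))) := by
    intro x y
    have h := F_pull2 s 1 0 (Fin.cons x (Fin.cons y (fun k => v (M k))))
    simpa using h
  have G1 : D v (b+1) i (m+1) = _ :=
    F_pull2' v _ 0 B i (i+1+b+(m+1)) M (by simp) (by simp [B]; omega)
      (by intro k; simp [sA, B, M]; split_ifs <;> omega)
  have G2 : D v (b+2) i (m+1) = _ :=
    F_pull2' v _ 0 B i (i+1+b) M (by simp) (by simp [B]; omega)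
      (by intro k; simp [sA, B, M]; split_ifs <;> omega)
  have G3 : D v (b+1) (i+1) (m+1) = _ :=
    F_pull2' v _ (Fin.last _) B (i+1+(m+1)+(s+1)) (i+1+b) M (by simp; split_ifs <;> omega) (by simp [B])
      (by intro k; simp [sA, B, M]; split_ifs <;> omega)
  have G4 : D v b (i+1) (m+1) = _ :=
    F_pull2' v _ (Fin.last _) B (i+1+(m+1)+(s+1)) (i+1+b+(m+1)) M (by simp; split_ifs <;> omega) (by simp [B])
      (by intro k; simp [sA, B, M]; split_ifs <;> omega)
  have G5 : D v (b+1) i (m+2) = _ :=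
    F_pull2' v _ 0 (Fin.last _) i (i+1+(m+1)+(s+1)) M (by simp) (by simp; split_ifs <;> omega)
      (by intro k; simp [M]; omega)
  have G6 : D v (b+1) (i+1) m = _ :=
    F_pull2' v _ B' B (i+1+b) (i+1+b+(m+1)) M (by simp [B']) (by simp [B, B', sA]; omega)
      (by intro k; simp [sA, B, B', M]; split_ifs <;> omega)
  rw [G1, G2, G3, G4, G5, G6, anti (v (i+1+(m+1)+(s+1))) (v (i+1+b)),
     anti (v (i+1+(m+1)+(s+1))) (v (i+1+b+(m+1)))]
  have sg : ((-1:R)^b) * (-1)^b = 1 := by rw [← mul_pow]; simp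
  simp only [B, B', Fin.val_last, Fin.val_zero, pow_zero, pow_succ]
  linear_combination ((-1)^s * (-1)^b * (-1)^b) * P

theorem D_zero {s : ℕ} (v : ℕ → Fin (s+2) → R) (a i : ℕ) : D v a i 0 = D v 0 i 0 := by
  simp [D]

theorem D_left {s : ℕ} (v : ℕ → Fin (s+2) → R) (i m : ℕ) : D v 0 i m = D v 0 (i+m) 0 := by
  simp [D]; congr 1; funext k; congr 1; omega

theorem D_right {s : ℕ} (v : ℕ → Fin (s+2) → R) (i m : ℕ) : D v (s+2) i m = D v 0 i 0 := by
  simp [D]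

/-- existence of the vectors -/
theorem exists_v (s : ℕ) (e : ℕ → ℕ → R) (he : ∀ i, e 0 i = 1) :
    ∃ v : ℕ → Fin (s+2) → R, (∀ i, D v 0 i 0 = 1) ∧ ∀ a i, a ≤ s+1 → D v a i 1 = e a i := by
  let nxt : ℕ → (Fin (s+2) → Fin (s+2) → R) → (Fin (s+2) → R) := fun i W =>
    ∑ a : Fin (s+2), (-(-1)^s * (-1)^(a:ℕ) * e a i) • W a
  let W : ℕ → (Fin (s+2) → Fin (s+2) → R) := fun i => Nat.rec (fun k => Pi.single k 1)
    (fun i W => Fin.snoc (fun k : Fin (s+1) => W k.succ) (nxt i W)) i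
  have W0 : W 0 = fun k => Pi.single k 1 := rfl
  have WS : ∀ i, W (i+1) = Fin.snoc (fun k : Fin (s+1) => W i k.succ) (nxt i (W i)) := fun i => rfl
  let v : ℕ → Fin (s+2) → R := fun i => W i 0
  have hW : ∀ k : ℕ, ∀ (hk : k < s+2), ∀ i, W i ⟨k, hk⟩ = v (i+k) := by
    intro k
    induction k with
    | zero => intro hk i; rfl
    | succ k ih =>
      intro hk i
      have := ih (by omega) (i+1)
      rw [show i + (k+1) = i+1+k by omega, ← this, WS]
      have : (⟨k, by omega⟩ : Fin (s+2)) = Fin.castSucc ⟨k, by omega⟩ := rfl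
      rw [this, Fin.snoc_castSucc]
      rfl
  have hW' : ∀ i, W i = fun k : Fin (s+2) => v (i + k) := by
    intro i; funext k; exact hW k k.2 i
  have hrec : ∀ i, v (i + (s+2)) = nxt i (W i) := by
    intro i
    have h1 := hW (s+1) (by omega) (i+1)
    rw [show i + (s+2) = i+1+(s+1) by omega, ← h1, WS]
    have : (⟨s+1, by omega⟩ : Fin (s+2)) = Fin.last _ := rfl
    rw [this, Fin.snoc_last]
  have key : ∀ a i, a ≤ s+1 → D v a i 1 = e a i * D v 0 i 0 := by
    intro a i ha
    have h1 : D v a i 1 = F (s+2) (Function.update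
       (fun k : Fin (s+2) => v (i + k + if (k:ℕ) < a then 0 else 1)) (Fin.last _)
         (∑ b : Fin (s+2), (-(-1)^s * (-1)^(b:ℕ) * e b i) • v (i+b))) := by
      have : (∑ b : Fin (s+2), (-(-1)^s * (-1)^(b:ℕ) * e b i) • v (i+b)) = v (i+(s+2)) := by
        rw [hrec, hW']
      rw [this, Function.update_eq_self_iff.2]
      · rfl
      · show v (i+(s+2)) = v (i + (s+1) + if s+1<a then 0 else 1); rw [if_neg (by omega)]; rfl
    rw [h1, F_update_sum]
    let A : Fin (s+2) := ⟨a, by omega⟩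
    rw [Finset.sum_eq_single A]
    · have h2 := F_pull (s+1) A (fun k : Fin (s+2) => v (i + k))
      have h3 := F_pull (s+1) (Fin.last _) (Function.update
        (fun k : Fin (s+2) => v (i + k + if (k:ℕ) < a then 0 else 1)) (Fin.last _) (v (i + A)))
      have h4 : D v 0 i 0 = F (s+2) (fun k : Fin (s+2) => v (i + k)) := by simp [D]
      rw [h3, h4, h2]
      have h5 : (fun k : Fin (s+1) => (Function.update
        (fun k : Fin (s+2) => v (i + k + if (k:ℕ) < a then 0 else 1)) (Fin.last _) (v (i + A)))
          ((Fin.last _).succAbove k)) = fun k => v (i + (A.succAbove k : Fin (s+2))) := by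
        funext k
        rw [Function.update_of_ne (Fin.succAbove_ne _ _)]
        congr 1
        simp only [sA, A, Fin.val_last, k.2, if_true]
        split_ifs <;> omega
      rw [h5]
      simp only [Function.update_self, A, Fin.val_last, pow_succ]
      have sg : ((-1:R)^s) * (-1)^s = 1 := by rw [← mul_pow]; simp
      linear_combination ((-1) ^ a * e a i * F (s+1+1) (Fin.cons (v (i + a)) fun k => v (i + (A.succAbove k : Fin (s+2))))) * sg
    · intro b _ hb
      have hb' : (b:ℕ) ≠ a := fun h => hb (Fin.ext h)
      have : ∃ c : Fin (s+1), (b:ℕ) = c + if (c:ℕ) < a then 0 else 1 := by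
        by_cases h : (b:ℕ) < a
        · exact ⟨⟨b, by omega⟩, by simp [h]⟩
        · exact ⟨⟨b-1, by omega⟩, by simp; split_ifs <;> omega⟩
      obtain ⟨c, hc⟩ := this
      rw [F_dup _ _ (Fin.last _) c.castSucc (Fin.castSucc_lt_last c).ne', mul_zero]
      rw [Function.update_self, Function.update_of_ne (Fin.castSucc_lt_last c).ne]
      congr 1
      simp only [Fin.val_castSucc]
      omega
    · simp
  have hone : ∀ i, D v 0 i 0 = 1 := by
    intro i
    induction i with
    | zero =>
      have : D v 0 0 0 = F (s+2) (W 0) := by rw [hW']; simp [D]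
      rw [this, W0]
      have : (fun k => Pi.single k 1 : Fin (s+2) → Fin (s+2) → R) = (1 : Matrix _ _ R) := by
        ext a b; simp [Matrix.one_apply, Pi.single_apply, eq_comm]
      rw [this]
      exact Matrix.det_one
    | succ i ih =>
      rw [← D_left, key 0 i (by omega), he, ih, one_mul]
  exact ⟨v, hone, fun a i ha => by rw [key a i ha, hone, mul_one]⟩

/-- closing up of the vectors -/
theorem closure_v {s : ℕ} (v : ℕ → Fin (s+2) → R) (l : ℕ) (hone : ∀ i, D v 0 i 0 = 1)
    (hu : ∀ a i, a ≤ s+1 → IsUnit (D v a i l)) (hz : ∀ a i, a ≤ s → D v (a+1) i (l+1) = 0) (i : ℕ) :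
    ∃ c : R, v i = c • v (i + (s+2+l)) := by
  let f : Fin (s+2) → Fin (s+2) → R := fun k => v (i+l+1+k)
  have hf : F (s+2) f = 1 := by rw [← hone (i+l+1)]; simp [D, f]
  have hc := cramerF (s+2) f (v i)
  rw [hf, one_smul] at hc
  obtain ⟨c, hcd⟩ : ∃ c : Fin (s+2) → R, c = fun k => F (s+2) (Function.update f k (v i)) := ⟨_, rfl⟩
  have hc : v i = ∑ k, c k • f k := by rw [hcd]; exact hc
  have hc0 : ∀ k : ℕ, ∀ hk : k < s+1, c ⟨k, by omega⟩ = 0 := by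
    intro k
    induction k using Nat.strong_induction_on with
    | _ k ih =>
      intro hk
      have h0 := hz k i (by omega)
      let K : Fin (s+2) := ⟨k, by omega⟩
      let g : Fin (s+2) → Fin (s+2) → R := fun p => v (i + p + if (p:ℕ) < k+1 then 0 else l+1)
      have h1 : D v (k+1) i (l+1) = F (s+2) (Function.update g 0 (∑ k, c k • f k)) := by
        rw [← hc, Function.update_eq_self_iff.2]
        · rfl
        · simp [g]
      rw [h1, F_update_sum, Finset.sum_eq_single K] at h0
      · have h2 : D v k (i+1) l = _ := F_pull (s+1) K _
        have h3 : Function.update g 0 (f K) = Fin.cons (f K) (fun p : Fin (s+1) => g p.succ) := by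
          funext p
          refine Fin.cases ?_ (fun p => ?_) p
          · simp
          · simp
        have h4 : D v k (i+1) l = (-1)^k * F (s+2) (Function.update g 0 (f K)) := by
          rw [h2, h3]
          have e1 : (v (i + 1 + (K:ℕ) + if (K:ℕ) < k then 0 else l)) = f K := by
            simp [K, f]; congr 1; omega
          have e2 : (fun p : Fin (s+1) => v (i + 1 + (K.succAbove p : Fin (s+2)) +
              if ((K.succAbove p : Fin (s+2)) : ℕ) < k then 0 else l)) = fun p => g p.succ := by
            funext p
            simp only [g, sA, K, Fin.val_succ]
            congr 1
            split_ifs <;> omega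
          rw [e1, e2]
        have h5 := hu k (i+1) (by omega)
        have h6 : c K * D v k (i+1) l = 0 := by
          rw [h4]; linear_combination (-1)^k * h0
        exact (h5.mul_left_eq_zero).1 h6
      · intro b _ hb
        have hb' : (b:ℕ) ≠ k := fun h => hb (Fin.ext h)
        rcases Nat.lt_or_gt_of_ne hb' with h | h
        · rw [show b = ⟨b, by omega⟩ from rfl, ih b h (by omega), zero_mul]
        · rw [F_dup _ _ 0 b, mul_zero]
          · intro h'; rw [← h'] at h; simp at h
          · rw [Function.update_self, Function.update_of_ne]
            · simp only [f, g]; rw [if_neg (by omega)]; congr 1; omega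
            · intro h'; rw [h'] at h; simp at h
      · simp
  refine ⟨c (Fin.last _), ?_⟩
  conv_lhs => rw [hc]
  rw [Finset.sum_eq_single (Fin.last _)]
  · simp [f]; congr 2; omega
  · intro b _ hb
    have : (b:ℕ) < s+1 := Fin.val_lt_last hb
    rw [show b = ⟨b, by omega⟩ from rfl, hc0 b this, zero_smul]
  · simp

/-- first and last rows of the minors agree up to scalars -/
theorem D_first_last {s : ℕ} (v : ℕ → Fin (s+2) → R) (l i m m' : ℕ) (hm : m + m' = l) (c : R)
    (hv : v i = c • v (i + (s+2+l))) :
    D v 1 i m = c * (-1)^(s+1) * D v (s+1) (i+1+m) m' := by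
  have h2 : D v (s+1) (i+1+m) m' = _ := F_pull (s+1) (Fin.last _) _
  have h1 : D v 1 i m = F (s+2) (Function.update
     (fun k : Fin (s+2) => v (i + k + if (k:ℕ) < 1 then 0 else m)) 0
       (∑ k ∈ {()}, c • v (i + (s+2+l)))) := by
    rw [Finset.sum_singleton, ← hv, Function.update_eq_self_iff.2]
    · rfl
    · simp
  rw [h1, F_update_sum, Finset.sum_singleton]
  have e : (Function.update
     (fun k : Fin (s+2) => v (i + k + if (k:ℕ) < 1 then 0 else m)) 0 (v (i + (s+2+l))))
     = Fin.cons (v (i + 1 + m + ((Fin.last (s+1) : Fin (s+2)) : ℕ) +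
         if ((Fin.last (s+1) : Fin (s+2)) : ℕ) < s+1 then 0 else m'))
       (fun k : Fin (s+1) => v (i + 1 + m + ((Fin.last (s+1)).succAbove k : Fin (s+2)) +
         if (((Fin.last (s+1)).succAbove k : Fin (s+2)) : ℕ) < s+1 then 0 else m')) := by
    funext p
    refine Fin.cases ?_ (fun p => ?_) p
    · simp; congr 1; omega
    · simp; congr 1; split_ifs <;> omega
  rw [e, mul_assoc, h2, ← mul_assoc ((-1)^(s+1)), Fin.val_last, ← mul_pow]
  simp

end dets

section lift
variable {A : Type*} [AddCommGroup A]

/-- one row from the previous one -/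
def nxtRow (r : ℕ) (g row : ℕ → A) : ℕ → A
  | 0 => 0
  | a+1 => if a + 1 ≤ r then row (a+2) + nxtRow r g row a + g (a+1) - row (a+1) else 0

/-- first row of the lift -/
def t1 (r : ℕ) (g : ℕ → ℕ → A) : ℕ → ℕ → A
  | 0 => fun _ => 0
  | i+1 => nxtRow r (fun a => g a i) (t1 r g i)

/-- the lift -/
def tt (r : ℕ) (y : ℕ → ℕ → ℕ → A) (g : ℕ → ℕ → A) : ℕ → ℕ → ℕ → A
  | 0 => fun _ _ => 0
  | 1 => fun a i => t1 r g i a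
  | m+2 => fun a i => if 1 ≤ a ∧ a ≤ r then tt r y g (m+1) (a+1) i + tt r y g (m+1) (a-1) (i+1)
      - y a i (m+1) - tt r y g m a (i+1) else 0

theorem lift (r l : ℕ) (y p g : ℕ → ℕ → ℕ → A)
    (hpy : ∀ a i m, a + 1 ≤ r → m + 1 < l →
      p (a+1) i (m+1) = y (a+1) i (m+1) + g (a+1) i (m+1))
    (hp0 : ∀ i m, p 0 i m = 0) (hpr : ∀ i m, p (r+1) i m = 0) (hg0 : ∀ a i, g a i 0 = 0)
    (hY : ∀ a i m, a + 1 ≤ r → m + 1 < l →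
      y (a+1) i (m+1) + y (a+1) (i+1) (m+1) + g (a+1) (i+1) m + g (a+1) i (m+2)
        = p a (i+1) (m+1) + p (a+2) i (m+1)) :
    ∃ t : ℕ → ℕ → ℕ → A, (∀ i m, t 0 i m = 0) ∧ (∀ i m, t (r+1) i m = 0) ∧ (∀ a i, t a i 0 = 0) ∧
      (∀ a i m, a + 1 ≤ r → m + 1 < l →
        y (a+1) i (m+1) + t (a+1) i (m+2) + t (a+1) (i+1) m = t (a+2) i (m+1) + t a (i+1) (m+1)) ∧
      (∀ a i m, a + 1 ≤ r → m + 1 ≤ l →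
        t (a+1) i (m+1) + t (a+1) (i+1) (m+1)
          = t (a+2) i (m+1) + t a (i+1) (m+1) + g (a+1) i (m+1)) := by
  let t : ℕ → ℕ → ℕ → A := fun a i m => tt r y (fun a i => g a i 1) m a i
  have h0 : ∀ i m, t 0 i m = 0 := by
    intro i m
    match m with
    | 0 => rfl
    | 1 => cases i <;> simp [t, tt, t1, nxtRow]
    | m+2 => simp [t, tt]
  have hr : ∀ i m, t (r+1) i m = 0 := by
    intro i m
    match m with
    | 0 => rfl
    | 1 => cases i <;> simp [t, tt, t1, nxtRow]
    | m+2 => simp [t, tt]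
  have hm0 : ∀ a i, t a i 0 = 0 := fun a i => rfl
  have hm1 : ∀ a i, a + 1 ≤ r → t (a+1) i 1 + t (a+1) (i+1) 1
          = t (a+2) i 1 + t a (i+1) 1 + g (a+1) i 1 := by
    intro a i ha
    have : t (a+1) (i+1) 1 = t (a+2) i 1 + t a (i+1) 1 + g (a+1) i 1 - t (a+1) i 1 := by
      simp [t, tt, t1, nxtRow, ha]
    rw [this]; abel
  have hS : ∀ a i m, a + 1 ≤ r → y (a+1) i (m+1) + t (a+1) i (m+2) + t (a+1) (i+1) m
      = t (a+2) i (m+1) + t a (i+1) (m+1) := by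
    intro a i m ha
    have : t (a+1) i (m+2) = t (a+2) i (m+1) + t a (i+1) (m+1) - y (a+1) i (m+1)
       - t (a+1) (i+1) m := by
      simp [t, tt, ha]
    rw [this]; abel
  have hmain : ∀ m a i, a + 1 ≤ r → m + 1 ≤ l →
        t (a+1) i (m+1) + t (a+1) (i+1) (m+1)
          = t (a+2) i (m+1) + t a (i+1) (m+1) + g (a+1) i (m+1) := by
    intro m
    induction m using Nat.strong_induction_on with
    | _ m ih =>
      match m with
      | 0 => intro a i ha _; exact hm1 a i ha
      | m+1 =>
        intro a i ha hm
        have K : ∀ a i, a ≤ r+1 → t a i (m+1) + t a (i+1) (m+1)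
            = p a i (m+1) + t a i (m+2) + t a (i+1) m := by
          intro a i ha
          rcases a with _ | a
          · simp [h0, hp0]
          · by_cases h : a = r
            · subst h; simp [hr, hpr]
            · have e1 := ih m (by omega) a i (by omega) (by omega)
              have e2 := hS a i m (by omega)
              have e3 := hpy a i m (by omega) (by omega)
              rw [e1, e3, ← e2]; abel
        have k1 := K (a+2) i (by omega)
        have k2 := K a (i+1) (by omega)
        have k3 : t (a+1) (i+1) m + t (a+1) (i+2) m
            = t (a+2) (i+1) m + t a (i+2) m + g (a+1) (i+1) m := by
          rcases m with _ | m
          · simp [hm0, hg0]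
          · exact ih m (by omega) a (i+1) ha (by omega)
        have s1 := hS a i m ha
        have s2 := hS a (i+1) m ha
        have yy := hY a i m ha (by omega)
        linear_combination (norm := module) s1 + s2 - k3 + k1 + k2 - yy
  exact ⟨t, h0, hr, hm0, fun a i m ha _ => hS a i m ha, fun a i m ha hm => hmain m a i ha hm⟩

end lift

section core
variable {R : Type*} [CommRing R]

theorem core (s l : ℕ) (hl : 2 ≤ l) (y p g : ℕ → ℕ → ℕ → Rˣ)
    (hp1 : ∀ a i m, a + 1 ≤ s+1 → m + 1 < l → (p (a+1) i (m+1) : R) = 1 + y (a+1) i (m+1))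
    (hpy : ∀ a i m, a + 1 ≤ s+1 → m + 1 < l →
      p (a+1) i (m+1) = y (a+1) i (m+1) * g (a+1) i (m+1))
    (hp0 : ∀ i m, p 0 i m = 1) (hpr : ∀ i m, p (s+2) i m = 1) (hg0 : ∀ a i, g a i 0 = 1)
    (hgl : ∀ a i, g a i l = 1)
    (hY : ∀ a i m, a + 1 ≤ s+1 → m + 1 < l →
      y (a+1) i (m+1) * y (a+1) (i+1) (m+1) * g (a+1) (i+1) m * g (a+1) i (m+2)
        = p a (i+1) (m+1) * p (a+2) i (m+1)) (i m m' : ℕ) (hm : (m+1) + (m'+1) = l) :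
    (y 1 i (m+1) : R) = y (s+1) (i+1+(m+1)) (m'+1) := by
  obtain ⟨t, t0, tr, tm0, tS, tM⟩ := lift (A := Additive Rˣ) (s+1) l
    (fun a i m => Additive.ofMul (y a i m)) (fun a i m => Additive.ofMul (p a i m))
    (fun a i m => Additive.ofMul (g a i m)) hpy hp0 hpr hg0 hY
  obtain ⟨T, hT⟩ : ∃ T : ℕ → ℕ → ℕ → Rˣ, T = fun a i m => (t a i m).toMul := ⟨_, rfl⟩
  have T0 : ∀ i m, T 0 i m = 1 := by rw [hT]; exact t0
  have Tr : ∀ i m, T (s+2) i m = 1 := by rw [hT]; exact tr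
  have Tm0 : ∀ a i, T a i 0 = 1 := by rw [hT]; exact tm0
  have TS : ∀ a i m, a + 1 ≤ s+1 → m + 1 < l →
        (y (a+1) i (m+1) * T (a+1) i (m+2) * T (a+1) (i+1) m : R)
          = T (a+2) i (m+1) * T a (i+1) (m+1) := by
    intro a i m ha hm
    rw [hT]
    exact_mod_cast congrArg (fun z : Additive Rˣ => ((z.toMul : Rˣ) : R)) (tS a i m ha hm)
  have TM : ∀ a i m, a + 1 ≤ s+1 → m + 1 ≤ l →
        (T (a+1) i (m+1) * T (a+1) (i+1) (m+1) : R)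
          = T (a+2) i (m+1) * T a (i+1) (m+1) * g (a+1) i (m+1) := by
    intro a i m ha hm
    rw [hT]
    exact_mod_cast congrArg (fun z : Additive Rˣ => ((z.toMul : Rˣ) : R)) (tM a i m ha hm)
  have TP : ∀ a i m, a + 1 ≤ s+1 → m + 1 < l →
        (T (a+1) i (m+1) * T (a+1) (i+1) (m+1) : R)
          = p (a+1) i (m+1) * (T (a+1) i (m+2) * T (a+1) (i+1) m) := by
    intro a i m ha hm
    rw [TM a i m ha (by omega), ← TS a i m ha hm, hpy a i m ha hm]
    push_cast
    ring
  obtain ⟨v, hone, hv1⟩ := exists_v s (fun a i => (T a i 1 : R)) (fun i => by simp [T0])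
  have hD : ∀ m, m ≤ l → ∀ a, a ≤ s+2 → ∀ i, D v a i m = T a i m := by
    intro m
    induction m using Nat.strong_induction_on with
    | _ m ih =>
      match m with
      | 0 => intro _ a _ i; rw [D_zero, hone, Tm0]; simp
      | 1 =>
        intro _ a ha i
        by_cases h : a = s+2
        · subst h; rw [D_right, hone, Tr]; simp
        · exact hv1 a i (by omega)
      | m+2 =>
        intro hm a ha i
        rcases a with _ | b
        · rw [D_left, hone, T0]; simp
        · by_cases h : b = s+1
          · subst h; rw [D_right, hone, Tr]; simp
          · have P := D_plucker v b i m (by omega)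
            rw [ih (m+1) (by omega) (by omega) _ (by omega), ih (m+1) (by omega) (by omega) _ (by omega),
              ih (m+1) (by omega) (by omega) _ (by omega), ih (m+1) (by omega) (by omega) _ (by omega),
              ih m (by omega) (by omega) _ (by omega)] at P
            have h1 := TP b i m (by omega) (by omega)
            have h2 := TS b i m (by omega) (by omega)
            have h3 := hp1 b i m (by omega) (by omega)
            apply (T (b+1) (i+1) m).isUnit.mul_right_cancel
            rw [h3] at h1
            linear_combination h1 - P + h2
  have hz : ∀ a i, a ≤ s → D v (a+1) i (l+1) = 0 := by
    intro a i ha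
    obtain ⟨k, rfl⟩ : ∃ k, l = k+1 := ⟨l-1, by omega⟩
    have P := D_plucker v a i k ha
    rw [hD (k+1) (by omega) _ (by omega), hD (k+1) (by omega) _ (by omega),
      hD (k+1) (by omega) _ (by omega), hD (k+1) (by omega) _ (by omega),
      hD k (by omega) _ (by omega)] at P
    have h1 := TM a i k (by omega) (by omega)
    rw [hgl] at h1
    apply (T (a+1) (i+1) k).isUnit.mul_right_cancel
    push_cast at h1
    linear_combination h1 - P
  have hcl := closure_v v l hone
    (fun a i ha => by rw [hD l le_rfl a (by omega)]; exact Units.isUnit _) hz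
  have FL : ∀ i, ∃ c : R, ∀ m m', m + m' = l → (T 1 i m : R) = c * T (s+1) (i+1+m) m' := by
    intro i
    obtain ⟨c, hc⟩ := hcl i
    refine ⟨c * (-1)^(s+1), fun m m' h => ?_⟩
    rw [← hD m (by omega) 1 (by omega), ← hD m' (by omega) (s+1) (by omega)]
    exact D_first_last v l i m m' h c hc
  obtain ⟨c, hc⟩ := FL i
  obtain ⟨d, hd⟩ := FL (i+1)
  have a1 := hc (m+1) (m'+1) hm
  have a2 := hd (m+1) (m'+1) hm
  have a3 := hc (m+2) m' (by omega)
  have a4 := hd m (m'+2) (by omega)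
  have q1 := TP 0 i m (by omega) (by omega)
  have q2 := TP s (i+1+(m+1)) m' (by omega) (by omega)
  have z1 := hp1 0 i m (by omega) (by omega)
  have z2 := hp1 s (i+1+(m+1)) m' (by omega) (by omega)
  rw [show i + 1 + 1 + (m+1) = i+1+(m+1)+1 by omega] at a2
  rw [show i + 1 + (m+2) = i+1+(m+1)+1 by omega] at a3
  rw [show i + 1 + 1 + m = i+1+(m+1) by omega] at a4
  simp only [zero_add] at q1 z1
  have fin : (p 1 i (m+1) : R) = p (s+1) (i+1+(m+1)) (m'+1) := by
    apply (T 1 i (m+2) * T 1 (i+1) m).isUnit.mul_right_cancel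
    push_cast
    rw [← q1, a1, a2, a3, a4]
    linear_combination c * d * q2
  rw [z1, z2] at fin
  exact add_left_cancel fin

end core
end YSys

/-- Periodicity of the level `ℓ` restricted Y-system `𝕐_ℓ(A_r)`. -/
theorem restricted_Y_Ar_periodicity {R : Type*} [CommRing R]
    (r ℓ : ℕ) (hr : 1 ≤ r) (hℓ : 2 ≤ ℓ)
    (Y : ℕ → ℕ → ℤ → R)
    (hYu : ∀ a m u, 1 ≤ a → a ≤ r → 1 ≤ m → m ≤ ℓ - 1 → IsUnit (Y a m u))
    (hY1u : ∀ a m u, 1 ≤ a → a ≤ r → 1 ≤ m → m ≤ ℓ - 1 → IsUnit (1 + Y a m u))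
    (hYsys : ∀ a m u, 1 ≤ a → a ≤ r → 1 ≤ m → m ≤ ℓ - 1 →
      Y a m (u - 1) * Y a m (u + 1)
          * (if m = 1 then 1 else 1 + Ring.inverse (Y a (m - 1) u))
          * (if m = ℓ - 1 then 1 else 1 + Ring.inverse (Y a (m + 1) u))
        = (if a = 1 then 1 else 1 + Y (a - 1) m u)
          * (if a = r then 1 else 1 + Y (a + 1) m u)) :
    (∀ a m u, 1 ≤ a → a ≤ r → 1 ≤ m → m ≤ ℓ - 1 →
      Y a m (u + ((r : ℤ) + 1 + ℓ)) = Y (r + 1 - a) (ℓ - m) u) ∧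
    (∀ a m u, 1 ≤ a → a ≤ r → 1 ≤ m → m ≤ ℓ - 1 →
      Y a m (u + 2 * ((r : ℤ) + 1 + ℓ)) = Y a m u) := by
  classical
  -- units
  let IN : ℕ → ℕ → Prop := fun a m => 1 ≤ a ∧ a ≤ r ∧ 1 ≤ m ∧ m ≤ ℓ - 1
  obtain ⟨U, hU⟩ : ∃ U : ℕ → ℕ → ℤ → Rˣ, ∀ a m u, IN a m → (U a m u : R) = Y a m u := by
    refine ⟨fun a m u => if h : IN a m then (hYu a m u h.1 h.2.1 h.2.2.1 h.2.2.2).unit else 1, ?_⟩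
    intro a m u h; simp [h]
  obtain ⟨P, hP, hP'⟩ : ∃ P : ℕ → ℕ → ℤ → Rˣ, (∀ a m u, IN a m → (P a m u : R) = 1 + Y a m u) ∧
      (∀ a m u, ¬ IN a m → P a m u = 1) := by
    refine ⟨fun a m u => if h : IN a m then (hY1u a m u h.1 h.2.1 h.2.2.1 h.2.2.2).unit else 1, ?_, ?_⟩
    · intro a m u h; simp [h]
    · intro a m u h; simp [h]
  obtain ⟨G, hG, hG'⟩ : ∃ G : ℕ → ℕ → ℤ → Rˣ, (∀ a m u, IN a m → P a m u = U a m u * G a m u) ∧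
      (∀ a m u, ¬ IN a m → G a m u = 1) := by
    refine ⟨fun a m u => if IN a m then (U a m u)⁻¹ * P a m u else 1, ?_, ?_⟩
    · intro a m u h; simp [h]
    · intro a m u h; simp [h]
  have hGv : ∀ a m u, IN a m → (G a m u : R) = 1 + Ring.inverse (Y a m u) := by
    intro a m u h
    have h1 := hG a m u h
    have h2 : (P a m u : R) = U a m u * G a m u := by rw [h1]; simp
    rw [hP a m u h] at h2
    rw [← hU a m u h] at h2 ⊢
    rw [Ring.inverse_unit]
    apply (U a m u).isUnit.mul_left_cancel
    rw [← h2, mul_add]; simp [add_comm]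
  have sys : ∀ a m u, a + 1 ≤ r → m + 1 < ℓ →
      U (a+1) (m+1) (u-1) * U (a+1) (m+1) (u+1) * G (a+1) m u * G (a+1) (m+2) u
       = P a (m+1) u * P (a+2) (m+1) u := by
    intro a m u ha hm
    have h := hYsys (a+1) (m+1) u (by omega) ha (by omega) (by omega)
    have e1 : (if m + 1 = 1 then 1 else 1 + Ring.inverse (Y (a+1) (m+1-1) u)) = (G (a+1) m u : R) := by
      split_ifs with h1
      · rw [hG' _ _ _ (by simp only [IN]; omega)]; simp
      · rw [hGv _ _ _ (by simp only [IN]; omega)]; simp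
    have e2 : (if m + 1 = ℓ - 1 then 1 else 1 + Ring.inverse (Y (a+1) (m+1+1) u)) = (G (a+1) (m+2) u : R) := by
      split_ifs with h1
      · rw [hG' _ _ _ (by simp only [IN]; omega)]; simp
      · rw [hGv _ _ _ (by simp only [IN]; omega)]
    have e3 : (if a + 1 = 1 then 1 else 1 + Y (a+1-1) (m+1) u) = (P a (m+1) u : R) := by
      split_ifs with h1
      · rw [hP' _ _ _ (by simp only [IN]; omega)]; simp
      · rw [hP _ _ _ (by simp only [IN]; omega)]; simp
    have e4 : (if a + 1 = r then 1 else 1 + Y (a+1+1) (m+1) u) = (P (a+2) (m+1) u : R) := by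
      split_ifs with h1
      · rw [hP' _ _ _ (by simp only [IN]; omega)]; simp
      · rw [hP _ _ _ (by simp only [IN]; omega)]
    rw [e1, e2, e3, e4, ← hU _ _ _ (by simp only [IN]; omega),
      ← hU _ _ _ (by simp only [IN]; omega)] at h
    exact_mod_cast h
  -- first row
  have row1 : ∀ m m' u, (m+1) + (m'+1) = ℓ → U 1 (m+1) u = U r (m'+1) (u + ((r : ℤ) + 1 + ℓ)) := by
    intro m m' u hm
    obtain ⟨s, rfl⟩ : ∃ s, r = s+1 := ⟨r-1, by omega⟩
    let c : ℤ := u - 3 - m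
    have h := YSys.core s ℓ hℓ (fun a i m => U a m (2*i+1+a+m+c)) (fun a i m => P a m (2*i+1+a+m+c))
      (fun a i m => G a m (2*i+1+a+m+c)) ?_ ?_ ?_ ?_ ?_ ?_ ?_ 0 m m' hm
    · have h' := Units.ext h
      convert h' using 2
      · simp only [c]; push_cast; ring
      · simp only [c]; rw [← hm]; push_cast; ring
    · intro a i m ha hm
      rw [hP _ _ _ (by simp only [IN]; omega), hU _ _ _ (by simp only [IN]; omega)]
    · intro a i m ha hm
      exact hG _ _ _ (by simp only [IN]; omega)
    · intro i m; exact hP' _ _ _ (by simp only [IN]; omega)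
    · intro i m; exact hP' _ _ _ (by simp only [IN]; omega)
    · intro a i; exact hG' _ _ _ (by simp only [IN]; omega)
    · intro a i; exact hG' _ _ _ (by simp only [IN]; omega)
    · intro a i m ha hm
      have h := sys a m (2*i+1+a+m+c+3) ha hm
      convert h using 3
      · congr 2 <;> (push_cast; try ring)
      · push_cast; ring
      · push_cast; ring
      · push_cast; ring
      · push_cast; ring
  have PfromU : ∀ a b m m' u w, IN a m → IN b m' → U a m u = U b m' w → P a m u = P b m' w := by
    intro a b m m' u w h1 h2 h
    apply Units.ext
    rw [hP _ _ _ h1, hP _ _ _ h2, ← hU _ _ _ h1, ← hU _ _ _ h2, h]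
  have UfromP : ∀ a b m m' u w, IN a m → IN b m' → P a m u = P b m' w → U a m u = U b m' w := by
    intro a b m m' u w h1 h2 h
    apply Units.ext
    have h := congrArg Units.val h
    rw [hP _ _ _ h1, hP _ _ _ h2, ← hU _ _ _ h1, ← hU _ _ _ h2] at h
    exact add_left_cancel h
  have GfromU : ∀ a b m m' u w, IN a m → IN b m' → U a m u = U b m' w → G a m u = G b m' w := by
    intro a b m m' u w h1 h2 h
    have h3 := PfromU _ _ _ _ _ _ h1 h2 h
    rw [hG _ _ _ h1, hG _ _ _ h2, h] at h3
    exact mul_left_cancel h3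
  have all : ∀ a, ∀ b m m' u, (a+1) + (b+1) = r+1 → (m+1) + (m'+1) = ℓ →
      U (a+1) (m+1) u = U (b+1) (m'+1) (u + ((r : ℤ) + 1 + ℓ)) := by
    intro a
    induction a using Nat.strong_induction_on with
    | _ a ih =>
      rcases a with _ | a
      · intro b m m' u hb hm
        obtain rfl : r = b+1 := by omega
        exact row1 m m' u hm
      · intro b m m' u hb hm
        apply UfromP
        · simp only [IN]; omega
        · simp only [IN]; omega
        have s1 := sys a m u (by omega) (by omega)
        have s2 := sys (b+1) m' (u + ((r : ℤ) + 1 + ℓ)) (by omega) (by omega)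
        have u1 := ih a (by omega) (b+1) m m' (u-1) (by omega) hm
        have u2 := ih a (by omega) (b+1) m m' (u+1) (by omega) hm
        have g1 : G (a+1) m u = G (b+1+1) (m'+2) (u + ((r : ℤ) + 1 + ℓ)) := by
          rcases m with _ | m
          · rw [hG' _ _ _ (by simp only [IN]; omega), hG' _ _ _ (by simp only [IN]; omega)]
          · exact GfromU _ _ _ _ _ _ (by simp only [IN]; omega) (by simp only [IN]; omega)
              (ih a (by omega) (b+1) m (m'+1) u (by omega) (by omega))
        have g2 : G (a+1) (m+2) u = G (b+1+1) m' (u + ((r : ℤ) + 1 + ℓ)) := by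
          rcases m' with _ | m'
          · rw [hG' _ _ _ (by simp only [IN]; omega), hG' _ _ _ (by simp only [IN]; omega)]
          · exact GfromU _ _ _ _ _ _ (by simp only [IN]; omega) (by simp only [IN]; omega)
              (ih a (by omega) (b+1) (m+1) m' u (by omega) (by omega))
        have p1 : P a (m+1) u = P (b+1+2) (m'+1) (u + ((r : ℤ) + 1 + ℓ)) := by
          rcases a with _ | a
          · rw [hP' _ _ _ (by simp only [IN]; omega), hP' _ _ _ (by simp only [IN]; omega)]
          · exact PfromU _ _ _ _ _ _ (by simp only [IN]; omega) (by simp only [IN]; omega)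
              (ih a (by omega) (b+2) m m' u (by omega) (by omega))
        rw [show u + ((r : ℤ) + 1 + ℓ) - 1 = u - 1 + ((r : ℤ) + 1 + ℓ) by ring,
          show u + ((r : ℤ) + 1 + ℓ) + 1 = u + 1 + ((r : ℤ) + 1 + ℓ) by ring,
          ← u1, ← u2, ← g1, ← g2, ← p1] at s2
        have : P a (m+1) u * P (a+2) (m+1) u =
            P a (m+1) u * P (b+1) (m'+1) (u + ((r : ℤ) + 1 + ℓ)) := by
          rw [← s1, mul_comm (P a (m+1) u) (P (b+1) _ _), ← s2]
          exact mul_right_comm _ _ _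
        exact mul_left_cancel this
  have half : ∀ a m u, 1 ≤ a → a ≤ r → 1 ≤ m → m ≤ ℓ - 1 →
      Y a m (u + ((r : ℤ) + 1 + ℓ)) = Y (r + 1 - a) (ℓ - m) u := by
    intro a m u h1 h2 h3 h4
    have h := all (r - a) (a - 1) (ℓ - m - 1) (m - 1) u (by omega) (by omega)
    rw [show r - a + 1 = r + 1 - a by omega, show ℓ - m - 1 + 1 = ℓ - m by omega,
      show a - 1 + 1 = a by omega, show m - 1 + 1 = m by omega] at h
    rw [← hU _ _ _ (by simp only [IN]; omega), ← hU _ _ _ (by simp only [IN]; omega), h]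
  refine ⟨half, ?_⟩
  intro a m u h1 h2 h3 h4
  rw [show u + 2 * ((r : ℤ) + 1 + ℓ) = (u + ((r : ℤ) + 1 + ℓ)) + ((r : ℤ) + 1 + ℓ) by ring,
    half a m _ h1 h2 h3 h4, half _ _ _ (by omega) (by omega) (by omega) (by omega),
    show r + 1 - (r + 1 - a) = a by omega, show ℓ - (ℓ - m) = m by omega]
end

section
/- Let R be a commutative ring, r ≥ 2, ℓ ≥ 2, and let T = {T^{(a)}_m(u)} be a regular solution in R of the level ℓ restricted T-system 𝕋̃_ℓ(C_r) with quasi-unit boundary condition. Then: (1) half-periodicity: for all u ∈ (1/2)ℤ, T^{(a)}_m(u + r + 1 + ℓ) = T^{(a)}_{2ℓ−m}(u) for 1 ≤ a ≤ r−1 and 1 ≤ m ≤ 2ℓ−1, and T^{(r)}_m(u + r + 1 + ℓ) = T^{(r)}_ℓ(u) · T^{(r)}_{ℓ−m}(u) for 1 ≤ m ≤ ℓ−1; (2) periodicity: T^{(a)}_m(u + 2(r + 1 + ℓ)) = T^{(a)}_m(u) for all indices. -/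
section CrPeriod
open Matrix

lemma cr_jacobi_dom {S : Type*} [CommRing S] [IsDomain S] {n : ℕ}
    (W : Matrix (Fin 2 ⊕ Fin n) (Fin 2 ⊕ Fin n) S) (hW : W.det ≠ 0) :
    (W.adjugate.toBlocks₁₁).det = W.det * (W.toBlocks₂₂).det := by
  have h := W.mul_adjugate
  rw [← fromBlocks_toBlocks W.adjugate] at h
  nth_rewrite 1 [← fromBlocks_toBlocks W] at h
  rw [fromBlocks_multiply, ← fromBlocks_one, fromBlocks_smul, fromBlocks_inj] at h
  obtain ⟨h1, -, h3, -⟩ := h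
  have key : W * fromBlocks W.adjugate.toBlocks₁₁ 0 W.adjugate.toBlocks₂₁ 1
      = fromBlocks (W.det • 1) W.toBlocks₁₂ 0 W.toBlocks₂₂ := by
    nth_rewrite 1 [← fromBlocks_toBlocks W]
    rw [fromBlocks_multiply, h1, h3]
    simp
  have h4 := congrArg Matrix.det key
  rw [det_mul, det_fromBlocks_zero₁₂, det_fromBlocks_zero₂₁, det_smul] at h4
  simp only [det_one, mul_one, Fintype.card_fin] at h4
  apply mul_left_cancel₀ hW
  rw [h4]; ring

lemma cr_jacobi {S : Type*} [CommRing S] {n : ℕ}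
    (W : Matrix (Fin 2 ⊕ Fin n) (Fin 2 ⊕ Fin n) S) :
    (W.adjugate.toBlocks₁₁).det = W.det * (W.toBlocks₂₂).det := by
  have h := cr_jacobi_dom (mvPolynomialX (Fin 2 ⊕ Fin n) (Fin 2 ⊕ Fin n) ℤ)
    (det_mvPolynomialX_ne_zero _ _)
  let f : MvPolynomial ((Fin 2 ⊕ Fin n) × (Fin 2 ⊕ Fin n)) ℤ →+* S :=
    (MvPolynomial.aeval fun p => W p.1 p.2 :
      MvPolynomial ((Fin 2 ⊕ Fin n) × (Fin 2 ⊕ Fin n)) ℤ →ₐ[ℤ] S).toRingHom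
  have hf : f.mapMatrix (mvPolynomialX (Fin 2 ⊕ Fin n) (Fin 2 ⊕ Fin n) ℤ) = W := by
    ext i j
    simp [f, mvPolynomialX]
  have h2 := congrArg f h
  rw [map_mul, RingHom.map_det, RingHom.map_det, RingHom.map_det] at h2
  rw [hf] at h2
  have e1 : f.mapMatrix (mvPolynomialX (Fin 2 ⊕ Fin n) (Fin 2 ⊕ Fin n) ℤ).toBlocks₂₂
      = W.toBlocks₂₂ := by
    rw [← hf]; rfl
  have e2 : f.mapMatrix (mvPolynomialX (Fin 2 ⊕ Fin n) (Fin 2 ⊕ Fin n) ℤ).adjugate.toBlocks₁₁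
      = W.adjugate.toBlocks₁₁ := by
    have : f.mapMatrix (mvPolynomialX (Fin 2 ⊕ Fin n) (Fin 2 ⊕ Fin n) ℤ).adjugate
      = W.adjugate := by
      rw [RingHom.map_adjugate, hf]
    rw [← this]; rfl
  rw [e1, e2] at h2
  exact h2

lemma cr_dodgson {S : Type*} [CommRing S] {n : ℕ}
    (W : Matrix (Fin (n+2)) (Fin (n+2)) S) :
    W.det * (W.submatrix (fun k : Fin n => k.succ.castSucc) (fun k => k.succ.castSucc)).det
      = (W.submatrix Fin.succ Fin.succ).det * (W.submatrix Fin.castSucc Fin.castSucc).det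
        - (W.submatrix Fin.succ Fin.castSucc).det * (W.submatrix Fin.castSucc Fin.succ).det := by
  let g : Fin 2 ⊕ Fin n → Fin (n+2) :=
    Sum.elim ![0, Fin.last (n+1)] (fun k => k.succ.castSucc)
  have hg : Function.Bijective g := by
    rw [Fintype.bijective_iff_injective_and_card]
    refine ⟨?_, by simp; omega⟩
    rintro (a | a) (b | b) h
    · fin_cases a <;> fin_cases b <;> simp_all [g, Fin.ext_iff]
    · have := b.2
      fin_cases a <;> simp [g, Fin.ext_iff] at h
      omega
    · have := a.2
      fin_cases b <;> simp [g, Fin.ext_iff] at h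
      omega
    · simp [g, Fin.ext_iff] at h ⊢
      exact h
  let e := Equiv.ofBijective g hg
  have h := cr_jacobi (W.submatrix e e)
  rw [det_submatrix_equiv_self, adjugate_submatrix_equiv_self, det_fin_two] at h
  have e1 : (W.submatrix e e).toBlocks₂₂ =
    W.submatrix (fun k : Fin n => k.succ.castSucc) (fun k => k.succ.castSucc) := rfl
  rw [e1] at h
  rw [← h]
  have a00 : (W.adjugate.submatrix e e).toBlocks₁₁ 0 0 = W.adjugate 0 0 := rfl
  have a11 : (W.adjugate.submatrix e e).toBlocks₁₁ 1 1
    = W.adjugate (Fin.last (n+1)) (Fin.last (n+1)) := rfl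
  have a01 : (W.adjugate.submatrix e e).toBlocks₁₁ 0 1
    = W.adjugate 0 (Fin.last (n+1)) := rfl
  have a10 : (W.adjugate.submatrix e e).toBlocks₁₁ 1 0
    = W.adjugate (Fin.last (n+1)) 0 := rfl
  rw [a00, a11, a01, a10]
  simp only [adjugate_fin_succ_eq_det_submatrix]
  have s1 : (0 : Fin (n+2)).succAbove = Fin.succ := by ext; simp
  have s2 : (Fin.last (n+1)).succAbove = Fin.castSucc := by ext; simp
  rw [s1, s2]
  have hs : ((-1 : S) ^ (n+1)) * (-1) ^ (n+1) = 1 := by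
    rw [← mul_pow]; simp
  simp only [Fin.val_last, Fin.val_zero, pow_add, add_zero, zero_add, pow_zero] at hs ⊢
  linear_combination
    ((W.submatrix Fin.succ Fin.succ).det * (W.submatrix Fin.castSucc Fin.castSucc).det
      - (W.submatrix Fin.succ Fin.castSucc).det * (W.submatrix Fin.castSucc Fin.succ).det) * hs

lemma cr_alt_odd {S : Type*} [CommRing S] {n : ℕ} (hn : Odd n)
    (W : Matrix (Fin n) (Fin n) S) (h0 : ∀ i, W i i = 0) (h1 : ∀ i j, W j i = - W i j) :
    W.det = 0 := by
  let P : Matrix (Fin n) (Fin n) (MvPolynomial (Fin n × Fin n) ℤ) :=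
    mvPolynomialX (Fin n) (Fin n) ℤ - (mvPolynomialX (Fin n) (Fin n) ℤ)ᵀ
  have hP : P.det = 0 := by
    have h : Pᵀ = -P := by simp [P]
    have h2 := congrArg Matrix.det h
    rw [det_transpose, det_neg, Fintype.card_fin, hn.neg_one_pow] at h2
    have h3 : (2 : MvPolynomial (Fin n × Fin n) ℤ) * P.det = 0 := by linear_combination h2
    exact (mul_eq_zero.mp h3).resolve_left two_ne_zero
  let f : MvPolynomial (Fin n × Fin n) ℤ →+* S :=
    (MvPolynomial.aeval fun p => if p.1 < p.2 then W p.1 p.2 else 0 :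
      MvPolynomial (Fin n × Fin n) ℤ →ₐ[ℤ] S).toRingHom
  have hf : f.mapMatrix P = W := by
    ext i j
    simp only [f, P, mvPolynomialX, RingHom.mapMatrix_apply, map_apply, Matrix.sub_apply,
      transpose_apply, of_apply, AlgHom.toRingHom_eq_coe, RingHom.coe_coe, map_sub,
      MvPolynomial.aeval_X]
    rcases lt_trichotomy i j with h | h | h
    · simp [h, h.not_gt]
    · subst h; simp [h0]
    · simp [h, h.not_gt, h1 j i]
  rw [← hf, ← RingHom.map_det, hP, map_zero]


def crD {R : Type*} [CommRing R] (A : ℤ → ℤ → R) (m : ℕ) (i j : ℤ) : R :=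
  Matrix.det (Matrix.of fun x y : Fin m => A (i + ((x : ℕ) : ℤ)) (j + ((y : ℕ) : ℤ)))

lemma crD_zero {R : Type*} [CommRing R] (A : ℤ → ℤ → R) (i j : ℤ) : crD A 0 i j = 1 := by
  simp [crD]

lemma crD_one {R : Type*} [CommRing R] (A : ℤ → ℤ → R) (i j : ℤ) : crD A 1 i j = A i j := by
  simp [crD]

lemma crD_dodgson {R : Type*} [CommRing R] (A : ℤ → ℤ → R) (n : ℕ) (i j : ℤ) :
    crD A (n+2) i j * crD A n (i+1) (j+1)
      = crD A (n+1) (i+1) (j+1) * crD A (n+1) i j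
        - crD A (n+1) (i+1) j * crD A (n+1) i (j+1) := by
  have h := cr_dodgson (Matrix.of fun x y : Fin (n+2) =>
    A (i + ((x : ℕ) : ℤ)) (j + ((y : ℕ) : ℤ)))
  unfold crD
  convert h using 2
  · congr 1; ext x y; simp [add_comm, add_left_comm]
  · congr 1
    congr 1; ext x y; simp [add_comm, add_left_comm]
  · congr 1
    · congr 1; ext x y; simp [add_comm, add_left_comm]
    · congr 1; ext x y; simp [add_comm, add_left_comm]

lemma crD_swap {R : Type*} [CommRing R] (A : ℤ → ℤ → R) (hA : ∀ i j, A j i = - A i j)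
    (m : ℕ) (i j : ℤ) : crD A m j i = (-1) ^ m * crD A m i j := by
  unfold crD
  rw [← det_transpose]
  have : (Matrix.of fun x y : Fin m => A (j + ((x : ℕ) : ℤ)) (i + ((y : ℕ) : ℤ)))ᵀ
    = - (Matrix.of fun x y : Fin m => A (i + ((x : ℕ) : ℤ)) (j + ((y : ℕ) : ℤ))) := by
    ext x y
    simp only [transpose_apply, of_apply, Matrix.neg_apply]
    exact hA _ _
  rw [this, det_neg, Fintype.card_fin]

lemma crD_odd {R : Type*} [CommRing R] (A : ℤ → ℤ → R) (hA : ∀ i j, A j i = - A i j)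
    (hA0 : ∀ i, A i i = 0) (m : ℕ) (hm : Odd m) (i : ℤ) : crD A m i i = 0 :=
  cr_alt_odd hm _ (fun _ => hA0 _) (fun _ _ => hA _ _)

structure CrData {R : Type*} [CommRing R] (r L : ℕ) (s : ℕ → ℕ → ℤ → R)
    (A : ℤ → ℤ → R) : Prop where
  hr : 1 ≤ r
  hL2 : 2 ≤ L
  hLe : Even L
  alt : ∀ i j, A j i = - A i j
  diag : ∀ i, A i i = 0
  hA : ∀ i (d : ℕ), d ≤ r + 1 → A i (i + d) = s d 1 (2 * i + d)
  hA0 : ∀ i (d : ℕ), r + 1 < d → A i (i + d) = 0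
  top : ∀ m v, s (r + 1) m v = 1
  zero : ∀ d v, d ≤ r + 1 → s d 0 v = 1
  last : ∀ d v, d ≤ r + 1 → s d L v = 1
  odd : ∀ m v, Odd m → s 0 m v = 0
  unit : ∀ d m v, 1 ≤ d → d ≤ r + 1 → m ≤ L → IsUnit (s d m v)
  unit0 : ∀ m v, Even m → m ≤ L → IsUnit (s 0 m v)
  oct : ∀ d m v, 1 ≤ d → d ≤ r → m + 2 ≤ L →
    s d (m+1) (v-1) * s d (m+1) (v+1) = s d m v * s d (m+2) v + s (d+1) (m+1) v * s (d-1) (m+1) v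
  sq : ∀ m v, Even m → m + 2 ≤ L → s 0 m v * s 0 (m+2) v = s 1 (m+1) v ^ 2

namespace CrData
variable {R : Type*} [CommRing R] {r L : ℕ} {s : ℕ → ℕ → ℤ → R} {A : ℤ → ℤ → R}

lemma far (h : CrData r L s A) (m : ℕ) (i : ℤ) (d : ℕ) (hd : r + 1 < d) :
    crD A (m+1) i (i + d) = 0 := by
  apply det_eq_zero_of_row_eq_zero 0
  intro y
  have := h.hA0 i (d + y) (by omega)
  simpa [add_assoc] using this

lemma step (h : CrData r L s A) (m : ℕ) (hm : m + 2 ≤ L)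
    (h1 : ∀ i (d : ℕ), d ≤ r + 1 → crD A m i (i + d) = s d m (2 * i + d + m - 1))
    (h2 : ∀ i (d : ℕ), d ≤ r + 1 → crD A (m+1) i (i + d) = s d (m+1) (2 * i + d + m)) :
    ∀ i (d : ℕ), d ≤ r + 1 → crD A (m+2) i (i + d) = s d (m+2) (2 * i + d + m + 1) := by
  intro i d hd
  have dd := crD_dodgson A m i (i + d)
  have e1 : crD A m (i+1) (i + d + 1) = s d m (2 * i + d + m + 1) := by
    rw [show i + (d : ℤ) + 1 = (i + 1) + d by ring, h1 _ _ hd]; congr 1; ring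
  have e2 : crD A (m+1) (i+1) (i + d + 1) = s d (m+1) (2 * i + d + m + 1 + 1) := by
    rw [show i + (d : ℤ) + 1 = (i + 1) + d by ring, h2 _ _ hd]; congr 1; ring
  have e3 : crD A (m+1) i (i + d) = s d (m+1) (2 * i + d + m + 1 - 1) := by
    rw [h2 _ _ hd]; congr 1; ring
  rcases Nat.eq_zero_or_pos d with rfl | hpos
  · rcases Nat.even_or_odd m with he | ho
    · have e4 : crD A (m+1) i (i + 1) = s 1 (m+1) (2 * i + m + 1) := by
        have := h2 i 1 (by omega)
        rw [Nat.cast_one] at this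
        rw [this]; congr 1; ring
      have e5 := crD_swap A h.alt (m+1) i (i + 1)
      have hodd : Odd (m+1) := he.add_one
      rw [hodd.neg_one_pow, e4] at e5
      have e6 := crD_odd A h.alt h.diag _ hodd i
      simp only [Nat.cast_zero, add_zero] at dd e1 ⊢
      rw [e1, e6, e4, e5] at dd
      have := h.sq m (2 * i + m + 1) he hm
      apply (h.unit0 m (2 * i + m + 1) he (by omega)).mul_left_cancel
      linear_combination dd - this
    · rw [h.odd _ _ (by exact Odd.add_even ho even_two)]
      simpa using crD_odd A h.alt h.diag (m+2) (Odd.add_even ho even_two) i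
  · apply (h.unit d m (2 * i + d + m + 1) hpos hd (by omega)).mul_left_cancel
    rw [e1, e2, e3] at dd
    rcases Nat.lt_or_ge r d with hd' | hd'
    · obtain rfl : d = r + 1 := by omega
      have e4 : crD A (m+1) i (i + (r+1 : ℕ) + 1) = 0 := by
        have := h.far m i (r + 2) (by omega)
        rw [← this]; congr 1; push_cast; ring
      rw [e4] at dd
      simp only [h.top] at dd ⊢
      linear_combination dd
    · have e4 : crD A (m+1) i (i + d + 1) = s (d+1) (m+1) (2 * i + d + m + 1) := by
        have := h2 i (d+1) (by omega)
        push_cast at this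
        rw [show i + (d : ℤ) + 1 = i + (d + 1) by ring, this]; congr 1; ring
      have e5 : crD A (m+1) (i+1) (i + d) = s (d-1) (m+1) (2 * i + d + m + 1) := by
        have := h2 (i+1) (d-1) (by omega)
        push_cast [hpos] at this
        rw [show i + (d : ℤ) = i + 1 + (d - 1) by ring, this]; congr 1; ring
      rw [e4, e5] at dd
      have := h.oct d m (2 * i + d + m + 1) hpos hd' hm
      linear_combination dd + this

lemma val (h : CrData r L s A) (m : ℕ) :
    (m ≤ L → ∀ i (d : ℕ), d ≤ r + 1 → crD A m i (i + d) = s d m (2 * i + d + m - 1)) ∧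
    (m + 1 ≤ L → ∀ i (d : ℕ), d ≤ r + 1 →
      crD A (m+1) i (i + d) = s d (m+1) (2 * i + d + m)) := by
  induction m with
  | zero =>
    refine ⟨fun _ i d hd => ?_, fun _ i d hd => ?_⟩
    · rw [crD_zero, h.zero _ _ hd]
    · rw [zero_add, crD_one, h.hA i d hd]; simp
  | succ m ih =>
    refine ⟨fun hm i d hd => ?_, fun hm i d hd => ?_⟩
    · rw [ih.2 hm i d hd]; congr 1; push_cast; ring
    · rw [h.step m hm (ih.1 (by omega)) (ih.2 (by omega)) i d hd]; congr 1; push_cast; ring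

lemma valL (h : CrData r L s A) (i j : ℤ) (hj : i - (r + 1) ≤ j) (hj' : j ≤ i + (r + 1)) :
    crD A L i j = 1 := by
  rcases le_total i j with hij | hij
  · obtain ⟨d, rfl⟩ := Int.le.dest hij
    rw [(h.val L).1 le_rfl i d (by omega), h.last _ _ (by omega)]
  · obtain ⟨d, rfl⟩ := Int.le.dest hij
    rw [crD_swap A h.alt, h.hLe.neg_one_pow, one_mul, (h.val L).1 le_rfl j d (by omega),
      h.last _ _ (by omega)]

lemma valL1_aux (h : CrData r L s A) (i : ℤ) (d : ℕ) (hd : d ≤ r) :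
    crD A (L+1) i (i + d) = 0 := by
  rcases Nat.eq_zero_or_pos d with rfl | hpos
  · simpa using crD_odd A h.alt h.diag _ h.hLe.add_one i
  · obtain ⟨n, rfl⟩ : ∃ n, L = n + 1 := ⟨L - 1, by have := h.hL2; omega⟩
    have dd := crD_dodgson A n i (i + d)
    rw [h.valL _ _ (by omega) (by omega), h.valL _ _ (by omega) (by omega),
      h.valL _ _ (by omega) (by omega), h.valL _ _ (by omega) (by omega),
      show i + (d : ℤ) + 1 = (i + 1) + d by ring, (h.val n).1 (by omega) _ _ (by omega)] at dd
    apply (h.unit d n _ hpos (by omega) (by omega)).mul_right_cancel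
    rw [dd]; ring

lemma valL1 (h : CrData r L s A) (i j : ℤ) (hj : i - r ≤ j) (hj' : j ≤ i + r) :
    crD A (L+1) i j = 0 := by
  rcases le_total i j with hij | hij
  · obtain ⟨d, rfl⟩ := Int.le.dest hij
    exact h.valL1_aux _ _ (by omega)
  · obtain ⟨d, rfl⟩ := Int.le.dest hij
    rw [crD_swap A h.alt, h.valL1_aux _ _ (by omega), mul_zero]

lemma Aeq1 (h : CrData r L s A) (i j : ℤ) (hj : j = i + (r + 1)) : A i j = 1 := by
  subst hj
  have := h.hA i (r+1) le_rfl
  push_cast at this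
  rw [this, h.top]

lemma Afar (h : CrData r L s A) (i j : ℤ) (hj : i + (r + 1) < j) : A i j = 0 := by
  obtain ⟨d, rfl⟩ := Int.le.dest (show i ≤ j by omega)
  exact h.hA0 i d (by omega)

lemma Afar' (h : CrData r L s A) (i j : ℤ) (hj : j + (r + 1) < i) : A i j = 0 := by
  rw [h.alt j i, h.Afar j i hj, neg_zero]

lemma minor (h : CrData r L s A) : ∀ (n : ℕ) (p : Fin (n+1)) (i : ℤ),
    Matrix.det (Matrix.of fun x y : Fin n =>
      A (i + ((p.succAbove x : ℕ) : ℤ)) (i + r + 1 + ((y : ℕ) : ℤ)))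
      = crD A (n - p) (i + p + 1) (i + p + 1 + r) := by
  intro n
  induction n with
  | zero =>
    intro p i
    have : (0 - (p : ℕ)) = 0 := by omega
    rw [this, crD_zero]; simp
  | succ n ih =>
    intro p i
    refine Fin.cases ?_ (fun p => ?_) p
    · unfold crD
      congr 1
      ext x y
      simp only [of_apply, Fin.succAbove_zero, Fin.val_succ, Fin.val_zero]
      congr 1 <;> push_cast <;> ring
    · rw [det_succ_row_zero, Fin.sum_univ_succ, Finset.sum_eq_zero]
      · have h1 : A i (i + r + 1) = 1 := h.Aeq1 _ _ (by ring)
        have hs := ih p (i + 1)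
        have e1 : (n + 1 - ((p.succ : Fin (n+2)) : ℕ)) = n - p := by
          rw [Fin.val_succ]; omega
        rw [e1]
        simp only [Fin.val_succ]
        have e2 : i + ((p : ℕ) + 1 : ℕ) + 1 = i + 1 + (p : ℕ) + 1 := by push_cast; ring
        rw [e2, ← hs]
        simp only [Fin.succ_succAbove_zero, of_apply, Fin.val_zero, Nat.cast_zero, add_zero, h1,
          pow_zero, one_mul]
        congr 1
        ext x y
        simp only [submatrix_apply, of_apply, Fin.succ_succAbove_succ, Fin.val_succ,
          Fin.succAbove_zero]
        congr 1 <;> push_cast <;> ring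
      · intro y _
        have : A i (i + r + 1 + ((y : ℕ) + 1)) = 0 := h.Afar _ _ (by omega)
        simp [this]


/-- the kernel vector -/
def cv (r L : ℕ) (s : ℕ → ℕ → ℤ → R) (i : ℤ) (p : ℕ) : R :=
  (-1) ^ p * s r (L - p) (2 * i + p + r + L + 1)

/-- kernel vector applied to `A` -/
def X (r L : ℕ) (s : ℕ → ℕ → ℤ → R) (A : ℤ → ℤ → R) (i j : ℤ) : R :=
  ∑ p : Fin (L+1), cv r L s i p * A (i + ((p : ℕ) : ℤ)) j

lemma X_first (h : CrData r L s A) (i : ℤ) (y : Fin (L+1)) :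
    X r L s A i (i + r + ((y : ℕ) : ℤ)) = 0 := by
  let W : Matrix (Fin (L+1)) (Fin (L+1)) R :=
    Matrix.of fun x y => A (i + ((x : ℕ) : ℤ)) (i + r + ((y : ℕ) : ℤ))
  have hdet : W.det = 0 := h.valL1 i (i + r) (by omega) (by omega)
  have hadj : ∀ p : Fin (L+1), W.adjugate 0 p = cv r L s i p := by
    intro p
    rw [adjugate_fin_succ_eq_det_submatrix]
    have := h.minor L p i
    have e : (W.submatrix p.succAbove (Fin.succAbove 0)) =
      (Matrix.of fun x y : Fin L =>
        A (i + ((p.succAbove x : ℕ) : ℤ)) (i + r + 1 + ((y : ℕ) : ℤ))) := by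
      ext x y
      simp only [W, submatrix_apply, of_apply, Fin.succAbove_zero, Fin.val_succ]
      congr 1; push_cast; ring
    rw [e, this, (h.val (L - p)).1 (by omega) _ _ (by omega)]
    unfold cv
    simp only [Fin.val_zero, add_zero]
    congr 2
    have := p.2
    push_cast [show (p : ℕ) ≤ L by omega]
    ring
  have h2 := congrFun (congrFun W.adjugate_mul 0) y
  rw [hdet, zero_smul, Matrix.mul_apply] at h2
  simp only [hadj] at h2
  exact h2

lemma X_mid (h : CrData r L s A) (i : ℤ) (t : ℕ) (ht : t ≤ 2 * r) :
    ∀ y : Fin (L+1), X r L s A i (i + r - t + ((y : ℕ) : ℤ)) = 0 := by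
  induction t with
  | zero => intro y; simpa using h.X_first i y
  | succ t ih =>
    have ih := ih (by omega)
    let W : Matrix (Fin (L+1)) (Fin (L+1)) R :=
      Matrix.of fun x y => A (i + ((x : ℕ) : ℤ)) (i + r - (t+1 : ℕ) + ((y : ℕ) : ℤ))
    have hdet : W.det = 0 := h.valL1 i _ (by omega) (by omega)
    have hsucc : ∀ y : Fin L, X r L s A i (i + r - (t+1 : ℕ) + ((y.succ : ℕ) : ℤ)) = 0 := by
      intro y
      have := ih y.castSucc
      rw [← this]; congr 1; simp; ring
    let c : Fin (L+1) → R := fun p => cv r L s i p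
    have hc : c ᵥ* W = Pi.single 0 (X r L s A i (i + r - (t+1 : ℕ))) := by
      ext y
      refine Fin.cases ?_ (fun y => ?_) y
      · simp [vecMul, dotProduct, W, X, c]
      · rw [Pi.single_eq_of_ne (Fin.succ_ne_zero y), ← hsucc y]; rfl
    have h3 : c ᵥ* (W * W.adjugate) = 0 := by
      rw [mul_adjugate, hdet]; simp
    rw [← vecMul_vecMul, hc] at h3
    have h4 := congrFun h3 (Fin.last L)
    rw [single_vecMul] at h4
    have hadj : W.adjugate 0 (Fin.last L) = 1 := by
      rw [adjugate_fin_succ_eq_det_submatrix]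
      have := h.valL i (i + r - t) (by omega) (by omega)
      have e : (W.submatrix (Fin.last L).succAbove (Fin.succAbove 0)).det
          = crD A L i (i + r - t) := by
        unfold crD
        congr 1; ext x y
        simp only [W, submatrix_apply, of_apply, Fin.succAbove_zero, Fin.val_succ,
          Fin.succAbove_last, Fin.val_castSucc]
        congr 1; push_cast; ring
      rw [e, this]
      simp [h.hLe.neg_one_pow]
    have h5 : X r L s A i (i + r - (t+1 : ℕ)) = 0 := by
      simpa [hadj] using h4
    intro y
    refine Fin.cases ?_ (fun y => hsucc y) y
    simpa using h5

lemma X_mid' (h : CrData r L s A) (i j : ℤ) (h1 : i - r ≤ j) (h2 : j ≤ i + r + L) :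
    X r L s A i j = 0 := by
  rcases le_total j (i + r) with hj | hj
  · obtain ⟨t, ht⟩ := Int.le.dest hj
    have := h.X_mid i t (by omega) 0
    rw [← this]; congr 1; simp; omega
  · obtain ⟨t, rfl⟩ := Int.le.dest hj
    exact h.X_first i ⟨t, by omega⟩

lemma cv_zero (h : CrData r L s A) (i : ℤ) : cv r L s i 0 = 1 := by
  simp [cv, h.last]

lemma cv_last (h : CrData r L s A) (i : ℤ) : cv r L s i L = 1 := by
  simp [cv, h.zero, h.hLe.neg_one_pow]

lemma X_val (h : CrData r L s A) (i j : ℤ) :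
    X r L s A i j = if j = i + L + r + 1 then 1 else if j = i - r - 1 then -1 else 0 := by
  split_ifs with c1 c2
  · unfold X
    rw [Finset.sum_eq_single (Fin.last L)]
    · rw [Fin.val_last, h.cv_last, h.Aeq1 _ _ (by omega), one_mul]
    · intro p _ hp
      have : (p : ℕ) ≠ L := fun hh => hp (Fin.ext hh)
      rw [h.Afar _ _ (by omega), mul_zero]
    · simp
  · unfold X
    rw [Finset.sum_eq_single 0]
    · rw [Fin.val_zero, h.cv_zero, h.alt j, h.Aeq1 _ _ (by push_cast; omega), one_mul]
    · intro p _ hp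
      have : (p : ℕ) ≠ 0 := fun hh => hp (Fin.ext hh)
      rw [h.Afar' _ _ (by omega), mul_zero]
    · simp
  · rcases lt_or_ge j (i - r) with hj | hj
    · unfold X
      apply Finset.sum_eq_zero
      intro p _
      rw [h.Afar' _ _ (by omega), mul_zero]
    rcases lt_or_ge (i + r + L) j with hj2 | hj2
    · unfold X
      apply Finset.sum_eq_zero
      intro p _
      rw [h.Afar _ _ (by omega), mul_zero]
    · exact h.X_mid' i j hj hj2

lemma cv_symm (h : CrData r L s A) (i : ℤ) (q : ℕ) (hq : q ≤ L) :
    cv r L s (i + r + 1 + L - q) q = cv r L s i (L - q) := by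
  set i' := i + r + 1 + L - q with hi'
  have e : ∑ y : Fin (L+1), X r L s A i (i' + ((y : ℕ) : ℤ)) * cv r L s i' y
      = - ∑ x : Fin (L+1), X r L s A i' (i + ((x : ℕ) : ℤ)) * cv r L s i x := by
    unfold X
    simp only [Finset.sum_mul]
    rw [Finset.sum_comm, ← Finset.sum_neg_distrib]
    apply Finset.sum_congr rfl
    intro x _
    rw [← Finset.sum_neg_distrib]
    apply Finset.sum_congr rfl
    intro y _
    rw [h.alt (i + ((x : ℕ) : ℤ)) (i' + ((y : ℕ) : ℤ))]
    ring
  rw [Finset.sum_eq_single (⟨q, by omega⟩ : Fin (L+1)),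
    Finset.sum_eq_single (⟨L - q, by omega⟩ : Fin (L+1))] at e
  · rw [h.X_val, h.X_val, if_pos (by push_cast; omega), if_neg (by push_cast [hq]; omega),
      if_pos (by push_cast [hq]; omega)] at e
    simpa using e
  · intro x _ hx
    have : (x : ℕ) ≠ L - q := fun hh => hx (Fin.ext hh)
    rw [h.X_val, if_neg (by omega), if_neg (by omega), zero_mul]
  · simp
  · intro y _ hy
    have : (y : ℕ) ≠ q := fun hh => hy (Fin.ext hh)
    rw [h.X_val, if_neg (by omega), if_neg (by omega), zero_mul]
  · simp

lemma half (h : CrData r L s A) (i : ℤ) (q : ℕ) (hq : q ≤ L) :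
    s r (L - q) (2 * i + 2 * L - q + r + 1 + (2 * r + 2 + L)) = s r q (2 * i + 2 * L - q + r + 1) := by
  have e := h.cv_symm i q hq
  unfold cv at e
  have e1 : L - (L - q) = q := by omega
  have e2 : ((-1 : R)) ^ (L - q) = (-1) ^ q := by
    have : (-1 : R) ^ (L - q) * (-1) ^ q = 1 := by
      rw [← pow_add, Nat.sub_add_cancel hq, h.hLe.neg_one_pow]
    have h2 : (-1 : R) ^ q * (-1) ^ q = 1 := by rw [← mul_pow]; simp
    linear_combination (-1 : R) ^ q * this - (-1 : R) ^ (L - q) * h2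
  rw [e1, e2] at e
  have hu : IsUnit ((-1 : R) ^ q) := (isUnit_one.neg).pow q
  have e3 := hu.mul_left_cancel e
  push_cast [hq] at e3
  convert e3 using 2 <;> ring

end CrData

/-- type A unfolding -/
def crTau {R : Type*} [CommRing R] (r : ℕ) (T : ℕ → ℕ → ℤ → R) (a m : ℕ) (v : ℤ) : R :=
  if a < r then T a m v
  else if a = r then
    (if Even m then T r (m/2) (v-1) * T r (m/2) (v+1) else T r (m/2) v * T r (m/2+1) v)
  else (if Even m then T r (m/2) v ^ 2 else 0)

lemma crTau_lt {R : Type*} [CommRing R] (r : ℕ) (T : ℕ → ℕ → ℤ → R) (a m : ℕ) (v : ℤ)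
    (h : a < r) : crTau r T a m v = T a m v := by simp [crTau, h]

lemma crTau_even {R : Type*} [CommRing R] (r : ℕ) (T : ℕ → ℕ → ℤ → R) (k : ℕ) (v : ℤ) :
    crTau r T r (2*k) v = T r k (v-1) * T r k (v+1) := by simp [crTau]

lemma crTau_odd {R : Type*} [CommRing R] (r : ℕ) (T : ℕ → ℕ → ℤ → R) (k : ℕ) (v : ℤ) :
    crTau r T r (2*k+1) v = T r k v * T r (k+1) v := by
  have h : ¬ Even (2*k+1) := by simp
  have h2 : (2*k+1)/2 = k := by omega
  simp [crTau, h2]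

lemma crTau1_even {R : Type*} [CommRing R] (r : ℕ) (T : ℕ → ℕ → ℤ → R) (k : ℕ) (v : ℤ) :
    crTau r T (r+1) (2*k) v = T r k v ^ 2 := by simp [crTau]

lemma crTau1_odd {R : Type*} [CommRing R] (r : ℕ) (T : ℕ → ℕ → ℤ → R) (m : ℕ) (v : ℤ)
    (h : Odd m) : crTau r T (r+1) m v = 0 := by
  simp [crTau, h]

/-- octahedron data -/
structure CrOct {R : Type*} [CommRing R] (r L : ℕ) (g : ℕ → ℕ → ℤ → R) : Prop where
  hr : 2 ≤ r
  hL2 : 2 ≤ L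
  hLe : Even L
  top : ∀ m v, g 0 m v = 1
  zero : ∀ a v, a ≤ r + 1 → g a 0 v = 1
  last : ∀ a v, a ≤ r + 1 → g a L v = 1
  odd : ∀ m v, Odd m → g (r+1) m v = 0
  unit : ∀ a m v, a ≤ r → m ≤ L → IsUnit (g a m v)
  unit0 : ∀ m v, Even m → m ≤ L → IsUnit (g (r+1) m v)
  oct : ∀ a m v, 1 ≤ a → a ≤ r → m + 2 ≤ L →
    g a (m+1) (v-1) * g a (m+1) (v+1) = g a m v * g a (m+2) v + g (a-1) (m+1) v * g (a+1) (m+1) v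
  sq : ∀ m v, Even m → m + 2 ≤ L → g (r+1) m v * g (r+1) (m+2) v = g r (m+1) v ^ 2

namespace CrOct
variable {R : Type*} [CommRing R] {r L : ℕ} {g : ℕ → ℕ → ℤ → R}

lemma data (h : CrOct r L g) (ε : ℤ) :
    CrData r L (fun d m v => g (r+1-d) m (v+ε))
      (fun i j => if i ≤ j then
          (if (j-i).toNat ≤ r + 1 then g (r+1-(j-i).toNat) 1 (i+j+ε) else 0)
        else - (if (i-j).toNat ≤ r + 1 then g (r+1-(i-j).toNat) 1 (i+j+ε) else 0)) where
  hr := by have := h.hr; omega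
  hL2 := h.hL2
  hLe := h.hLe
  alt i j := by
    rcases lt_trichotomy i j with hij | hij | hij
    · rw [if_neg (not_le.mpr hij), if_pos hij.le, add_comm j i]
    · subst hij
      simp [h.odd 1 _ odd_one]
    · rw [if_pos hij.le, if_neg (not_le.mpr hij), add_comm j i, neg_neg]
  diag i := by simp [h.odd 1 _ odd_one]
  hA i d hd := by
    have e : (i + (d : ℤ) - i).toNat = d := by omega
    rw [if_pos (by omega), e, if_pos hd]
    congr 1; ring
  hA0 i d hd := by
    have e : (i + (d : ℤ) - i).toNat = d := by omega
    rw [if_pos (by omega), e, if_neg (by omega)]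
  top m v := by simp [h.top]
  zero d v _ := h.zero _ _ (by omega)
  last d v _ := h.last _ _ (by omega)
  odd m v hm := h.odd m _ hm
  unit d m v h1 _ hm := h.unit _ _ _ (by omega) hm
  unit0 m v he hm := h.unit0 _ _ he hm
  oct d m v h1 h2 hm := by
    have := h.oct (r+1-d) m (v+ε) (by omega) (by omega) hm
    have e1 : r + 1 - d - 1 = r + 1 - (d+1) := by omega
    have e2 : r + 1 - d + 1 = r + 1 - (d-1) := by omega
    rw [e1, e2] at this
    rw [show v - 1 + ε = v + ε - 1 by ring, show v + 1 + ε = v + ε + 1 by ring]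
    exact this
  sq m v he hm := by
    have := h.sq m (v+ε) he hm
    simpa using this

lemma half1 (h : CrOct r L g) (v : ℤ) (q : ℕ) (hq : q ≤ L) :
    g 1 (L - q) (v + (2 * r + 2 + L)) = g 1 q v := by
  have e : ∃ i ε : ℤ, v = 2 * i + 2 * L - q + r + 1 + ε := by
    refine ⟨0, v - (2 * L - q + r + 1), by ring⟩
  obtain ⟨i, ε, rfl⟩ := e
  have := (h.data ε).half i q hq
  simp only [show r + 1 - r = 1 by omega] at this
  rw [← this]
  congr 1; ring

lemma half (h : CrOct r L g) (a : ℕ) :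
    (a ≤ r → ∀ m v, m ≤ L → g a (L - m) (v + (2 * r + 2 + L)) = g a m v) ∧
    (a + 1 ≤ r → ∀ m v, m ≤ L → g (a+1) (L - m) (v + (2 * r + 2 + L)) = g (a+1) m v) := by
  induction a with
  | zero =>
    refine ⟨fun _ m v hm => ?_, fun _ m v hm => ?_⟩
    · rw [h.top, h.top]
    · exact h.half1 v m hm
  | succ a ih =>
    refine ⟨ih.2, fun ha m v hm => ?_⟩
    have ih1 := ih.1 (by omega)
    have ih2 := ih.2 (by omega)
    rcases Nat.eq_zero_or_pos m with rfl | hpos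
    · rw [Nat.sub_zero, h.last _ _ (by omega), h.zero _ _ (by omega)]
    rcases Nat.eq_or_lt_of_le hm with rfl | hlt
    · rw [Nat.sub_self, h.last _ _ (by omega), h.zero _ _ (by omega)]
    obtain ⟨m, rfl⟩ : ∃ n, m = n + 1 := ⟨m - 1, by omega⟩
    have o1 := h.oct (a+1) m v (by omega) (by omega) (by omega)
    have o2 := h.oct (a+1) (L - (m+2)) (v + (2 * r + 2 + L)) (by omega) (by omega) (by omega)
    rw [show L - (m+2) + 1 = L - (m+1) by omega, show L - (m+2) + 2 = L - m by omega,
      show v + (2 * (r:ℤ) + 2 + L) - 1 = (v - 1) + (2 * r + 2 + L) by ring,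
      show v + (2 * (r:ℤ) + 2 + L) + 1 = (v + 1) + (2 * r + 2 + L) by ring,
      ih2 _ _ (by omega), ih2 _ _ (by omega), ih2 _ _ (by omega), ih2 _ _ (by omega)] at o2
    simp only [Nat.add_sub_cancel] at o1 o2
    rw [ih1 _ _ (by omega)] at o2
    apply (h.unit a (m+1) v (by omega) (by omega)).mul_left_cancel
    linear_combination o1 - o2

lemma half' (h : CrOct r L g) (a : ℕ) (ha : a ≤ r) (m : ℕ) (v : ℤ) (hm : m ≤ L) :
    g a m (v + (2 * r + 2 + L)) = g a (L - m) v := by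
  have := (h.half a).1 ha (L - m) v (by omega)
  rwa [show L - (L - m) = m by omega] at this

end CrOct

end CrPeriod



/-- Periodicity of the level `ℓ` restricted T-system `𝕋̃_ℓ(C_r)` with the quasi-unit
boundary condition.  The half-integer spectral parameter `u ∈ (1/2)ℤ` is encoded by
the integer `v = 2u`; a shift of `u` by `1/2`, `1`, `r+1+ℓ` corresponds to a shift
of `v` by `1`, `2`, `2(r+1+ℓ)` respectively. -/
theorem restricted_T_Cr_quasiunit_periodicity {R : Type*} [CommRing R]
    (r ℓ : ℕ) (hr : 2 ≤ r) (hℓ : 2 ≤ ℓ)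
    (T : ℕ → ℕ → ℤ → R)
    (h0 : ∀ m v, T 0 m v = 1)
    (hm0 : ∀ a v, a ≤ r → T a 0 v = 1)
    (hm2ℓ : ∀ a v, 1 ≤ a → a ≤ r - 1 → T a (2 * ℓ) v = 1)
    (hunit1 : ∀ a m v, 1 ≤ a → a ≤ r - 1 → 1 ≤ m → m ≤ 2 * ℓ - 1 → IsUnit (T a m v))
    (hunit2 : ∀ m v, 1 ≤ m → m ≤ ℓ - 1 → IsUnit (T r m v))
    (hsq : ∀ v, T r ℓ v ^ 2 = 1)
    (hper : ∀ v, T r ℓ (v + 2) = T r ℓ v)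
    (hsysA : ∀ a m v, 1 ≤ a → a ≤ r - 2 → 1 ≤ m → m ≤ 2 * ℓ - 1 →
      T a m (v - 1) * T a m (v + 1)
        = T a (m - 1) v * T a (m + 1) v + T (a - 1) m v * T (a + 1) m v)
    (hsysB : ∀ m v, 1 ≤ m → m ≤ ℓ - 1 →
      T (r - 1) (2 * m) (v - 1) * T (r - 1) (2 * m) (v + 1)
        = T (r - 1) (2 * m - 1) v * T (r - 1) (2 * m + 1) v
          + T (r - 2) (2 * m) v * (T r m (v - 1) * T r m (v + 1)))
    (hsysC : ∀ m v, m ≤ ℓ - 1 →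
      T (r - 1) (2 * m + 1) (v - 1) * T (r - 1) (2 * m + 1) (v + 1)
        = T (r - 1) (2 * m) v * T (r - 1) (2 * m + 2) v
          + T (r - 2) (2 * m + 1) v * (T r m v * T r (m + 1) v))
    (hsysD : ∀ m v, 1 ≤ m → m ≤ ℓ - 1 →
      T r m (v - 2) * T r m (v + 2)
        = T r (m - 1) v * T r (m + 1) v + T (r - 1) (2 * m) v) :
    (∀ a m v, 1 ≤ a → a ≤ r - 1 → 1 ≤ m → m ≤ 2 * ℓ - 1 →
      T a m (v + 2 * ((r : ℤ) + 1 + ℓ)) = T a (2 * ℓ - m) v) ∧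
    (∀ m v, 1 ≤ m → m ≤ ℓ - 1 →
      T r m (v + 2 * ((r : ℤ) + 1 + ℓ)) = T r ℓ v * T r (ℓ - m) v) ∧
    (∀ a m v, 1 ≤ a → a ≤ r - 1 → 1 ≤ m → m ≤ 2 * ℓ - 1 →
      T a m (v + 4 * ((r : ℤ) + 1 + ℓ)) = T a m v) ∧
    (∀ m v, 1 ≤ m → m ≤ ℓ →
      T r m (v + 4 * ((r : ℤ) + 1 + ℓ)) = T r m v) := by
  have hTl : ∀ v, IsUnit (T r ℓ v) := fun v =>
    IsUnit.of_mul_eq_one (T r ℓ v) (by rw [← sq]; exact hsq v)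
  have hTu : ∀ k v, k ≤ ℓ → IsUnit (T r k v) := by
    intro k v hk
    rcases Nat.eq_zero_or_pos k with rfl | hpos
    · rw [hm0 r v le_rfl]; exact isUnit_one
    rcases Nat.eq_or_lt_of_le hk with rfl | hlt
    · exact hTl v
    · exact hunit2 k v hpos (by omega)
  have H : CrOct r (2*ℓ) (crTau r T) := by
    refine ⟨hr, by omega, even_two_mul ℓ, ?_, ?_, ?_, ?_, ?_, ?_, ?_, ?_⟩
    · intro m v; rw [crTau_lt _ _ _ _ _ (by omega), h0]
    · intro a v ha
      rcases lt_trichotomy a r with h | rfl | h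
      · rw [crTau_lt _ _ _ _ _ h, hm0 _ _ (by omega)]
      · have := crTau_even a T 0 v
        rw [mul_zero] at this
        rw [this, hm0 _ _ le_rfl, hm0 _ _ le_rfl, one_mul]
      · obtain rfl : a = r + 1 := by omega
        have := crTau1_even r T 0 v
        rw [mul_zero] at this
        rw [this, hm0 _ _ le_rfl, one_pow]
    · intro a v ha
      rcases lt_trichotomy a r with h | rfl | h
      · rw [crTau_lt _ _ _ _ _ h]
        rcases Nat.eq_zero_or_pos a with rfl | hpos
        · exact h0 _ _
        · exact hm2ℓ _ _ hpos (by omega)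
      · rw [crTau_even]
        have := hper (v-1)
        rw [show v - 1 + 2 = v + 1 by ring] at this
        rw [this, ← sq, hsq]
      · obtain rfl : a = r + 1 := by omega
        rw [crTau1_even, hsq]
    · intro m v hm; exact crTau1_odd r T m v hm
    · intro a m v ha hm
      rcases Nat.eq_or_lt_of_le ha with rfl | h
      · rcases Nat.even_or_odd' m with ⟨k, rfl | rfl⟩
        · rw [crTau_even]; exact (hTu _ _ (by omega)).mul (hTu _ _ (by omega))
        · rw [crTau_odd]; exact (hTu _ _ (by omega)).mul (hTu _ _ (by omega))
      · rw [crTau_lt _ _ _ _ _ h]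
        rcases Nat.eq_zero_or_pos a with rfl | hpos
        · rw [h0]; exact isUnit_one
        rcases Nat.eq_zero_or_pos m with rfl | hmpos
        · rw [hm0 _ _ (by omega)]; exact isUnit_one
        rcases Nat.eq_or_lt_of_le hm with rfl | hlt
        · rw [hm2ℓ _ _ hpos (by omega)]; exact isUnit_one
        · exact hunit1 _ _ _ hpos (by omega) hmpos (by omega)
    · intro m v he hm
      obtain ⟨k, rfl⟩ := he.two_dvd
      rw [crTau1_even]; exact (hTu _ _ (by omega)).pow 2
    · intro a m v h1 h2 hm
      rcases Nat.eq_or_lt_of_le h2 with rfl | h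
      · rw [crTau_lt a T (a-1) _ _ (by omega)]
        rcases Nat.even_or_odd' m with ⟨k, rfl | rfl⟩
        · rw [crTau1_odd a T _ _ (odd_two_mul_add_one k), crTau_odd, crTau_odd, crTau_even,
            show 2 * k + 2 = 2 * (k+1) by ring, crTau_even]
          ring
        · rw [show 2 * k + 1 + 1 = 2 * (k+1) by ring, show 2 * k + 1 + 2 = 2 * (k+1) + 1 by ring,
            crTau1_even, crTau_odd, crTau_odd, crTau_even, crTau_even]
          have := hsysD (k+1) v (by omega) (by omega)
          rw [Nat.add_sub_cancel] at this
          rw [show v - 1 - 1 = v - 2 by ring, show v - 1 + 1 = v by ring,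
            show v + 1 - 1 = v by ring, show v + 1 + 1 = v + 2 by ring]
          linear_combination (T a (k+1) v)^2 * this
      · rw [crTau_lt _ _ a _ _ h, crTau_lt _ _ a _ _ h, crTau_lt _ _ a _ _ h, crTau_lt _ _ a _ _ h,
          crTau_lt _ _ (a-1) _ _ (by omega)]
        rcases Nat.lt_or_ge (a+1) r with h' | h'
        · rw [crTau_lt _ _ (a+1) _ _ h']
          have := hsysA a (m+1) v h1 (by omega) (by omega) (by omega)
          rw [Nat.add_sub_cancel] at this
          exact this
        · obtain rfl : r = a + 1 := by omega
          rcases Nat.even_or_odd' m with ⟨k, rfl | rfl⟩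
          · rw [crTau_odd]
            have := hsysC k v (by omega)
            simpa using this
          · rw [show 2 * k + 1 + 1 = 2 * (k+1) by ring, crTau_even]
            have := hsysB (k+1) v (by omega) (by omega)
            rw [show 2 * (k+1) - 1 = 2 * k + 1 by omega,
              show 2 * (k+1) + 1 = 2 * k + 1 + 2 by omega,
              show a + 1 - 2 = a - 1 by omega, Nat.add_sub_cancel] at this
            exact this
    · intro m v he hm
      obtain ⟨k, rfl⟩ := he.two_dvd
      rw [show 2 * k + 2 = 2 * (k+1) by ring, crTau1_even, crTau1_even, crTau_odd]
      ring
  have C1 : ∀ a m v, 1 ≤ a → a ≤ r - 1 → 1 ≤ m → m ≤ 2 * ℓ - 1 →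
      T a m (v + 2 * ((r : ℤ) + 1 + ℓ)) = T a (2 * ℓ - m) v := by
    intro a m v h1 h2 h3 h4
    have := H.half' a (by omega) m v (by omega)
    rw [crTau_lt _ _ _ _ _ (by omega), crTau_lt _ _ _ _ _ (by omega)] at this
    rw [← this]; congr 1; push_cast; ring
  have C2' : ∀ m v, m ≤ ℓ - 1 →
      T r (m+1) (v + 2 * ((r : ℤ) + 1 + ℓ)) = T r ℓ v * T r (ℓ - (m+1)) v := by
    intro m
    induction m with
    | zero =>
      intro v _
      have := H.half' r le_rfl (2*0+1) v (by omega)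
      rw [crTau_odd, show 2 * ℓ - (2*0+1) = 2 * (ℓ-1) + 1 by omega, crTau_odd,
        hm0 _ _ le_rfl, one_mul, show ℓ - 1 + 1 = ℓ by omega] at this
      rw [zero_add, mul_comm (T r ℓ v), ← this, zero_add]; congr 1; push_cast; ring
    | succ m ih =>
      intro v hm
      have := H.half' r le_rfl (2*(m+1)+1) v (by omega)
      rw [crTau_odd, show 2 * ℓ - (2*(m+1)+1) = 2 * (ℓ-(m+2)) + 1 by omega, crTau_odd,
        show ℓ - (m+2) + 1 = ℓ - (m+1) by omega,
        show v + (2 * (r:ℤ) + 2 + (2 * ℓ : ℕ)) = v + 2 * ((r : ℤ) + 1 + ℓ) by push_cast; ring,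
        ih v (by omega)] at this
      apply ((hTl v).mul (hTu (ℓ - (m+1)) v (by omega))).mul_left_cancel
      rw [this]
      have := hsq v
      rw [show ℓ - (m + 1 + 1) = ℓ - (m+2) by omega]
      linear_combination (-(T r (ℓ - (m+2)) v * T r (ℓ - (m+1)) v)) * this
  have C2 : ∀ m v, 1 ≤ m → m ≤ ℓ →
      T r m (v + 2 * ((r : ℤ) + 1 + ℓ)) = T r ℓ v * T r (ℓ - m) v := by
    intro m v h1 h2
    have := C2' (m-1) v (by omega)
    rwa [show m - 1 + 1 = m by omega] at this
  have e4 : ∀ v : ℤ, v + 4 * ((r : ℤ) + 1 + ℓ)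
    = (v + 2 * ((r : ℤ) + 1 + ℓ)) + 2 * ((r : ℤ) + 1 + ℓ) := fun v => by ring
  have Cl : ∀ v, T r ℓ (v + 2 * ((r : ℤ) + 1 + ℓ)) = T r ℓ v := by
    intro v
    rw [C2 ℓ v (by omega) le_rfl, Nat.sub_self, hm0 _ _ le_rfl, mul_one]
  refine ⟨C1, fun m v h1 h2 => C2 m v h1 (by omega), ?_, ?_⟩
  · intro a m v h1 h2 h3 h4
    rw [e4, C1 _ _ _ h1 h2 h3 h4, C1 _ _ _ h1 h2 (by omega) (by omega),
      show 2 * ℓ - (2 * ℓ - m) = m by omega]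
  · intro m v h1 h2
    rcases Nat.eq_or_lt_of_le h2 with rfl | hlt
    · rw [e4, Cl, Cl]
    · rw [e4, C2 _ _ h1 h2, Cl, C2 _ _ (by omega) (by omega),
        show ℓ - (ℓ - m) = m by omega]
      have := hsq v
      linear_combination (T r m v) * this
end
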